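/- Let n ≥ 4 and let (u, p) be a smooth solution of the steady Navier-Stokes equations on ℝⁿ \ B₁ (the complement of the closed unit ball). If there is a constant C > 0 such that |u(x)| ≤ C/|x| for all x with |x| ≥ 1, then there exists a constant C̃ > 0 such that |u(x)| ≤ C̃/|x|^{n−2} for all x with |x| ≥ 1. -/

import Mathlib

namespace SteadyNS

open MeasureTheory Set Filter Topology
open scoped ContDiff

/-- The partial derivative of `f` in the `i`-th coordinate direction. -/
noncomputable def pd {n : ℕ} (i : Fin n) (f : EuclideanSpace ℝ (Fin n) → ℝ)
    (x : EuclideanSpace ℝ (Fin n)) : ℝ :=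
  fderiv ℝ f x (EuclideanSpace.single i 1)

/-- The Laplacian as a sum of second partial derivatives. -/
noncomputable def lap {n : ℕ} (f : EuclideanSpace ℝ (Fin n) → ℝ)
    (x : EuclideanSpace ℝ (Fin n)) : ℝ :=
  ∑ i, pd i (pd i f) x

section Calculus

variable {n : ℕ} {f g : EuclideanSpace ℝ (Fin n) → ℝ}

@[fun_prop]
theorem contDiff_pd (i : Fin n) (hf : ContDiff ℝ ∞ f) : ContDiff ℝ ∞ (pd i f) := by
  unfold pd
  exact (hf.fderiv_right (m := ∞) (by simp)).clm_apply contDiff_const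

@[fun_prop]
theorem contDiff_lap (hf : ContDiff ℝ ∞ f) : ContDiff ℝ ∞ (lap f) := by
  unfold lap
  fun_prop

theorem pd_congr {s : Set (EuclideanSpace ℝ (Fin n))} (hs : IsOpen s)
    (h : ∀ x ∈ s, f x = g x) (i : Fin n) : ∀ x ∈ s, pd i f x = pd i g x := by
  intro x hx
  unfold pd
  rw [Filter.EventuallyEq.fderiv_eq]
  exact Filter.eventuallyEq_of_mem (hs.mem_nhds hx) h

theorem pd_add (hf : ContDiff ℝ ∞ f) (hg : ContDiff ℝ ∞ g) (i : Fin n)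
    (x : EuclideanSpace ℝ (Fin n)) :
    pd i (fun y => f y + g y) x = pd i f x + pd i g x := by
  unfold pd
  rw [fderiv_fun_add (hf.differentiable (by simp) x) (hg.differentiable (by simp) x)]
  simp

theorem pd_sub (hf : ContDiff ℝ ∞ f) (hg : ContDiff ℝ ∞ g) (i : Fin n)
    (x : EuclideanSpace ℝ (Fin n)) :
    pd i (fun y => f y - g y) x = pd i f x - pd i g x := by
  unfold pd
  rw [fderiv_fun_sub (hf.differentiable (by simp) x) (hg.differentiable (by simp) x)]
  simp

theorem pd_neg (i : Fin n) (x : EuclideanSpace ℝ (Fin n)) :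
    pd i (fun y => - f y) x = - pd i f x := by
  unfold pd
  rw [fderiv_fun_neg]
  simp

theorem pd_const (c : ℝ) (i : Fin n) (x : EuclideanSpace ℝ (Fin n)) :
    pd i (fun _ => c) x = 0 := by
  unfold pd
  simp

theorem pd_mul (hf : ContDiff ℝ ∞ f) (hg : ContDiff ℝ ∞ g) (i : Fin n)
    (x : EuclideanSpace ℝ (Fin n)) :
    pd i (fun y => f y * g y) x = pd i f x * g x + f x * pd i g x := by
  unfold pd
  rw [fderiv_fun_mul (hf.differentiable (by simp) x) (hg.differentiable (by simp) x)]
  simp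
  ring

theorem pd_const_mul (c : ℝ) (hf : ContDiff ℝ ∞ f) (i : Fin n)
    (x : EuclideanSpace ℝ (Fin n)) :
    pd i (fun y => c * f y) x = c * pd i f x := by
  rw [pd_mul contDiff_const hf, pd_const]
  ring

theorem pd_sum {ι : Type*} (s : Finset ι) {F : ι → EuclideanSpace ℝ (Fin n) → ℝ}
    (hF : ∀ k, ContDiff ℝ ∞ (F k)) (i : Fin n) (x : EuclideanSpace ℝ (Fin n)) :
    pd i (fun y => ∑ k ∈ s, F k y) x = ∑ k ∈ s, pd i (F k) x := by
  unfold pd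
  rw [fderiv_fun_sum (fun k _ => (hF k).differentiable (by simp) x)]
  simp

theorem pd_comm (hf : ContDiff ℝ ∞ f) (i j : Fin n) (x : EuclideanSpace ℝ (Fin n)) :
    pd i (pd j f) x = pd j (pd i f) x := by
  have key : ∀ i j : Fin n, pd i (pd j f) x =
      fderiv ℝ (fderiv ℝ f) x (EuclideanSpace.single i 1) (EuclideanSpace.single j 1) := by
    intro i j
    unfold pd
    have hd : DifferentiableAt ℝ (fderiv ℝ f) x :=
      (hf.fderiv_right (m := ∞) (by simp)).differentiable (by simp) x
    rw [fderiv_clm_apply hd (differentiableAt_const _)]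
    simp
  rw [key, key]
  have := (hf.contDiffAt (x := x)).isSymmSndFDerivAt
    (by simp only [minSmoothness_of_isRCLikeNormedField]; exact WithTop.coe_le_coe.2 le_top)
  exact this _ _

theorem pd_coord (i j : Fin n) (x : EuclideanSpace ℝ (Fin n)) :
    pd i (fun y => y j) x = if i = j then 1 else 0 := by
  unfold pd
  have : (fun y : EuclideanSpace ℝ (Fin n) => y j) =
      (EuclideanSpace.proj j : EuclideanSpace ℝ (Fin n) →L[ℝ] ℝ) := rfl
  rw [this, ContinuousLinearMap.fderiv]
  simp [eq_comm]

theorem pd_comp {F : ℝ → ℝ} (hF : ContDiff ℝ ∞ F) (hf : ContDiff ℝ ∞ f) (i : Fin n)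
    (x : EuclideanSpace ℝ (Fin n)) :
    pd i (fun y => F (f y)) x = deriv F (f x) * pd i f x := by
  unfold pd
  have h1 : HasDerivAt F (deriv F (f x)) (f x) :=
    (hF.differentiable (by simp) _).hasDerivAt
  have h2 := (hf.differentiable (by simp) x).hasFDerivAt
  have h3 : HasFDerivAt (fun y => F (f y)) (deriv F (f x) • fderiv ℝ f x) x :=
    h1.comp_hasFDerivAt x h2
  rw [h3.fderiv]
  simp

@[fun_prop]
theorem contDiff_norm_sq' : ContDiff ℝ ∞ (fun x : EuclideanSpace ℝ (Fin n) => ‖x‖ ^ 2) :=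
  contDiff_norm_sq ℝ

theorem pd_norm_sq (i : Fin n) (x : EuclideanSpace ℝ (Fin n)) :
    pd i (fun y => ‖y‖ ^ 2) x = 2 * x i := by
  have : (fun y : EuclideanSpace ℝ (Fin n) => ‖y‖ ^ 2) = fun y => ∑ j, y j * y j := by
    funext y
    rw [EuclideanSpace.real_norm_sq_eq]
    exact Finset.sum_congr rfl fun j _ => sq _
  have hc : ∀ k : Fin n, ContDiff ℝ ∞ (fun y : EuclideanSpace ℝ (Fin n) => y k) :=
    fun k => by fun_prop
  rw [this, pd_sum _ (fun k => by fun_prop)]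
  simp_rw [fun k : Fin n => pd_mul (hc k) (hc k) i x, pd_coord]
  simp [Finset.sum_add_distrib]
  ring

/-- A smooth function of the squared norm. -/
theorem pd_radial {F : ℝ → ℝ} (hF : ContDiff ℝ ∞ F) (i : Fin n)
    (x : EuclideanSpace ℝ (Fin n)) :
    pd i (fun y => F (‖y‖ ^ 2)) x = 2 * x i * deriv F (‖x‖ ^ 2) := by
  rw [pd_comp hF (by fun_prop), pd_norm_sq]
  ring

theorem pd_pd_radial {F : ℝ → ℝ} (hF : ContDiff ℝ ∞ F) (i j : Fin n)
    (x : EuclideanSpace ℝ (Fin n)) :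
    pd i (pd j (fun y => F (‖y‖ ^ 2))) x =
      (if i = j then 2 * deriv F (‖x‖ ^ 2) else 0)
        + 4 * x i * x j * deriv (deriv F) (‖x‖ ^ 2) := by
  have hF' : ContDiff ℝ ∞ (deriv F) := hF.deriv' 
  have : pd j (fun y : EuclideanSpace ℝ (Fin n) => F (‖y‖ ^ 2)) =
      fun y => (2 * y j) * deriv F (‖y‖ ^ 2) := by
    funext y; exact pd_radial hF j y
  have hF'' : ContDiff ℝ ∞ (fun y : EuclideanSpace ℝ (Fin n) => deriv F (‖y‖ ^ 2)) :=
    hF'.comp contDiff_norm_sq'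
  rw [this, pd_mul (by fun_prop) hF'', pd_radial hF',
    pd_const_mul _ (by fun_prop), pd_coord]
  split_ifs <;> ring

theorem sum_sq_eq (x : EuclideanSpace ℝ (Fin n)) : ∑ i, x i * x i = ‖x‖ ^ 2 := by
  rw [EuclideanSpace.real_norm_sq_eq]
  exact Finset.sum_congr rfl fun j _ => (sq _).symm

theorem lap_radial {F : ℝ → ℝ} (hF : ContDiff ℝ ∞ F) (x : EuclideanSpace ℝ (Fin n)) :
    lap (fun y => F (‖y‖ ^ 2)) x =
      2 * n * deriv F (‖x‖ ^ 2) + 4 * ‖x‖ ^ 2 * deriv (deriv F) (‖x‖ ^ 2) := by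
  unfold lap
  have : ∀ i, pd i (pd i (fun y : EuclideanSpace ℝ (Fin n) => F (‖y‖ ^ 2))) x =
      2 * deriv F (‖x‖ ^ 2) + 4 * deriv (deriv F) (‖x‖ ^ 2) * (x i * x i) := by
    intro i
    rw [pd_pd_radial hF, if_pos rfl]
    ring
  rw [Finset.sum_congr rfl fun i _ => this i, Finset.sum_add_distrib,
    ← Finset.mul_sum (f := fun i => x i * x i), sum_sq_eq]
  simp
  ring

theorem hasCompactSupport_pd (hf : HasCompactSupport f) (i : Fin n) :
    HasCompactSupport (pd i f) := by
  unfold pd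
  exact hf.fderiv_apply ℝ _

theorem integral_mul_pd (hf : ContDiff ℝ ∞ f) (hg : ContDiff ℝ ∞ g)
    (hs : HasCompactSupport g) (i : Fin n) :
    ∫ x, f x * pd i g x = - ∫ x, pd i f x * g x := by
  have hc : ∀ {u v : EuclideanSpace ℝ (Fin n) → ℝ}, Continuous u → Continuous v →
      HasCompactSupport v → Integrable (fun x => u x * v x) := fun hu hv hvs =>
    (hu.mul hv).integrable_of_hasCompactSupport hvs.mul_left
  unfold pd
  exact integral_mul_fderiv_eq_neg_fderiv_mul_of_integrable
    (hc (contDiff_pd i hf).continuous hg.continuous hs)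
    (hc hf.continuous (contDiff_pd i hg).continuous (hasCompactSupport_pd hs i))
    (hc hf.continuous hg.continuous hs)
    (fun x _ => hf.differentiable (by simp) x) (fun x _ => hg.differentiable (by simp) x)

end Calculus

theorem nonneg_of_isLocalMin_of_hasDerivAt {g g' : ℝ → ℝ} {d : ℝ} (hmin : IsLocalMin g 0)
    (hg : ∀ s, HasDerivAt g (g' s) s) (hg' : HasDerivAt g' d 0) : 0 ≤ d := by
  by_contra! hd
  have hderiv : deriv g = g' := funext fun s => (hg s).deriv
  have h0 : deriv g 0 = 0 := hmin.deriv_eq_zero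
  have hmax : IsLocalMax g 0 := by
    apply isLocalMax_of_deriv_deriv_neg _ h0 (hg 0).continuousAt
    rw [hderiv, hg'.deriv]
    exact hd
  have hconst : ∀ᶠ s in 𝓝 (0 : ℝ), g s = g 0 := by
    filter_upwards [hmin, hmax] with s h1 h2 using le_antisymm h2 h1
  have hconst' : ∀ᶠ s in 𝓝 (0 : ℝ), g' s = 0 := by
    filter_upwards [hconst.eventually_nhds] with s hs
    rw [← hderiv]
    have : g =ᶠ[𝓝 s] fun _ => g 0 := hs
    rw [this.deriv_eq]
    simp
  have : HasDerivAt g' 0 0 :=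
    (hasDerivAt_const (0 : ℝ) (0 : ℝ)).congr_of_eventuallyEq hconst'
  linarith [this.unique hg']

section

variable {n : ℕ} {w : EuclideanSpace ℝ (Fin n) → ℝ}

theorem hasDerivAt_line (hw : ContDiff ℝ ∞ w) (z : EuclideanSpace ℝ (Fin n)) (k : Fin n)
    (c s : ℝ) :
    HasDerivAt (fun s : ℝ => w (z + (c * s) • EuclideanSpace.single k (1 : ℝ)))
      (c * pd k w (z + (c * s) • EuclideanSpace.single k (1 : ℝ))) s := by
  have h1 := (hw.differentiable (by simp)
    (z + (c * s) • EuclideanSpace.single k (1 : ℝ))).hasFDerivAt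
  have h2 : HasDerivAt (fun s : ℝ => z + (c * s) • EuclideanSpace.single k (1 : ℝ))
      (c • EuclideanSpace.single k (1 : ℝ)) s := by
    have := (((hasDerivAt_id s).const_mul c).smul_const
      (EuclideanSpace.single k (1 : ℝ))).const_add z
    simpa using this
  have h3 := h1.comp_hasDerivAt s h2
  have h4 : HasDerivAt (fun s : ℝ => w (z + (c * s) • EuclideanSpace.single k (1 : ℝ))) _ s := h3
  exact h4.congr_deriv (by simp [pd])

/-- One-sided form of the interior gradient estimate for Poisson's equation, by comparison with
a quadratic barrier on a half cube. -/
theorem pd_le_of_lap_bound (hw : ContDiff ℝ ∞ w) (x : EuclideanSpace ℝ (Fin n)) {t M N : ℝ}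
    (ht : 0 < t) (hM : ∀ y : EuclideanSpace ℝ (Fin n), (∀ k, |y k - x k| ≤ t) → |w y| ≤ M)
    (hN : ∀ y : EuclideanSpace ℝ (Fin n), (∀ k, |y k - x k| ≤ t) → |lap w y| ≤ N) (i : Fin n) :
    pd i w x ≤ n * M / t + t / 2 * N := by
  have hM0 : 0 ≤ M := (abs_nonneg _).trans (hM x (by simp [ht.le]))
  have hN0 : 0 ≤ N := (abs_nonneg _).trans (hN x (by simp [ht.le]))
  have main : ∀ N', N < N' → pd i w x ≤ (n * M / t ^ 2 + N' / 2) * t := by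
    intro N' hN'
    set κ : ℝ := n * M / t ^ 2 + N' / 2 with hκ
    have hκ0 : 0 ≤ κ := by have : 0 ≤ N' := hN0.trans hN'.le; positivity
    let σ : EuclideanSpace ℝ (Fin n) → EuclideanSpace ℝ (Fin n) := fun y =>
      y + (-2 * (y i - x i)) • EuclideanSpace.single i (1 : ℝ)
    have hσ : ∀ y k, σ y k = if k = i then 2 * x i - y i else y k := by
      intro y k
      by_cases h : k = i
      · subst h; simp [σ]; ring
      · simp [σ, h]
    let K : Set (EuclideanSpace ℝ (Fin n)) := {y | (∀ k, |y k - x k| ≤ t) ∧ 0 ≤ y i - x i}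
    have hKσ : ∀ y, (∀ k, |y k - x k| ≤ t) → ∀ k, |σ y k - x k| ≤ t := by
      intro y hy k
      rw [hσ]
      split_ifs with h
      · subst h
        have := hy k
        rw [abs_sub_comm] at this
        convert this using 2
        ring
      · exact hy k
    let Ψ : EuclideanSpace ℝ (Fin n) → ℝ := fun y =>
      M / t ^ 2 * ∑ k, (y k - x k) ^ 2 + κ * ((y i - x i) * (t - (y i - x i)))
        - (w y - w (σ y)) / 2
    have hKclosed : IsClosed K := by
      have : K = (⋂ k, {y | |y k - x k| ≤ t}) ∩ {y | 0 ≤ y i - x i} := by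
        ext y; simp [K]
      rw [this]
      refine (isClosed_iInter fun k => isClosed_le (by fun_prop) (by fun_prop)).inter
        (isClosed_le (by fun_prop) (by fun_prop))
    have hKbdd : K ⊆ Metric.closedBall x (Real.sqrt (∑ _k : Fin n, t ^ 2)) := by
      intro y hy
      rw [Metric.mem_closedBall, EuclideanSpace.dist_eq]
      apply Real.sqrt_le_sqrt
      refine Finset.sum_le_sum fun k _ => ?_
      rw [Real.dist_eq]
      exact pow_le_pow_left₀ (abs_nonneg _) (hy.1 k) 2
    have hKc : IsCompact K :=
      (isCompact_closedBall _ _).of_isClosed_subset hKclosed hKbdd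
    have hKne : K.Nonempty := ⟨x, by simp [K, ht.le]⟩
    have hσc : Continuous σ := by fun_prop
    have hwc : Continuous w := hw.continuous
    have hΨc : Continuous Ψ := by fun_prop
    obtain ⟨y, hyK, hymin⟩ := hKc.exists_isMinOn hKne hΨc.continuousOn
    have hΨy : 0 ≤ Ψ y := by
      by_contra! hneg
      have hge : ∀ k, (y k - x k) ^ 2 ≤ ∑ k, (y k - x k) ^ 2 := fun k =>
        Finset.single_le_sum (f := fun k => (y k - x k) ^ 2) (fun _ _ => sq_nonneg _)
          (Finset.mem_univ k)
      have hai : y i - x i ≤ t := (abs_le.1 (hyK.1 i)).2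
      have hquad : 0 ≤ κ * ((y i - x i) * (t - (y i - x i))) :=
        mul_nonneg hκ0 (mul_nonneg hyK.2 (by linarith))
      have hdiff : (w y - w (σ y)) / 2 ≤ M := by
        have h1 := abs_le.1 (hM y hyK.1)
        have h2 := abs_le.1 (hM _ (hKσ y hyK.1))
        linarith [h1.2, h2.1]
      have hlt : ∀ k, |y k - x k| < t := by
        intro k
        refine lt_of_le_of_ne (hyK.1 k) fun heq => ?_
        have h1 : t ^ 2 ≤ ∑ k, (y k - x k) ^ 2 := by
          rw [← heq, sq_abs]; exact hge k
        have h2 : M ≤ M / t ^ 2 * ∑ k, (y k - x k) ^ 2 := by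
          calc M = M / t ^ 2 * t ^ 2 := by field_simp
            _ ≤ _ := by gcongr
        simp only [Ψ] at hneg
        linarith
      have hpos : 0 < y i - x i := by
        refine lt_of_le_of_ne hyK.2 fun heq => ?_
        have : σ y = y := by
          simp [σ, ← heq]
        simp only [Ψ, this] at hneg
        have : 0 ≤ M / t ^ 2 * ∑ k, (y k - x k) ^ 2 := by positivity
        linarith
      have hnhds : ∀ᶠ z in 𝓝 y, z ∈ K := by
        have h1 : ∀ᶠ z in 𝓝 y, ∀ k, |z k - x k| < t := by
          rw [eventually_all]
          intro k
          exact (Continuous.tendsto (by fun_prop) y).eventually_lt_const (hlt k)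
        have h2 : ∀ᶠ z in 𝓝 y, 0 < z i - x i :=
          (Continuous.tendsto (by fun_prop) y).eventually_const_lt hpos
        filter_upwards [h1, h2] with z h1 h2 using ⟨fun k => (h1 k).le, h2.le⟩
      let c : Fin n → ℝ := fun k => if k = i then -1 else 1
      have hline : ∀ k : Fin n, 0 ≤ 2 * (M / t ^ 2) - (if k = i then 2 * κ else 0)
          - (pd k (pd k w) y - pd k (pd k w) (σ y)) / 2 := by
        intro k
        let e : EuclideanSpace ℝ (Fin n) := EuclideanSpace.single k (1 : ℝ)
        let δ : ℝ := if k = i then 1 else 0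
        have hΨline : ∀ s : ℝ, Ψ (y + s • e) =
            M / t ^ 2 * (∑ j, (y j - x j) ^ 2 + 2 * s * (y k - x k) + s ^ 2)
            + κ * ((y i - x i + δ * s) * (t - (y i - x i + δ * s)))
            - (w (y + (1 * s) • EuclideanSpace.single k (1 : ℝ))
              - w (σ y + (c k * s) • EuclideanSpace.single k (1 : ℝ))) / 2 := by
          intro s
          have e1 : ∑ j, ((y + s • e) j - x j) ^ 2 =
              ∑ j, (y j - x j) ^ 2 + 2 * s * (y k - x k) + s ^ 2 := by
            have : ∀ j, ((y + s • e) j - x j) ^ 2 = (y j - x j) ^ 2 +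
                (if j = k then 2 * s * (y k - x k) + s ^ 2 else 0) := by
              intro j
              by_cases h : j = k
              · subst h; simp [e]; ring
              · simp [e, h]
            simp_rw [this, Finset.sum_add_distrib]
            simp
            ring
          have e2 : (y + s • e) i - x i = y i - x i + δ * s := by
            by_cases h : k = i
            · subst h; simp [e, δ]; ring
            · simp [e, δ, h, Ne.symm h]
          have e3 : σ (y + s • e) = σ y + (c k * s) • EuclideanSpace.single k (1 : ℝ) := by
            ext j
            simp only [hσ, PiLp.add_apply, PiLp.smul_apply]
            by_cases h : k = i
            · subst h
              by_cases h' : j = k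
              · subst h'; simp [e, c]; ring
              · simp [e, h']
            · by_cases h' : j = i
              · subst h'; simp [e, Ne.symm h]
              · simp [e, c, h, h']
          simp only [Ψ]
          rw [e1, e2, e3, one_mul]
        have hloc : IsLocalMin (fun s : ℝ => Ψ (y + s • e)) 0 := by
          have ht0 : Tendsto (fun s : ℝ => y + s • e) (𝓝 0) (𝓝 y) := by
            have : Continuous (fun s : ℝ => y + s • e) := by fun_prop
            simpa using this.tendsto 0
          filter_upwards [ht0.eventually hnhds] with s hs
          simpa using hymin hs
        have hd1 : ∀ s, HasDerivAt (fun s : ℝ => Ψ (y + s • e))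
            (M / t ^ 2 * (2 * (y k - x k) + 2 * s)
              + κ * (δ * (t - (y i - x i + δ * s)) - δ * (y i - x i + δ * s))
              - (1 * pd k w (y + (1 * s) • EuclideanSpace.single k (1 : ℝ))
                - c k * pd k w (σ y + (c k * s) • EuclideanSpace.single k (1 : ℝ))) / 2) s := by
          intro s
          simp_rw [hΨline]
          have a1 : HasDerivAt (fun s : ℝ => ∑ j, (y j - x j) ^ 2 + 2 * s * (y k - x k) + s ^ 2)
              (2 * (y k - x k) + 2 * s) s := by
            have := (((((hasDerivAt_id s).const_mul 2).mul_const (y k - x k)).const_add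
              (∑ j, (y j - x j) ^ 2))).fun_add ((hasDerivAt_id s).fun_pow 2)
            exact this.congr_deriv (by simp)
          have a2 : HasDerivAt (fun s : ℝ => y i - x i + δ * s) δ s := by
            simpa using ((hasDerivAt_id s).const_mul δ).const_add (y i - x i)
          have a3 : HasDerivAt (fun s : ℝ => (y i - x i + δ * s) * (t - (y i - x i + δ * s)))
              (δ * (t - (y i - x i + δ * s)) - δ * (y i - x i + δ * s)) s := by
            exact (a2.fun_mul (a2.const_sub t)).congr_deriv (by ring)
          exact ((a1.const_mul _).add (a3.const_mul _)).sub
            (((hasDerivAt_line hw y k 1 s).sub (hasDerivAt_line hw (σ y) k (c k) s)).div_const 2)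
        have hd2 : HasDerivAt (fun s : ℝ => (M / t ^ 2 * (2 * (y k - x k) + 2 * s)
              + κ * (δ * (t - (y i - x i + δ * s)) - δ * (y i - x i + δ * s))
              - (1 * pd k w (y + (1 * s) • EuclideanSpace.single k (1 : ℝ))
                - c k * pd k w (σ y + (c k * s) • EuclideanSpace.single k (1 : ℝ))) / 2))
            (M / t ^ 2 * 2 + κ * (-(2 * δ ^ 2))
              - (1 * (1 * pd k (pd k w) (y + (1 * (0 : ℝ)) • EuclideanSpace.single k (1 : ℝ)))
                - c k * (c k *
                  pd k (pd k w) (σ y + (c k * 0) • EuclideanSpace.single k (1 : ℝ)))) / 2) 0 := by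
          have a2 : HasDerivAt (fun s : ℝ => y i - x i + δ * s) δ 0 := by
            simpa using ((hasDerivAt_id (0 : ℝ)).const_mul δ).const_add (y i - x i)
          have a1 : HasDerivAt (fun s : ℝ => 2 * (y k - x k) + 2 * s) 2 0 := by
            simpa using ((hasDerivAt_id (0 : ℝ)).const_mul 2).const_add (2 * (y k - x k))
          have a3 : HasDerivAt
              (fun s : ℝ => δ * (t - (y i - x i + δ * s)) - δ * (y i - x i + δ * s))
              (-(2 * δ ^ 2)) 0 := by
            exact (((a2.const_sub t).const_mul δ).fun_sub (a2.const_mul δ)).congr_deriv (by ring)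
          exact ((a1.const_mul _).add (a3.const_mul _)).sub
            ((((hasDerivAt_line (contDiff_pd k hw) y k 1 0).const_mul 1).sub
              ((hasDerivAt_line (contDiff_pd k hw) (σ y) k (c k) 0).const_mul (c k))).div_const 2)
        have := nonneg_of_isLocalMin_of_hasDerivAt hloc hd1 hd2
        have hc : c k * (c k * pd k (pd k w) (σ y)) = pd k (pd k w) (σ y) := by
          by_cases h : k = i <;> simp [c, h]
        simp only [mul_zero, zero_smul, add_zero, one_mul, hc] at this
        have hδ : κ * (-(2 * δ ^ 2)) = - (if k = i then 2 * κ else 0) := by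
          by_cases h : k = i
          · simp [δ, h]; ring
          · simp [δ, h]
        linarith
      have hsum := Finset.sum_nonneg fun k (_ : k ∈ Finset.univ) => hline k
      rw [Finset.sum_sub_distrib, Finset.sum_sub_distrib, ← Finset.sum_div,
        Finset.sum_sub_distrib] at hsum
      have h1 := abs_le.1 (hN y hyK.1)
      have h2 := abs_le.1 (hN _ (hKσ y hyK.1))
      unfold lap at h1 h2
      simp at hsum
      have : κ = n * (M / t ^ 2) + N' / 2 := by rw [hκ]; ring
      linarith [h1.1, h2.2]
    have hΨ : ∀ z ∈ K, 0 ≤ Ψ z := fun z hz => hΨy.trans (hymin hz)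
    have hline : ∀ s ∈ Ioo (0 : ℝ) t, (w (x + (1 * s) • EuclideanSpace.single i (1 : ℝ)) -
        w (x + (-1 * s) • EuclideanSpace.single i (1 : ℝ))) / 2
          ≤ M / t ^ 2 * s ^ 2 + κ * (s * (t - s)) := by
      intro s hs
      have hmem : x + s • EuclideanSpace.single i (1 : ℝ) ∈ K := by
        refine ⟨fun k => ?_, by simp [hs.1.le]⟩
        by_cases h : k = i
        · subst h; simpa [abs_of_pos hs.1] using hs.2.le
        · simp [h, ht.le]
      have h0 := hΨ _ hmem
      have e3 : σ (x + s • EuclideanSpace.single i (1 : ℝ)) =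
          x + (-1 * s) • EuclideanSpace.single i (1 : ℝ) := by
        ext j
        by_cases h : j = i
        · subst h; simp [hσ]; ring
        · simp [hσ, h]
      have e1 : ∑ j, ((x + s • EuclideanSpace.single i (1 : ℝ)) j - x j) ^ 2 = s ^ 2 := by
        have : ∀ j, ((x + s • EuclideanSpace.single i (1 : ℝ)) j - x j) ^ 2 =
            if j = i then s ^ 2 else 0 := by
          intro j
          by_cases h : j = i
          · subst h; simp
          · simp [h]
        simp_rw [this]
        simp
      simp only [Ψ] at h0
      rw [e3, e1] at h0
      simp at h0
      simp
      linarith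
    have hder : HasDerivAt (fun s : ℝ => M / t ^ 2 * s ^ 2 + κ * (s * (t - s)) -
        (w (x + (1 * s) • EuclideanSpace.single i (1 : ℝ)) -
        w (x + (-1 * s) • EuclideanSpace.single i (1 : ℝ))) / 2) (κ * t - pd i w x) 0 := by
      have h1 := (hasDerivAt_line hw x i 1 0).sub (hasDerivAt_line hw x i (-1) 0)
      have h2 : HasDerivAt (fun s : ℝ => M / t ^ 2 * s ^ 2 + κ * (s * (t - s))) (κ * t) 0 := by
        have a := ((hasDerivAt_id (0 : ℝ)).fun_pow 2).const_mul (M / t ^ 2)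
        have b := ((hasDerivAt_id (0 : ℝ)).fun_mul ((hasDerivAt_id (0 : ℝ)).const_sub t)).const_mul κ
        exact (a.fun_add b).congr_deriv (by simp)
      exact (h2.fun_sub (h1.div_const 2)).congr_deriv (by simp)
    have hge := hder.hasDerivWithinAt (s := Ioi (0 : ℝ))
    rw [hasDerivWithinAt_iff_tendsto_slope' (by simp)] at hge
    have : 0 ≤ κ * t - pd i w x := by
      refine ge_of_tendsto hge ?_
      filter_upwards [Ioo_mem_nhdsGT ht] with s hs
      rw [slope_def_field]
      refine div_nonneg ?_ (by simpa using hs.1.le)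
      have := hline s hs
      simp at this ⊢
      linarith
    linarith
  have hlim : Tendsto (fun N' : ℝ => (n * M / t ^ 2 + N' / 2) * t) (𝓝[>] N)
      (𝓝 ((n * M / t ^ 2 + N / 2) * t)) :=
    (Continuous.tendsto (by fun_prop) N).mono_left nhdsWithin_le_nhds
  have := ge_of_tendsto hlim (eventually_nhdsWithin_of_forall fun N' h => main N' h)
  calc pd i w x ≤ _ := this
    _ = _ := by field_simp

theorem abs_pd_le_of_lap_bound (hw : ContDiff ℝ ∞ w) (x : EuclideanSpace ℝ (Fin n)) {t M N : ℝ}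
    (ht : 0 < t) (hM : ∀ y : EuclideanSpace ℝ (Fin n), (∀ k, |y k - x k| ≤ t) → |w y| ≤ M)
    (hN : ∀ y : EuclideanSpace ℝ (Fin n), (∀ k, |y k - x k| ≤ t) → |lap w y| ≤ N) (i : Fin n) :
    |pd i w x| ≤ n * M / t + t / 2 * N := by
  refine abs_le.2 ⟨?_, pd_le_of_lap_bound hw x ht hM hN i⟩
  have hpd : ∀ k, pd k (fun y => - w y) = fun y => - pd k w y := fun k =>
    funext fun y => pd_neg k y
  have := pd_le_of_lap_bound (w := fun y => - w y) hw.neg x ht (by simpa using hM) (fun y hy => by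
    have h := hN y hy
    unfold lap at h ⊢
    simp_rw [hpd, pd_neg, Finset.sum_neg_distrib, abs_neg]
    exact h) i
  rw [pd_neg] at this
  linarith

end

abbrev V (n : ℕ) := EuclideanSpace ℝ (Fin n)

/-- Globally defined smooth fields solving the steady Navier-Stokes equations outside the ball of
radius `R`, with the scale-invariant decay of the velocity there. -/
structure IsSol {n : ℕ} (U : Fin n → V n → ℝ) (P : V n → ℝ) (R C : ℝ) : Prop where
  smooth : ∀ j, ContDiff ℝ ∞ (U j)
  smoothP : ContDiff ℝ ∞ P
  one_le : 1 ≤ R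
  nonneg : 0 ≤ C
  mom : ∀ x, R < ‖x‖ → ∀ j, lap (U j) x = ∑ i, U i x * pd i (U j) x + pd j P x
  div : ∀ x, R < ‖x‖ → ∑ i, pd i (U i) x = 0
  bound : ∀ x, R < ‖x‖ → ∀ j, |U j x| ≤ C / ‖x‖

section

variable {n : ℕ} (U : Fin n → V n → ℝ) (P : V n → ℝ)

/-- The vorticity. -/
noncomputable def om (i j : Fin n) (x : V n) : ℝ := pd i (U j) x - pd j (U i) x

/-- The Lamb vector. -/
noncomputable def lamb (j : Fin n) (x : V n) : ℝ := ∑ k, U k x * om U k j x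

/-- The total head pressure. -/
noncomputable def head (x : V n) : ℝ := P x + 1 / 2 * ∑ k, U k x * U k x

/-- Half the squared norm of the vorticity. -/
noncomputable def ens (x : V n) : ℝ := 1 / 2 * ∑ i, ∑ j, om U i j x * om U i j x

variable {U P} {R C : ℝ}

theorem contDiff_om (hU : ∀ j, ContDiff ℝ ∞ (U j)) (i j : Fin n) : ContDiff ℝ ∞ (om U i j) := by
  unfold om
  exact (contDiff_pd i (hU j)).sub (contDiff_pd j (hU i))

theorem contDiff_lamb (hU : ∀ j, ContDiff ℝ ∞ (U j)) (j : Fin n) : ContDiff ℝ ∞ (lamb U j) := by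
  unfold lamb
  exact ContDiff.sum fun k _ => (hU k).mul (contDiff_om hU k j)

theorem contDiff_head (hU : ∀ j, ContDiff ℝ ∞ (U j)) (hP : ContDiff ℝ ∞ P) :
    ContDiff ℝ ∞ (head U P) := by
  unfold head
  exact hP.add (contDiff_const.mul (ContDiff.sum fun k _ => (hU k).mul (hU k)))

theorem contDiff_ens (hU : ∀ j, ContDiff ℝ ∞ (U j)) : ContDiff ℝ ∞ (ens U) := by
  unfold ens
  exact contDiff_const.mul (ContDiff.sum fun i _ => ContDiff.sum fun j _ =>
    (contDiff_om hU i j).mul (contDiff_om hU i j))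

theorem om_antisymm (i j : Fin n) (x : V n) : om U i j x = - om U j i x := by
  unfold om; ring

theorem isOpen_ext (R : ℝ) : IsOpen {x : V n | R < ‖x‖} :=
  isOpen_lt continuous_const continuous_norm

theorem pd_head (hU : ∀ j, ContDiff ℝ ∞ (U j)) (hP : ContDiff ℝ ∞ P) (j : Fin n) (x : V n) :
    pd j (head U P) x = pd j P x + ∑ k, U k x * pd j (U k) x := by
  have h1 : ∀ k, ContDiff ℝ ∞ (fun y => U k y * U k y) := fun k => (hU k).mul (hU k)
  unfold head
  rw [pd_add hP (contDiff_const.mul (ContDiff.sum fun k _ => h1 k)),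
    pd_const_mul _ (ContDiff.sum fun k _ => h1 k), pd_sum _ h1, Finset.mul_sum]
  congr 1
  refine Finset.sum_congr rfl fun k _ => ?_
  rw [pd_mul (hU k) (hU k)]
  ring

theorem lap_pd (f : V n → ℝ) (hf : ContDiff ℝ ∞ f) (i : Fin n) (x : V n) :
    lap (pd i f) x = pd i (lap f) x := by
  unfold lap
  rw [pd_sum _ fun k => contDiff_pd k (contDiff_pd k hf)]
  refine Finset.sum_congr rfl fun k _ => ?_
  have : pd k (pd i f) = pd i (pd k f) := funext fun y => pd_comm hf k i y
  rw [this, pd_comm (contDiff_pd k hf)]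

theorem sum_mul_lamb (x : V n) : ∑ j, U j x * lamb U j x = 0 := by
  unfold lamb
  simp_rw [Finset.mul_sum]
  have h : ∑ j, ∑ k, U j x * (U k x * om U k j x) = ∑ j, ∑ k, U k x * (U j x * om U j k x) :=
    Finset.sum_comm
  have h2 : ∑ j, ∑ k, U k x * (U j x * om U j k x) = - ∑ j, ∑ k, U j x * (U k x * om U k j x) := by
    simp_rw [← Finset.sum_neg_distrib]
    refine Finset.sum_congr rfl fun j _ => Finset.sum_congr rfl fun k _ => ?_
    rw [om_antisymm j k]; ring
  linarith

namespace IsSol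

theorem pos (h : IsSol U P R C) : 0 < R := one_pos.trans_le h.one_le

theorem norm_pos (h : IsSol U P R C) {x : V n} (hx : R < ‖x‖) : 0 < ‖x‖ := h.pos.trans hx

theorem lap_eq_head (h : IsSol U P R C) (x : V n) (hx : R < ‖x‖) (j : Fin n) :
    lap (U j) x = pd j (head U P) x + lamb U j x := by
  rw [h.mom x hx, pd_head h.smooth h.smoothP]
  simp only [lamb, om]
  simp_rw [mul_sub, Finset.sum_sub_distrib]
  ring

theorem pd_div (h : IsSol U P R C) (x : V n) (hx : R < ‖x‖) (j : Fin n) :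
    ∑ i, pd j (pd i (U i)) x = 0 := by
  rw [← pd_sum _ fun k => contDiff_pd k (h.smooth k)]
  rw [pd_congr (isOpen_ext R) (g := fun _ => 0) (fun y hy => h.div y hy) j x hx, pd_const]

theorem lap_eq_om (h : IsSol U P R C) (x : V n) (hx : R < ‖x‖) (j : Fin n) :
    lap (U j) x = ∑ i, pd i (om U i j) x := by
  have : ∀ i, pd i (om U i j) x = pd i (pd i (U j)) x - pd j (pd i (U i)) x := by
    intro i
    unfold om
    rw [pd_sub (contDiff_pd i (h.smooth j)) (contDiff_pd j (h.smooth i)), pd_comm (h.smooth i) i j]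
  simp_rw [this, Finset.sum_sub_distrib, h.pd_div x hx]
  simp [lap]

theorem lap_om (h : IsSol U P R C) (x : V n) (hx : R < ‖x‖) (i j : Fin n) :
    lap (om U i j) x = pd i (lamb U j) x - pd j (lamb U i) x := by
  have e1 : lap (om U i j) x = lap (pd i (U j)) x - lap (pd j (U i)) x := by
    unfold lap om
    rw [← Finset.sum_sub_distrib]
    refine Finset.sum_congr rfl fun k _ => ?_
    have : pd k (fun x => pd i (U j) x - pd j (U i) x) =
        fun x => pd k (pd i (U j)) x - pd k (pd j (U i)) x := funext fun y =>
      pd_sub (contDiff_pd i (h.smooth j)) (contDiff_pd j (h.smooth i)) k y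
    rw [this, pd_sub (contDiff_pd _ (contDiff_pd i (h.smooth j)))
      (contDiff_pd _ (contDiff_pd j (h.smooth i)))]
  have hH := contDiff_head h.smooth h.smoothP
  have e2 : ∀ i j, pd i (lap (U j)) x = pd i (pd j (head U P)) x + pd i (lamb U j) x := by
    intro i j
    rw [pd_congr (isOpen_ext R) (fun y hy => h.lap_eq_head y hy j) i x hx,
      pd_add (contDiff_pd j hH) (contDiff_lamb h.smooth j)]
  rw [e1, lap_pd _ (h.smooth j), lap_pd _ (h.smooth i), e2, e2, pd_comm hH j i]
  ring

theorem sum_pd_lap (h : IsSol U P R C) (x : V n) (hx : R < ‖x‖) : ∑ j, pd j (lap (U j)) x = 0 := by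
  have : ∀ j, pd j (lap (U j)) x = ∑ k, pd k (fun y => pd k (pd j (U j)) y) x := by
    intro j
    rw [← lap_pd _ (h.smooth j)]
    rfl
  simp_rw [this]
  rw [Finset.sum_comm]
  refine Finset.sum_eq_zero fun k _ => ?_
  rw [← pd_sum _ fun j => contDiff_pd k (contDiff_pd j (h.smooth j)),
    pd_congr (isOpen_ext R) (g := fun _ => 0) (fun y hy => h.pd_div y hy k) k x hx, pd_const]

theorem lap_head (h : IsSol U P R C) (x : V n) (hx : R < ‖x‖) :
    lap (head U P) x = ∑ j, U j x * pd j (head U P) x + ens U x := by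
  have hH := contDiff_head h.smooth h.smoothP
  have e1 : lap (head U P) x = - ∑ j, pd j (lamb U j) x := by
    have : ∀ j, pd j (pd j (head U P)) x = pd j (lap (U j)) x - pd j (lamb U j) x := by
      intro j
      rw [← pd_sub (contDiff_lap (h.smooth j)) (contDiff_lamb h.smooth j)]
      refine pd_congr (isOpen_ext R) (fun y hy => ?_) j x hx
      rw [h.lap_eq_head y hy j]; ring
    unfold lap at this ⊢
    simp_rw [this, Finset.sum_sub_distrib]
    have := h.sum_pd_lap x hx
    unfold lap at this
    rw [this]; ring
  have e2 : ∀ j, pd j (lamb U j) x = ∑ k, pd j (U k) x * om U k j x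
      + ∑ k, U k x * pd j (om U k j) x := by
    intro j
    unfold lamb
    rw [pd_sum _ fun k => (h.smooth k).mul (contDiff_om h.smooth k j), ← Finset.sum_add_distrib]
    exact Finset.sum_congr rfl fun k _ => pd_mul (h.smooth k) (contDiff_om h.smooth k j) j x
  have e3 : ∑ j, ∑ k, U k x * pd j (om U k j) x = - ∑ k, U k x * pd k (head U P) x := by
    rw [Finset.sum_comm]
    have : ∀ k, ∑ j, U k x * pd j (om U k j) x
        = - (U k x * pd k (head U P) x) - U k x * lamb U k x := by
      intro k
      have h1 := h.lap_eq_om x hx k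
      rw [h.lap_eq_head x hx k] at h1
      have h2 : ∀ j, pd j (om U k j) x = - pd j (om U j k) x := by
        intro j
        rw [← pd_neg]
        congr 1
        funext y
        exact om_antisymm k j y
      simp_rw [h2, ← Finset.mul_sum, Finset.sum_neg_distrib]
      rw [← h1]; ring
    simp_rw [this, Finset.sum_sub_distrib, sum_mul_lamb, Finset.sum_neg_distrib]
    ring
  have e4 : ∑ j, ∑ k, pd j (U k) x * om U k j x = - ens U x := by
    have h1 : ∑ j, ∑ k, pd j (U k) x * om U k j x = ∑ j, ∑ k, pd k (U j) x * om U j k x :=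
      Finset.sum_comm
    have h2 : ∑ j, ∑ k, om U j k x * om U j k x =
        - ∑ j, ∑ k, pd j (U k) x * om U k j x - ∑ j, ∑ k, pd k (U j) x * om U j k x := by
      rw [← Finset.sum_neg_distrib, ← Finset.sum_sub_distrib]
      refine Finset.sum_congr rfl fun j _ => ?_
      rw [← Finset.sum_neg_distrib, ← Finset.sum_sub_distrib]
      refine Finset.sum_congr rfl fun k _ => ?_
      rw [om_antisymm k j]
      simp only [om]; ring
    unfold ens
    linarith
  rw [e1]
  simp_rw [e2, Finset.sum_add_distrib]
  rw [e3, e4]; ring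

theorem lap_pressure (h : IsSol U P R C) (x : V n) (hx : R < ‖x‖) :
    lap P x = - ∑ i, ∑ j, pd j (pd i (fun y => U i y * U j y)) x := by
  have e0 : ∀ y, R < ‖y‖ → ∀ j, pd j P y = lap (U j) y - ∑ i, pd i (fun z => U i z * U j z) y := by
    intro y hy j
    rw [h.mom y hy j]
    simp_rw [fun i => pd_mul (h.smooth i) (h.smooth j) i y, Finset.sum_add_distrib,
      ← Finset.sum_mul, h.div y hy]
    ring
  have hs : ∀ i j, ContDiff ℝ ∞ (pd i (fun z => U i z * U j z)) := fun i j =>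
    contDiff_pd i ((h.smooth i).mul (h.smooth j))
  have e1 : ∀ j, pd j (pd j P) x =
      pd j (lap (U j)) x - ∑ i, pd j (pd i (fun z => U i z * U j z)) x := by
    intro j
    rw [pd_congr (isOpen_ext R) (fun y hy => e0 y hy j) j x hx,
      pd_sub (contDiff_lap (h.smooth j)) (ContDiff.sum fun i _ => hs i j), pd_sum _ fun i => hs i j]
  have := h.sum_pd_lap x hx
  unfold lap at this e1 ⊢
  simp_rw [e1, Finset.sum_sub_distrib]
  rw [this, Finset.sum_comm]
  ring

end IsSol

end

theorem le_one_of_bootstrap {K η X Y s₀ : ℝ} (hK : 0 < K) (hη : 0 < η) (hη1 : η ≤ 1)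
    (hs₀ : 0 < s₀) (hY0 : 0 ≤ Y) (hX : X ≤ K * (Y + Y ^ 2 + η ^ 2 * X))
    (hY : ∀ s, 0 < s → s ≤ s₀ → Y ≤ K * (η ^ 2 / s + s * X))
    (hsmall : K * (K * (1 / s₀ + s₀) * η + (K * (1 / s₀ + s₀)) ^ 2 * η ^ 2 + η ^ 2) < 1) :
    X ≤ 1 := by
  by_contra! hX1
  set K' := K * (1 / s₀ + s₀) with hK'
  have hK'0 : 0 < K' := by positivity
  obtain ⟨ξ, hξ1, rfl⟩ : ∃ ξ : ℝ, 1 < ξ ∧ X = ξ ^ 2 :=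
    ⟨√X, by rw [Real.lt_sqrt] <;> linarith, (Real.sq_sqrt (by linarith)).symm⟩
  have hξ0 : 0 < ξ := by linarith
  have hY1 : Y ≤ K' * η * ξ := by
    have h := hY (s₀ * η / ξ) (by positivity) (by
      rw [div_le_iff₀ hξ0]
      nlinarith [mul_le_mul hη1 hξ1.le (by norm_num) (by norm_num)])
    calc Y ≤ _ := h
      _ = K' * η * ξ := by rw [hK']; field_simp
  have hY2 : Y ^ 2 ≤ (K' * η * ξ) ^ 2 := pow_le_pow_left₀ hY0 hY1 2
  have hY3 : Y ≤ K' * η * ξ ^ 2 := by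
    refine hY1.trans ?_
    have : K' * η * ξ * 1 ≤ K' * η * ξ * ξ := by gcongr
    nlinarith
  have : ξ ^ 2 ≤ K * (K' * η + K' ^ 2 * η ^ 2 + η ^ 2) * ξ ^ 2 := by
    calc ξ ^ 2 ≤ _ := hX
      _ ≤ K * (K' * η * ξ ^ 2 + (K' * η * ξ) ^ 2 + η ^ 2 * ξ ^ 2) := by gcongr
      _ = _ := by ring
  nlinarith [pow_pos hξ0 2]

theorem dist_le_of_coord {n : ℕ} {x y : V n} {t : ℝ} (ht : 0 ≤ t) (h : ∀ k, |y k - x k| ≤ t) :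
    dist y x ≤ (n + 1) * t := by
  rw [EuclideanSpace.dist_eq]
  apply Real.sqrt_le_iff.2 ⟨by positivity, ?_⟩
  calc ∑ i, dist (y i) (x i) ^ 2 ≤ ∑ _i : Fin n, t ^ 2 := by
        refine Finset.sum_le_sum fun k _ => ?_
        rw [Real.dist_eq]
        exact pow_le_pow_left₀ (abs_nonneg _) (h k) 2
    _ = n * t ^ 2 := by simp
    _ ≤ ((n + 1) * t) ^ 2 := by
        have : (0 : ℝ) ≤ n := by positivity
        nlinarith [mul_nonneg this (sq_nonneg t), mul_nonneg (mul_nonneg this this) (sq_nonneg t),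
          sq_nonneg t]

section

variable {n : ℕ} {U : Fin n → V n → ℝ} {P : V n → ℝ} {R C : ℝ}

theorem pd_lamb (hU : ∀ j, ContDiff ℝ ∞ (U j)) (i j : Fin n) (x : V n) :
    pd i (lamb U j) x = ∑ k, (pd i (U k) x * om U k j x + U k x * pd i (om U k j) x) := by
  unfold lamb
  rw [pd_sum _ fun k => (hU k).mul (contDiff_om hU k j)]
  exact Finset.sum_congr rfl fun k _ => pd_mul (hU k) (contDiff_om hU k j) i x

theorem abs_sum_le_card_mul {n : ℕ} (f : Fin n → ℝ) {B : ℝ} (h : ∀ i, |f i| ≤ B) :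
    |∑ i, f i| ≤ n * B :=
  (Finset.abs_sum_le_sum_abs _ _).trans ((Finset.sum_le_sum fun i _ => h i).trans (by simp))

theorem sum_le_card_mul {n : ℕ} (f : Fin n → ℝ) {B : ℝ} (h : ∀ i, f i ≤ B) :
    ∑ i, f i ≤ n * B :=
  (Finset.sum_le_sum fun i _ => h i).trans (by simp)

set_option maxHeartbeats 1000000 in
/-- Scale-invariant interior estimate in a ball where the rescaled velocity is small. -/
theorem IsSol.interior_bound (h : IsSol U P R C) {η K s₀ : ℝ} (hK : K = 16 * ((n : ℝ) + 1) ^ 5)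
    (hs : s₀ = 1 / (2 * ((n : ℝ) + 1)))
    (hη : 0 < η) (hη1 : η ≤ 1)
    (hsmall : K * (K * (1 / s₀ + s₀) * η + (K * (1 / s₀ + s₀)) ^ 2 * η ^ 2 + η ^ 2) < 1)
    {x₀ : V n} {ρ m : ℝ} (hρ : 0 < ρ) (hm : 0 ≤ m) (hρm : ρ * m ≤ η ^ 2)
    (hball : ∀ y, dist y x₀ ≤ ρ → R < ‖y‖) (hUm : ∀ y, dist y x₀ ≤ ρ → ∀ j, |U j y| ≤ m) :
    (∀ k j, |pd k (U j) x₀| ≤ K * (1 / s₀ + s₀) / ρ ^ 2) ∧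
      ∀ k i j, |pd k (om U i j) x₀| ≤ 1 / ρ ^ 3 := by
  have hn1 : (1 : ℝ) ≤ n + 1 := by have : (0 : ℝ) ≤ n := by positivity
                                   linarith
  have hn0 : (0 : ℝ) ≤ n := by positivity
  have hs0 : 0 < s₀ := by rw [hs]; positivity
  have hs1 : (n + 1) * s₀ = 1 / 2 := by rw [hs]; field_simp
  have hsn : n * s₀ ≤ 1 / 2 := by nlinarith
  have hs2 : s₀ ≤ 1 := by nlinarith
  have hinv : 1 / s₀ = 2 * (n + 1) := by rw [hs]; field_simp
  have hK0 : 0 < K := by rw [hK]; positivity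
  let d : V n → ℝ := fun y => ρ - dist y x₀
  let φ : V n → ℝ := fun y => d y ^ 2 * ∑ k, ∑ j, |pd k (U j) y|
  let ψ : V n → ℝ := fun y => d y ^ 3 * ∑ k, ∑ i, ∑ j, |pd k (om U i j) y|
  have cU : ∀ k j, Continuous (pd k (U j)) := fun k j => (contDiff_pd k (h.smooth j)).continuous
  have cω : ∀ k i j, Continuous (pd k (om U i j)) := fun k i j =>
    (contDiff_pd k (contDiff_om h.smooth i j)).continuous
  have cφ : Continuous φ := by fun_prop
  have cψ : Continuous ψ := by fun_prop
  have hne : (Metric.closedBall x₀ ρ).Nonempty := ⟨x₀, by simp [hρ.le]⟩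
  obtain ⟨x₁, hx₁, hmax₁⟩ := (isCompact_closedBall x₀ ρ).exists_isMaxOn hne cφ.continuousOn
  obtain ⟨x₂, hx₂, hmax₂⟩ := (isCompact_closedBall x₀ ρ).exists_isMaxOn hne cψ.continuousOn
  obtain ⟨Y, hYdef⟩ : ∃ Y, Y = φ x₁ := ⟨_, rfl⟩
  obtain ⟨X, hXdef⟩ : ∃ X, X = ψ x₂ := ⟨_, rfl⟩
  have hd1 : 0 ≤ d x₁ := by simpa [d] using hx₁
  have hd2 : 0 ≤ d x₂ := by simpa [d] using hx₂
  have hY0 : 0 ≤ Y := by simp only [hYdef, φ]; positivity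
  have hX0 : 0 ≤ X := by simp only [hXdef, ψ]; positivity
  have hφ : ∀ y, dist y x₀ ≤ ρ → ∀ k j, d y ^ 2 * |pd k (U j) y| ≤ Y := by
    intro y hy k j
    refine le_trans ?_ ((hmax₁ (Metric.mem_closedBall.2 hy)).trans hYdef.ge)
    simp only [φ]
    gcongr
    calc |pd k (U j) y| ≤ ∑ j, |pd k (U j) y| :=
          Finset.single_le_sum (f := fun j => |pd k (U j) y|) (fun _ _ => abs_nonneg _)
            (Finset.mem_univ j)
      _ ≤ _ := Finset.single_le_sum (f := fun k => ∑ j, |pd k (U j) y|)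
            (fun _ _ => Finset.sum_nonneg fun _ _ => abs_nonneg _) (Finset.mem_univ k)
  have hψ : ∀ y, dist y x₀ ≤ ρ → ∀ k i j, d y ^ 3 * |pd k (om U i j) y| ≤ X := by
    intro y hy k i j
    have hdy : 0 ≤ d y := by simpa [d] using hy
    refine le_trans ?_ ((hmax₂ (Metric.mem_closedBall.2 hy)).trans hXdef.ge)
    simp only [ψ]
    gcongr
    calc |pd k (om U i j) y| ≤ ∑ j, |pd k (om U i j) y| :=
          Finset.single_le_sum (f := fun j => |pd k (om U i j) y|) (fun _ _ => abs_nonneg _)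
            (Finset.mem_univ j)
      _ ≤ ∑ i, ∑ j, |pd k (om U i j) y| :=
          Finset.single_le_sum (f := fun i => ∑ j, |pd k (om U i j) y|)
            (fun _ _ => Finset.sum_nonneg fun _ _ => abs_nonneg _) (Finset.mem_univ i)
      _ ≤ _ := Finset.single_le_sum (f := fun k => ∑ i, ∑ j, |pd k (om U i j) y|)
            (fun _ _ => Finset.sum_nonneg fun _ _ => Finset.sum_nonneg fun _ _ => abs_nonneg _)
            (Finset.mem_univ k)
  have hcube : ∀ x, dist x x₀ ≤ ρ → ∀ s, 0 < s → s ≤ s₀ → ∀ y : V n,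
      (∀ k, |y k - x k| ≤ s * d x) → dist y x₀ ≤ ρ ∧ d x / 2 ≤ d y := by
    intro x hx s hsp hss y hy
    have hdx : 0 ≤ d x := by simpa [d] using hx
    have h1 := dist_le_of_coord (by positivity) hy
    have h2 : (n + 1) * (s * d x) ≤ 1 / 2 * d x := by
      rw [← hs1, ← mul_assoc]; gcongr
    have h3 := dist_triangle y x x₀
    simp only [d] at *
    constructor <;> linarith
  have bU : ∀ x, dist x x₀ ≤ ρ → 0 < d x → ∀ y, dist y x₀ ≤ ρ → d x / 2 ≤ d y → ∀ k j,
      |pd k (U j) y| ≤ 4 * Y / d x ^ 2 := by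
    intro x hx hdx y hy hdy k j
    have := hφ y hy k j
    rw [le_div_iff₀ (by positivity)]
    have h2 : (d x / 2) ^ 2 * |pd k (U j) y| ≤ d y ^ 2 * |pd k (U j) y| := by gcongr
    linarith
  have bω : ∀ x, dist x x₀ ≤ ρ → 0 < d x → ∀ y, dist y x₀ ≤ ρ → d x / 2 ≤ d y → ∀ k i j,
      |pd k (om U i j) y| ≤ 8 * X / d x ^ 3 := by
    intro x hx hdx y hy hdy k i j
    have := hψ y hy k i j
    rw [le_div_iff₀ (by positivity)]
    have h2 : (d x / 2) ^ 3 * |pd k (om U i j) y| ≤ d y ^ 3 * |pd k (om U i j) y| := by gcongr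
    linarith
  have hmd : ∀ x, 0 < d x → m * d x ≤ η ^ 2 := by
    intro x hdx
    have : d x ≤ ρ := by simp [d]
    nlinarith
  have hY : ∀ s, 0 < s → s ≤ s₀ → Y ≤ K * (η ^ 2 / s + s * X) := by
    intro s hsp hss
    rcases hd1.eq_or_lt with h0 | hdx
    · simp only [hYdef, φ, ← h0]
      rw [zero_pow two_ne_zero, zero_mul]; positivity
    have key : ∀ k j, d x₁ ^ 2 * |pd k (U j) x₁| ≤ 4 * n * (η ^ 2 / s + s * X) := by
      intro k j
      have := abs_pd_le_of_lap_bound (h.smooth j) x₁ (t := s * d x₁) (M := m)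
        (N := n * (8 * X / d x₁ ^ 3)) (by positivity)
        (fun y hy => hUm y (hcube x₁ hx₁ s hsp hss y hy).1 j) (fun y hy => by
          obtain ⟨h1, h2⟩ := hcube x₁ hx₁ s hsp hss y hy
          rw [h.lap_eq_om y (hball y h1) j]
          exact abs_sum_le_card_mul _ fun i => bω x₁ hx₁ hdx y h1 h2 i i j) k
      calc d x₁ ^ 2 * |pd k (U j) x₁| ≤ d x₁ ^ 2 *
            (n * m / (s * d x₁) + s * d x₁ / 2 * (n * (8 * X / d x₁ ^ 3))) := by gcongr
        _ = n * (m * d x₁) / s + 4 * n * s * X := by field_simp; ring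
        _ ≤ n * η ^ 2 / s + 4 * n * s * X := by gcongr; exact hmd _ hdx
        _ ≤ _ := by
          have : 0 ≤ n * η ^ 2 / s := by positivity
          have e : 4 * n * (η ^ 2 / s + s * X) = 4 * (n * η ^ 2 / s) + 4 * n * s * X := by ring
          linarith
    have hsum : Y ≤ n * (n * (4 * n * (η ^ 2 / s + s * X))) := by
      have : Y = ∑ k, ∑ j, d x₁ ^ 2 * |pd k (U j) x₁| := by
        simp only [hYdef, φ, Finset.mul_sum]
      refine this.trans_le ?_
      exact sum_le_card_mul _ fun k => sum_le_card_mul _ fun j => key k j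
    refine hsum.trans ?_
    have hc : n * (n * (4 * n)) ≤ K := by
      rw [hK]
      calc (n : ℝ) * (n * (4 * n)) = 4 * (n : ℝ) ^ 3 := by ring
        _ ≤ 16 * ((n : ℝ) + 1) ^ 3 := by gcongr <;> linarith
        _ ≤ 16 * ((n : ℝ) + 1) ^ 5 := by gcongr <;> norm_num
    calc _ = n * (n * (4 * n)) * (η ^ 2 / s + s * X) := by ring
      _ ≤ _ := by gcongr
  have hX : X ≤ K * (Y + Y ^ 2 + η ^ 2 * X) := by
    rcases hd2.eq_or_lt with h0 | hdx
    · simp only [hXdef, ψ, ← h0]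
      rw [zero_pow three_ne_zero, zero_mul]; positivity
    have key : ∀ k i j, d x₂ ^ 3 * |pd k (om U i j) x₂| ≤
        16 * (n + 1) ^ 2 * (Y + Y ^ 2 + η ^ 2 * X) := by
      intro k i j
      have bom : ∀ y, dist y x₀ ≤ ρ → d x₂ / 2 ≤ d y → ∀ i j,
          |om U i j y| ≤ 8 * Y / d x₂ ^ 2 := by
        intro y h1 h2 i j
        have e1 := abs_le.1 (bU x₂ hx₂ hdx y h1 h2 i j)
        have e2 := abs_le.1 (bU x₂ hx₂ hdx y h1 h2 j i)
        have e3 : 8 * Y / d x₂ ^ 2 = 4 * Y / d x₂ ^ 2 + 4 * Y / d x₂ ^ 2 := by ring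
        unfold om
        rw [abs_le, e3]
        constructor <;> linarith [e1.1, e1.2, e2.1, e2.2]
      have bf : ∀ y, dist y x₀ ≤ ρ → d x₂ / 2 ≤ d y → ∀ i j,
          |pd i (lamb U j) y| ≤ n * (4 * Y / d x₂ ^ 2 * (8 * Y / d x₂ ^ 2)
            + m * (8 * X / d x₂ ^ 3)) := by
        intro y h1 h2 i j
        rw [pd_lamb h.smooth]
        refine abs_sum_le_card_mul _ fun k => (abs_add_le _ _).trans ?_
        rw [abs_mul, abs_mul]
        gcongr
        · exact bU x₂ hx₂ hdx y h1 h2 i k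
        · exact bom y h1 h2 k j
        · exact hUm y h1 k
        · exact bω x₂ hx₂ hdx y h1 h2 i k j
      have := abs_pd_le_of_lap_bound (contDiff_om h.smooth i j) x₂ (t := s₀ * d x₂)
        (M := 8 * Y / d x₂ ^ 2)
        (N := 2 * (n * (4 * Y / d x₂ ^ 2 * (8 * Y / d x₂ ^ 2) + m * (8 * X / d x₂ ^ 3))))
        (by positivity)
        (fun y hy => bom y (hcube x₂ hx₂ s₀ hs0 le_rfl y hy).1
          (hcube x₂ hx₂ s₀ hs0 le_rfl y hy).2 i j) (fun y hy => by
          obtain ⟨h1, h2⟩ := hcube x₂ hx₂ s₀ hs0 le_rfl y hy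
          rw [h.lap_om y (hball y h1), two_mul]
          exact (abs_sub _ _).trans (add_le_add (bf y h1 h2 i j) (bf y h1 h2 j i))) k
      calc d x₂ ^ 3 * |pd k (om U i j) x₂| ≤ d x₂ ^ 3 * (n * (8 * Y / d x₂ ^ 2) / (s₀ * d x₂)
            + s₀ * d x₂ / 2 * (2 * (n * (4 * Y / d x₂ ^ 2 * (8 * Y / d x₂ ^ 2)
              + m * (8 * X / d x₂ ^ 3))))) := by gcongr
        _ = 8 * n * Y * (1 / s₀) + (n * s₀) * (32 * Y ^ 2 + 8 * (m * d x₂) * X) := by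
          field_simp; ring
        _ ≤ 8 * n * Y * (2 * (n + 1)) + 1 / 2 * (32 * Y ^ 2 + 8 * (η ^ 2) * X) := by
          rw [hinv]; gcongr; exact hmd _ hdx
        _ ≤ _ := by
          have h1 : 0 ≤ Y ^ 2 := sq_nonneg _
          have h2 : 0 ≤ η ^ 2 * X := by positivity
          have hq1 : (1 : ℝ) ≤ (n + 1) ^ 2 := one_le_pow₀ hn1
          have hq2 : n * ((n : ℝ) + 1) ≤ (n + 1) ^ 2 := by
            rw [sq]; gcongr; linarith
          have e1 := mul_le_mul_of_nonneg_right hq2 hY0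
          have e2 := mul_le_mul_of_nonneg_right hq1 h1
          have e3 := mul_le_mul_of_nonneg_right hq1 h2
          linarith
    have hsum : X ≤ n * (n * (n * (16 * (n + 1) ^ 2 * (Y + Y ^ 2 + η ^ 2 * X)))) := by
      have : X = ∑ k, ∑ i, ∑ j, d x₂ ^ 3 * |pd k (om U i j) x₂| := by
        simp only [hXdef, ψ, Finset.mul_sum]
      refine this.trans_le ?_
      exact sum_le_card_mul _ fun k => sum_le_card_mul _ fun i => sum_le_card_mul _ fun j =>
        key k i j
    refine hsum.trans ?_
    have hc : n * (n * (n * (16 * (n + 1) ^ 2))) ≤ K := by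
      rw [hK]
      calc (n : ℝ) * (n * (n * (16 * (n + 1) ^ 2))) = 16 * ((n : ℝ) ^ 3 * ((n : ℝ) + 1) ^ 2) := by ring
        _ ≤ 16 * (((n : ℝ) + 1) ^ 3 * ((n : ℝ) + 1) ^ 2) := by gcongr <;> linarith
        _ = 16 * ((n : ℝ) + 1) ^ 5 := by ring
    calc _ = n * (n * (n * (16 * (n + 1) ^ 2))) * (Y + Y ^ 2 + η ^ 2 * X) := by ring
      _ ≤ _ := by gcongr
  have hX1 : X ≤ 1 := le_one_of_bootstrap hK0 hη hη1 hs0 hY0 hX hY hsmall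
  have hY1 : Y ≤ K * (1 / s₀ + s₀) := by
    refine (hY s₀ hs0 le_rfl).trans ?_
    have : η ^ 2 ≤ 1 := by nlinarith
    gcongr
    nlinarith
  have hd0 : d x₀ = ρ := by simp [d]
  refine ⟨fun k j => ?_, fun k i j => ?_⟩
  · rw [le_div_iff₀ (by positivity), mul_comm, ← hd0]
    exact (hφ x₀ (by simp [hρ.le]) k j).trans hY1
  · rw [le_div_iff₀ (by positivity), mul_comm, ← hd0]
    exact (hψ x₀ (by simp [hρ.le]) k i j).trans hX1

set_option maxHeartbeats 1000000 in
/-- Decay of first derivatives of velocity and vorticity. -/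
theorem IsSol.exists_deriv_bound (h : IsSol U P R C) : ∃ C₁, 0 ≤ C₁ ∧ ∀ x, 2 * R < ‖x‖ →
    (∀ k j, |pd k (U j) x| ≤ C₁ / ‖x‖ ^ 2) ∧ ∀ k i j, |pd k (om U i j) x| ≤ C₁ / ‖x‖ ^ 3 := by
  obtain ⟨K, hK⟩ : ∃ K, K = 16 * ((n : ℝ) + 1) ^ 5 := ⟨_, rfl⟩
  obtain ⟨s₀, hs⟩ : ∃ s₀, s₀ = 1 / (2 * ((n : ℝ) + 1)) := ⟨_, rfl⟩
  have hs0 : 0 < s₀ := by rw [hs]; positivity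
  have hK0 : 0 < K := by rw [hK]; positivity
  set K' := K * (1 / s₀ + s₀) with hK'
  have hK'0 : 0 < K' := by positivity
  obtain ⟨η, hηd⟩ : ∃ η, η = 1 / (1 + K * (K' + K' ^ 2 + 1)) := ⟨_, rfl⟩
  have hη : 0 < η := by rw [hηd]; positivity
  have hη1 : η ≤ 1 := by
    rw [hηd, div_le_one (by positivity)]
    have : 0 < K * (K' + K' ^ 2 + 1) := by positivity
    linarith
  have hη2 : η ^ 2 ≤ η := by nlinarith
  have hsmall : K * (K' * η + K' ^ 2 * η ^ 2 + η ^ 2) < 1 := by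
    calc K * (K' * η + K' ^ 2 * η ^ 2 + η ^ 2) ≤ K * (K' * η + K' ^ 2 * η + η) := by gcongr
      _ = K * (K' + K' ^ 2 + 1) * η := by ring
      _ < 1 := by
        rw [hηd, mul_one_div, div_lt_one (by positivity)]
        linarith
  obtain ⟨l, hl⟩ : ∃ l, l = η ^ 2 / (2 * C + 2) := ⟨_, rfl⟩
  have hC := h.nonneg
  have hl0 : 0 < l := by rw [hl]; positivity
  have hl1 : l ≤ 1 / 2 := by
    rw [hl, div_le_iff₀ (by positivity)]; nlinarith
  refine ⟨K' / l ^ 2 + 1 / l ^ 3, by positivity, fun x hx => ?_⟩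
  have hx0 : 0 < ‖x‖ := by linarith [h.pos]
  have hfar : ∀ y, dist y x ≤ l * ‖x‖ → ‖x‖ / 2 ≤ ‖y‖ := by
    intro y hy
    have h1 : ‖x‖ ≤ ‖y‖ + dist y x := by
      rw [dist_comm, dist_eq_norm]
      calc ‖x‖ = ‖y + (x - y)‖ := by congr 1; abel
        _ ≤ _ := norm_add_le _ _
    nlinarith
  have := h.interior_bound hK hs hη hη1 hsmall (x₀ := x) (ρ := l * ‖x‖) (m := 2 * C / ‖x‖)
    (by positivity) (by positivity) (by
      calc l * ‖x‖ * (2 * C / ‖x‖) = l * (2 * C) := by field_simp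
        _ ≤ l * (2 * C + 2) := by gcongr; linarith
        _ = η ^ 2 := by rw [hl]; field_simp)
    (fun y hy => by linarith [hfar y hy])
    (fun y hy j => (h.bound y (by linarith [hfar y hy]) j).trans (by
      have := hfar y hy
      rw [div_le_div_iff₀ (by linarith) hx0]
      nlinarith))
  refine ⟨fun k j => (this.1 k j).trans ?_, fun k i j => (this.2 k i j).trans ?_⟩
  · rw [mul_pow, ← div_div]
    gcongr
    have : 0 ≤ 1 / l ^ 3 := by positivity
    linarith
  · rw [mul_pow, ← div_div]
    gcongr
    have : 0 ≤ K' / l ^ 2 := by positivity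
    linarith

end

/-- Solutions whose derivatives and head pressure also have scale-invariant decay. -/
structure IsDecaying {n : ℕ} (U : Fin n → V n → ℝ) (P : V n → ℝ) (R C : ℝ) : Prop
    extends IsSol U P R C where
  bound_pd : ∀ x, R < ‖x‖ → ∀ k j, |pd k (U j) x| ≤ C / ‖x‖ ^ 2
  bound_pd_om : ∀ x, R < ‖x‖ → ∀ k i j, |pd k (om U i j) x| ≤ C / ‖x‖ ^ 3
  bound_pd_head : ∀ x, R < ‖x‖ → ∀ j, |pd j (head U P) x| ≤ C / ‖x‖ ^ 3
  bound_head : ∀ x, R < ‖x‖ → |head U P x| ≤ C / ‖x‖ ^ 2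

section

variable {n : ℕ}

theorem fderiv_apply_eq_sum (f : V n → ℝ) (x v : V n) :
    fderiv ℝ f x v = ∑ i, v i * pd i f x := by
  have hv : v = ∑ i, v i • EuclideanSpace.single i (1 : ℝ) := by
    ext j
    simp [Finset.sum_apply, Pi.single_apply]
  conv_lhs => rw [hv]
  rw [map_sum]
  simp [pd]

theorem norm_fderiv_le_sum (f : V n → ℝ) (x : V n) : ‖fderiv ℝ f x‖ ≤ ∑ i, |pd i f x| := by
  refine ContinuousLinearMap.opNorm_le_bound _ (Finset.sum_nonneg fun _ _ => abs_nonneg _)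
    fun v => ?_
  rw [fderiv_apply_eq_sum, Finset.sum_mul, Real.norm_eq_abs]
  refine (Finset.abs_sum_le_sum_abs _ _).trans (Finset.sum_le_sum fun i _ => ?_)
  rw [abs_mul, mul_comm]
  gcongr
  rw [← Real.norm_eq_abs]
  exact PiLp.norm_apply_le v i

theorem abs_sub_le_of_pd_le {f : V n → ℝ} (hf : ContDiff ℝ ∞ f) {s : Set (V n)} (hs : Convex ℝ s)
    {B : ℝ} (hB : ∀ z ∈ s, ∀ i, |pd i f z| ≤ B) {x y : V n} (hx : x ∈ s) (hy : y ∈ s) :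
    |f y - f x| ≤ n * B * ‖y - x‖ :=
  hs.norm_image_sub_le_of_norm_fderiv_le (fun z _ => hf.differentiable (by simp) z)
    (fun z hz => (norm_fderiv_le_sum f z).trans (sum_le_card_mul _ fun i => hB z hz i)) hx hy

theorem norm_ge_of_mem_ball {x z : V n} (hz : z ∈ Metric.closedBall x (‖x‖ / 2)) :
    ‖x‖ / 2 ≤ ‖z‖ := by
  rw [mem_closedBall_iff_norm] at hz
  have := norm_sub_norm_le x z
  rw [norm_sub_rev] at this
  linarith

theorem norm_le_of_mem_ball {x z : V n} (hz : z ∈ Metric.closedBall x (‖x‖ / 2)) :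
    ‖z‖ ≤ 3 / 2 * ‖x‖ := by
  rw [mem_closedBall_iff_norm] at hz
  have := norm_sub_norm_le z x
  linarith

/-- A function with gradient `O(|x|⁻³)` has a limit at infinity, approached at rate `|x|⁻²`. -/
theorem exists_limit_of_pd_bound (hn : 2 ≤ n) {f : V n → ℝ} (hf : ContDiff ℝ ∞ f) {R B : ℝ}
    (hR : 0 < R) (hB : 0 ≤ B) (h : ∀ x, R < ‖x‖ → ∀ i, |pd i f x| ≤ B / ‖x‖ ^ 3) :
    ∃ c, ∀ x, 2 * R < ‖x‖ → |f x - c| ≤ 12 * n * B / ‖x‖ ^ 2 := by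
  have loc : ∀ x, 2 * R < ‖x‖ → ∀ y ∈ Metric.closedBall x (‖x‖ / 2),
      |f y - f x| ≤ 4 * n * B / ‖x‖ ^ 2 := by
    intro x hx y hy
    have hx0 : 0 < ‖x‖ := by linarith
    have := abs_sub_le_of_pd_le hf (convex_closedBall x (‖x‖ / 2)) (B := B / (‖x‖ / 2) ^ 3)
      (fun z hz i => by
        have := norm_ge_of_mem_ball hz
        refine (h z (by linarith) i).trans ?_
        gcongr) (Metric.mem_closedBall_self (by positivity)) hy
    refine this.trans ?_
    rw [mem_closedBall_iff_norm] at hy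
    calc _ ≤ n * (B / (‖x‖ / 2) ^ 3) * (‖x‖ / 2) := by gcongr
      _ = _ := by field_simp; ring
  have pow2 : ∀ (x : V n) (k : ℕ), ‖(2 : ℝ) ^ k • x‖ = 2 ^ k * ‖x‖ := by
    intro x k; rw [norm_smul]; simp
  have dbl : ∀ x, 2 * R < ‖x‖ → |f ((2 : ℝ) • x) - f x| ≤ 8 * n * B / ‖x‖ ^ 2 := by
    intro x hx
    have hx0 : 0 < ‖x‖ := by linarith
    have e0 : ‖(3 / 2 : ℝ) • x‖ = 3 / 2 * ‖x‖ := by rw [norm_smul]; norm_num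
    have h1 := loc x hx ((3 / 2 : ℝ) • x) (by
      rw [mem_closedBall_iff_norm]
      have : (3 / 2 : ℝ) • x - x = (1 / 2 : ℝ) • x := by module
      rw [this, norm_smul]; norm_num; linarith)
    have h2 := loc ((3 / 2 : ℝ) • x) (by rw [e0]; linarith) ((2 : ℝ) • x) (by
      rw [mem_closedBall_iff_norm, e0]
      have : (2 : ℝ) • x - (3 / 2 : ℝ) • x = (1 / 2 : ℝ) • x := by module
      rw [this, norm_smul]; norm_num; linarith)
    rw [e0] at h2
    have h3 : 4 * n * B / (3 / 2 * ‖x‖) ^ 2 ≤ 4 * n * B / ‖x‖ ^ 2 := by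
      gcongr; linarith
    have h4 : 8 * n * B / ‖x‖ ^ 2 = 4 * n * B / ‖x‖ ^ 2 + 4 * n * B / ‖x‖ ^ 2 := by ring
    rw [abs_le] at *
    constructor <;> linarith [h1.1, h1.2, h2.1, h2.2]
  have lim : ∀ x, 2 * R < ‖x‖ → ∃ L, Tendsto (fun k : ℕ => f ((2 : ℝ) ^ k • x)) atTop (𝓝 L) ∧
      |f x - L| ≤ 12 * n * B / ‖x‖ ^ 2 := by
    intro x hx
    have hx0 : 0 < ‖x‖ := by linarith
    have hgeo : ∀ k : ℕ, dist (f ((2 : ℝ) ^ k • x)) (f ((2 : ℝ) ^ (k + 1) • x)) ≤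
        8 * n * B / ‖x‖ ^ 2 * (1 / 4) ^ k := by
      intro k
      have h1 : (1 : ℝ) ≤ 2 ^ k := one_le_pow₀ (by norm_num)
      have := dbl ((2 : ℝ) ^ k • x) (by rw [pow2]; nlinarith)
      rw [pow2, smul_smul, ← pow_succ'] at this
      rw [dist_comm, Real.dist_eq]
      refine this.trans (le_of_eq ?_)
      rw [mul_pow, ← pow_mul, mul_comm k 2, pow_mul, one_div, inv_pow]
      norm_num
      field_simp
    obtain ⟨L, hL⟩ := cauchySeq_tendsto_of_complete
      (cauchySeq_of_le_geometric _ _ (by norm_num) hgeo)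
    refine ⟨L, hL, ?_⟩
    have := dist_le_of_le_geometric_of_tendsto₀ _ _ (by norm_num) hgeo hL
    rw [pow_zero, one_smul, Real.dist_eq] at this
    refine this.trans ?_
    have : 8 * n * B / ‖x‖ ^ 2 / (1 - 1 / 4) = 32 / 3 * n * B / ‖x‖ ^ 2 := by ring
    rw [this]
    gcongr
    norm_num
  have same : ∀ x ∈ ({0}ᶜ : Set (V n)), ∀ y ∈ ({0}ᶜ : Set (V n)),
      Tendsto (fun k : ℕ => f ((2 : ℝ) ^ k • y) - f ((2 : ℝ) ^ k • x)) atTop (𝓝 0) := by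
    have hconn : IsPreconnected ({0}ᶜ : Set (V n)) :=
      (isConnected_compl_singleton_of_one_lt_rank (by
        rw [← Module.finrank_eq_rank, finrank_euclideanSpace_fin]
        exact_mod_cast hn) 0).isPreconnected
    intro x hx y hy
    refine hconn.induction₂ (fun x y => Tendsto (fun k : ℕ => f ((2 : ℝ) ^ k • y)
      - f ((2 : ℝ) ^ k • x)) atTop (𝓝 0)) (fun x hx => ?_) (fun x y z _ _ _ hxy hyz => ?_)
      (fun x y _ _ hxy => ?_) hx hy
    · have hx0 : 0 < ‖x‖ := norm_pos_iff.2 hx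
      filter_upwards [nhdsWithin_le_nhds (Metric.closedBall_mem_nhds x (half_pos hx0))] with y hy
      have htend : Tendsto (fun k : ℕ => (2 : ℝ) ^ k * ‖x‖) atTop atTop :=
        (tendsto_pow_atTop_atTop_of_one_lt (by norm_num)).atTop_mul_const hx0
      have h0 : Tendsto (fun k : ℕ => 4 * n * B / ((2 : ℝ) ^ k * ‖x‖) ^ 2) atTop (𝓝 0) :=
        ((tendsto_pow_atTop two_ne_zero).comp htend).const_div_atTop _
      refine squeeze_zero_norm' ?_ h0
      filter_upwards [htend.eventually_gt_atTop (2 * R)] with k hk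
      have := loc ((2 : ℝ) ^ k • x) (by rw [pow2]; exact hk) ((2 : ℝ) ^ k • y) (by
        rw [mem_closedBall_iff_norm, ← smul_sub, pow2, pow2, mul_div_assoc]
        rw [mem_closedBall_iff_norm] at hy
        gcongr)
      rw [pow2] at this
      exact this
    · simpa using hyz.add hxy
    · simpa using hxy.neg
  let i0 : Fin n := ⟨0, by omega⟩
  let x₀ : V n := EuclideanSpace.single i0 (2 * R + 1)
  have hx₀ : 2 * R < ‖x₀‖ := by
    have : ‖x₀‖ = |2 * R + 1| := by simp [x₀]
    rw [this, abs_of_pos] <;> linarith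
  obtain ⟨c, hc, -⟩ := lim x₀ hx₀
  refine ⟨c, fun x hx => ?_⟩
  obtain ⟨L, hL, hL'⟩ := lim x hx
  have hne : ∀ y : V n, 2 * R < ‖y‖ → y ∈ ({0}ᶜ : Set (V n)) := fun y hy => by
    have : 0 < ‖y‖ := by linarith
    exact norm_pos_iff.1 this
  have h1 := same x₀ (hne _ hx₀) x (hne _ hx)
  have h2 := tendsto_nhds_unique h1 (hL.sub hc)
  have : L = c := by linarith
  rwa [← this]

end

section

variable {n : ℕ} {U : Fin n → V n → ℝ} {P : V n → ℝ} {R C : ℝ}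

theorem abs_om_le {B : ℝ} {x : V n} (h : ∀ k j, |pd k (U j) x| ≤ B) (i j : Fin n) :
    |om U i j x| ≤ 2 * B := by
  unfold om
  rw [two_mul]
  exact (abs_sub _ _).trans (add_le_add (h i j) (h j i))

theorem abs_lamb_le {A B : ℝ} {x : V n} (hA : 0 ≤ A) (hU : ∀ k, |U k x| ≤ A)
    (h : ∀ i j, |om U i j x| ≤ B) (j : Fin n) : |lamb U j x| ≤ n * (A * B) := by
  unfold lamb
  refine abs_sum_le_card_mul _ fun k => ?_
  rw [abs_mul]
  gcongr
  · exact hU k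
  · exact h k j

theorem pd_sub_const {f : V n → ℝ} (hf : ContDiff ℝ ∞ f) (c : ℝ) (i : Fin n) (x : V n) :
    pd i (fun y => f y - c) x = pd i f x := by
  rw [pd_sub hf contDiff_const, pd_const, sub_zero]

theorem head_sub_const (c : ℝ) (x : V n) : head U (fun y => P y - c) x = head U P x - c := by
  unfold head; ring

theorem IsSol.sub_const (h : IsSol U P R C) (c : ℝ) : IsSol U (fun y => P y - c) R C where
  smooth := h.smooth
  smoothP := h.smoothP.sub contDiff_const
  one_le := h.one_le
  nonneg := h.nonneg
  mom x hx j := by rw [pd_sub_const h.smoothP]; exact h.mom x hx j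
  div := h.div
  bound := h.bound

theorem IsSol.mono (h : IsSol U P R C) {R' C' : ℝ} (hR : R ≤ R') (hC : C ≤ C') :
    IsSol U P R' C' where
  smooth := h.smooth
  smoothP := h.smoothP
  one_le := h.one_le.trans hR
  nonneg := h.nonneg.trans hC
  mom x hx := h.mom x (hR.trans_lt hx)
  div x hx := h.div x (hR.trans_lt hx)
  bound x hx j := (h.bound x (hR.trans_lt hx) j).trans (by gcongr)

theorem IsSol.exists_isDecaying (hn : 2 ≤ n) (h : IsSol U P R C) :
    ∃ P' R' C', R ≤ R' ∧ IsDecaying U P' R' C' := by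
  obtain ⟨C₁, hC₁, hd⟩ := h.exists_deriv_bound
  have hH : ∀ x, 2 * R < ‖x‖ → ∀ j,
      |pd j (head U P) x| ≤ (n * C₁ + n * (C * (2 * C₁))) / ‖x‖ ^ 3 := by
    intro x hx j
    have hRx : R < ‖x‖ := by linarith [h.pos]
    have hx0 := h.norm_pos hRx
    have e : pd j (head U P) x = ∑ i, pd i (om U i j) x - lamb U j x := by
      rw [← h.lap_eq_om x hRx, h.lap_eq_head x hRx]; ring
    have h1 := abs_sum_le_card_mul (fun i => pd i (om U i j) x) fun i => (hd x hx).2 i i j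
    have h2 := abs_lamb_le (U := U) (div_nonneg h.nonneg hx0.le) (h.bound x hRx)
      (fun i j => abs_om_le (hd x hx).1 i j) j
    rw [e]
    refine (abs_sub _ _).trans ((add_le_add h1 h2).trans (le_of_eq ?_))
    field_simp
  obtain ⟨c, hc⟩ := exists_limit_of_pd_bound hn (contDiff_head h.smooth h.smoothP)
    (by linarith [h.pos]) (by have := h.nonneg; positivity) hH
  have hC := h.nonneg
  set B := n * C₁ + n * (C * (2 * C₁)) with hBd
  have hB : 0 ≤ B := by positivity
  have hb2 : 0 ≤ 12 * n * B := by positivity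
  refine ⟨fun y => P y - c, 2 * (2 * R), C + C₁ + B + 12 * n * B, by linarith [h.pos], ?_⟩
  have hR2 : ∀ x : V n, 2 * (2 * R) < ‖x‖ → 2 * R < ‖x‖ := fun x hx => by linarith [h.pos]
  have h0 := (h.sub_const c).mono (R' := 2 * (2 * R)) (C' := C + C₁ + B + 12 * n * B)
    (by linarith [h.pos]) (by linarith)
  refine { toIsSol := h0, bound_pd := ?_, bound_pd_om := ?_, bound_pd_head := ?_, bound_head := ?_ }
  · intro x hx k j
    refine ((hd x (hR2 x hx)).1 k j).trans ?_
    gcongr; linarith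
  · intro x hx k i j
    refine ((hd x (hR2 x hx)).2 k i j).trans ?_
    gcongr; linarith
  · intro x hx j
    have : pd j (head U fun y => P y - c) x = pd j (head U P) x := by
      rw [← pd_sub_const (contDiff_head h.smooth h.smoothP) c]
      congr 1
      funext y
      exact head_sub_const c y
    rw [this]
    refine (hH x (hR2 x hx) j).trans ?_
    gcongr; linarith
  · intro x hx
    rw [head_sub_const]
    refine (hc x hx).trans ?_
    gcongr; linarith

end

section Cutoff

/-- A smooth cutoff, equal to `1` on `(-∞, 1]` and to `0` on `[2, ∞)`. -/
noncomputable def th (t : ℝ) : ℝ := Real.smoothTransition (2 - t)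

@[fun_prop]
theorem contDiff_th : ContDiff ℝ ∞ th := by
  unfold th
  exact Real.smoothTransition.contDiff.comp (contDiff_const.sub contDiff_id)

theorem th_nonneg (t : ℝ) : 0 ≤ th t := Real.smoothTransition.nonneg _

theorem th_le_one (t : ℝ) : th t ≤ 1 := Real.smoothTransition.le_one _

theorem th_eq_one {t : ℝ} (h : t ≤ 1) : th t = 1 :=
  Real.smoothTransition.one_of_one_le (by linarith)

theorem th_eq_zero {t : ℝ} (h : 2 ≤ t) : th t = 0 :=
  Real.smoothTransition.zero_of_nonpos (by linarith)

/-- Indicator of the dyadic interval `[A, 2 * A]`. -/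
noncomputable def dya (A : ℝ) (ρ : ℝ) : ℝ := (Icc A (2 * A)).indicator (fun _ => 1) ρ

theorem dya_nonneg (A ρ : ℝ) : 0 ≤ dya A ρ := indicator_nonneg (fun _ _ => zero_le_one) _

theorem dya_le_one (A ρ : ℝ) : dya A ρ ≤ 1 := by
  unfold dya
  by_cases h : ρ ∈ Icc A (2 * A) <;> simp [h]

theorem dya_of_mem {A ρ : ℝ} (h1 : A ≤ ρ) (h2 : ρ ≤ 2 * A) : dya A ρ = 1 :=
  indicator_of_mem (show ρ ∈ Icc A (2 * A) from ⟨h1, h2⟩) _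

theorem deriv_th_eq_zero {t : ℝ} (h : t < 1 ∨ 2 < t) : deriv th t = 0 := by
  rcases h with h | h
  · have : th =ᶠ[𝓝 t] fun _ => 1 := by
      filter_upwards [Iio_mem_nhds h] with s hs using th_eq_one (le_of_lt hs)
    rw [this.deriv_eq, deriv_const]
  · have : th =ᶠ[𝓝 t] fun _ => 0 := by
      filter_upwards [Ioi_mem_nhds h] with s hs using th_eq_zero (le_of_lt hs)
    rw [this.deriv_eq, deriv_const]

theorem deriv_deriv_th_eq_zero {t : ℝ} (h : t < 1 ∨ 2 < t) : deriv (deriv th) t = 0 := by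
  rcases h with h | h
  · have : deriv th =ᶠ[𝓝 t] fun _ => 0 := by
      filter_upwards [Iio_mem_nhds h] with s hs using deriv_th_eq_zero (Or.inl hs)
    rw [this.deriv_eq, deriv_const]
  · have : deriv th =ᶠ[𝓝 t] fun _ => 0 := by
      filter_upwards [Ioi_mem_nhds h] with s hs using deriv_th_eq_zero (Or.inr hs)
    rw [this.deriv_eq, deriv_const]

theorem contDiff_deriv {f : ℝ → ℝ} (hf : ContDiff ℝ ∞ f) : ContDiff ℝ ∞ (deriv f) :=
  (contDiff_infty_iff_deriv.1 hf).2

theorem hasDerivAt_of_smooth {f : ℝ → ℝ} (hf : ContDiff ℝ ∞ f) (t : ℝ) :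
    HasDerivAt f (deriv f t) t :=
  (hf.differentiable (by simp) t).hasDerivAt

theorem deriv_th_scale (A : ℝ) :
    deriv (fun ρ => th (ρ / A)) = fun ρ => deriv th (ρ / A) / A := by
  funext ρ
  have := (hasDerivAt_of_smooth contDiff_th (ρ / A)).comp ρ ((hasDerivAt_id ρ).div_const A)
  have h2 : HasDerivAt (fun ρ => th (ρ / A)) _ ρ := this
  rw [h2.deriv]; ring

theorem deriv_deriv_th_scale (A : ℝ) :
    deriv (deriv (fun ρ => th (ρ / A))) = fun ρ => deriv (deriv th) (ρ / A) / A ^ 2 := by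
  rw [deriv_th_scale]
  funext ρ
  have := (hasDerivAt_of_smooth (contDiff_deriv contDiff_th) (ρ / A)).comp ρ
    ((hasDerivAt_id ρ).div_const A)
  have h2 : HasDerivAt (fun ρ => deriv th (ρ / A)) _ ρ := this
  rw [(h2.div_const A).deriv]; ring

theorem exists_th_bound : ∃ K, 0 ≤ K ∧ ∀ A, 0 < A → ∀ ρ,
    |deriv (fun ρ => th (ρ / A)) ρ| ≤ K / ρ * dya A ρ ∧
    |deriv (deriv (fun ρ => th (ρ / A))) ρ| ≤ K / ρ ^ 2 * dya A ρ := by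
  obtain ⟨K₁, h₁⟩ := (isCompact_Icc (a := (1 : ℝ)) (b := 2)).exists_bound_of_continuousOn
    (contDiff_deriv contDiff_th).continuous.continuousOn
  obtain ⟨K₂, h₂⟩ := (isCompact_Icc (a := (1 : ℝ)) (b := 2)).exists_bound_of_continuousOn
    (contDiff_deriv (contDiff_deriv contDiff_th)).continuous.continuousOn
  have hK₁ : 0 ≤ K₁ := (norm_nonneg _).trans (h₁ 1 (by simp))
  have hK₂ : 0 ≤ K₂ := (norm_nonneg _).trans (h₂ 1 (by simp))
  refine ⟨2 * K₁ + 4 * K₂, by positivity, fun A hA ρ => ?_⟩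
  rw [deriv_deriv_th_scale, deriv_th_scale]
  beta_reduce
  by_cases h : ρ ∈ Icc A (2 * A)
  · have hρ : 0 < ρ := hA.trans_le h.1
    have ht : ρ / A ∈ Icc (1 : ℝ) 2 := by
      rw [mem_Icc, le_div_iff₀ hA, div_le_iff₀ hA]
      exact ⟨by linarith [h.1], h.2⟩
    rw [dya_of_mem h.1 h.2, mul_one, mul_one]
    have e1 := h₁ _ ht
    have e2 := h₂ _ ht
    rw [Real.norm_eq_abs] at e1 e2
    rw [abs_div, abs_div, abs_of_pos hA, abs_of_pos (pow_pos hA 2)]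
    have i1 : 1 / A ≤ 2 / ρ := by
      rw [div_le_div_iff₀ hA hρ]; linarith [h.2]
    have i2 : 1 / A ^ 2 ≤ 4 / ρ ^ 2 := by
      rw [div_le_div_iff₀ (by positivity) (by positivity)]
      nlinarith [h.2, h.1]
    constructor
    · calc _ ≤ K₁ * (1 / A) := by rw [mul_one_div]; gcongr
        _ ≤ K₁ * (2 / ρ) := by gcongr
        _ ≤ _ := by rw [mul_div_assoc']; gcongr; linarith
    · calc _ ≤ K₂ * (1 / A ^ 2) := by rw [mul_one_div]; gcongr
        _ ≤ K₂ * (4 / ρ ^ 2) := by gcongr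
        _ ≤ _ := by rw [mul_div_assoc']; gcongr; linarith
  · have ht : ρ / A < 1 ∨ 2 < ρ / A := by
      rw [div_lt_one hA, lt_div_iff₀ hA]
      by_contra! hc
      exact h ⟨hc.1, hc.2⟩
    rw [deriv_th_eq_zero ht, deriv_deriv_th_eq_zero ht]
    simp [dya, h]

/-- A cutoff to the annulus `A ≤ ρ ≤ 2 * S`. -/
noncomputable def cut (A S ρ : ℝ) : ℝ := (1 - th (ρ / A)) * th (ρ / S)

/-- The transition region of `cut A S`. -/
noncomputable def rim (A S ρ : ℝ) : ℝ := dya A ρ + dya S ρ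

theorem rim_nonneg (A S ρ : ℝ) : 0 ≤ rim A S ρ := add_nonneg (dya_nonneg _ _) (dya_nonneg _ _)

@[fun_prop]
theorem contDiff_cut (A S : ℝ) : ContDiff ℝ ∞ (cut A S) := by
  unfold cut
  fun_prop

theorem cut_nonneg (A S ρ : ℝ) : 0 ≤ cut A S ρ :=
  mul_nonneg (by linarith [th_le_one (ρ / A)]) (th_nonneg _)

theorem cut_le_one (A S ρ : ℝ) : cut A S ρ ≤ 1 :=
  mul_le_one₀ (by linarith [th_nonneg (ρ / A)]) (th_nonneg _) (th_le_one _)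

theorem cut_eq_zero_of_le {A ρ : ℝ} (S : ℝ) (hA : 0 < A) (h : ρ ≤ A) : cut A S ρ = 0 := by
  unfold cut
  rw [th_eq_one ((div_le_one hA).2 h)]; simp

theorem cut_eq_zero_of_ge {S ρ : ℝ} (A : ℝ) (hS : 0 < S) (h : 2 * S ≤ ρ) : cut A S ρ = 0 := by
  unfold cut
  rw [th_eq_zero ((le_div_iff₀ hS).2 h)]; simp

theorem exists_cut_bound : ∃ K, 0 ≤ K ∧ ∀ A S, 0 < A → 0 < S → ∀ ρ, 0 ≤ ρ →
    |deriv (cut A S) ρ| ≤ K / ρ * rim A S ρ ∧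
    |deriv (deriv (cut A S)) ρ| ≤ K / ρ ^ 2 * rim A S ρ := by
  obtain ⟨K, hK, hb⟩ := exists_th_bound
  refine ⟨K + 2 * K ^ 2, by positivity, fun A S hA hS ρ hρ => ?_⟩
  have sA : ContDiff ℝ ∞ (fun ρ => th (ρ / A)) := by fun_prop
  have sS : ContDiff ℝ ∞ (fun ρ => th (ρ / S)) := by fun_prop
  have hd1 : deriv (cut A S) = fun ρ => -deriv (fun ρ => th (ρ / A)) ρ * th (ρ / S)
      + (1 - th (ρ / A)) * deriv (fun ρ => th (ρ / S)) ρ := by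
    funext ρ
    exact (((hasDerivAt_of_smooth sA ρ).const_sub 1).fun_mul (hasDerivAt_of_smooth sS ρ)).deriv
  have hd2 : deriv (deriv (cut A S)) ρ = -deriv (deriv (fun ρ => th (ρ / A))) ρ * th (ρ / S)
      - 2 * (deriv (fun ρ => th (ρ / A)) ρ * deriv (fun ρ => th (ρ / S)) ρ)
      + (1 - th (ρ / A)) * deriv (deriv (fun ρ => th (ρ / S))) ρ := by
    rw [hd1]
    have h1 := (hasDerivAt_of_smooth (contDiff_deriv sA) ρ).fun_neg.fun_mul
      (hasDerivAt_of_smooth sS ρ)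
    have h2 := ((hasDerivAt_of_smooth sA ρ).const_sub 1).fun_mul
      (hasDerivAt_of_smooth (contDiff_deriv sS) ρ)
    rw [(h1.fun_add h2).deriv]
    ring
  rw [hd2, hd1]
  have bA := hb A hA ρ
  have bS := hb S hS ρ
  have tA : |1 - th (ρ / A)| ≤ 1 := by
    rw [abs_le]; constructor <;> linarith [th_le_one (ρ / A), th_nonneg (ρ / A)]
  have tS : |th (ρ / S)| ≤ 1 := by
    rw [abs_le]; constructor <;> linarith [th_le_one (ρ / S), th_nonneg (ρ / S)]
  have nA := dya_nonneg A ρ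
  have nS := dya_nonneg S ρ
  have n1 : 0 ≤ K / ρ := by positivity
  have n2 : 0 ≤ K / ρ ^ 2 := by positivity
  constructor
  · refine (abs_add_le _ _).trans ?_
    rw [abs_mul, abs_mul, abs_neg]
    calc _ ≤ K / ρ * dya A ρ * 1 + 1 * (K / ρ * dya S ρ) := by
          gcongr
          · exact bA.1
          · exact bS.1
      _ = K / ρ * rim A S ρ := by unfold rim; ring
      _ ≤ _ := by
        have := rim_nonneg A S ρ
        gcongr
        nlinarith [sq_nonneg K]
  · have hmid : |deriv (fun ρ => th (ρ / A)) ρ * deriv (fun ρ => th (ρ / S)) ρ| ≤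
        K / ρ * dya A ρ * (K / ρ * dya S ρ) := by
      rw [abs_mul]
      gcongr
      · exact bA.1
      · exact bS.1
    have hmid2 : dya A ρ * dya S ρ ≤ rim A S ρ := by
      unfold rim
      have := dya_le_one S ρ
      nlinarith
    calc _ ≤ |-deriv (deriv (fun ρ => th (ρ / A))) ρ * th (ρ / S)|
          + |2 * (deriv (fun ρ => th (ρ / A)) ρ * deriv (fun ρ => th (ρ / S)) ρ)|
          + |(1 - th (ρ / A)) * deriv (deriv (fun ρ => th (ρ / S))) ρ| :=
          (abs_add_le _ _).trans (add_le_add_left (abs_sub _ _) _)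
      _ ≤ K / ρ ^ 2 * dya A ρ * 1 + 2 * (K / ρ * dya A ρ * (K / ρ * dya S ρ))
          + 1 * (K / ρ ^ 2 * dya S ρ) := by
          rw [abs_mul, abs_mul 2, abs_mul (1 - th (ρ / A)), abs_neg, abs_two]
          gcongr
          · exact bA.2
          · exact bS.2
      _ = K / ρ ^ 2 * rim A S ρ + 2 * K ^ 2 / ρ ^ 2 * (dya A ρ * dya S ρ) := by
          unfold rim
          ring
      _ ≤ K / ρ ^ 2 * rim A S ρ + 2 * K ^ 2 / ρ ^ 2 * rim A S ρ := by gcongr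
      _ = _ := by ring

end Cutoff

section Identities

variable {n : ℕ}

/-- Smooth compactly supported functions vanishing where `‖x‖ ^ 2 ≤ A`. -/
structure IsTest (A : ℝ) (ζ : V n → ℝ) : Prop where
  smooth : ContDiff ℝ ∞ ζ
  compact : HasCompactSupport ζ
  zero : ∀ x, ‖x‖ ^ 2 ≤ A → ζ x = 0

theorem integrable_mul_test {f ζ : V n → ℝ} (hf : Continuous f) (hζ : Continuous ζ)
    (hs : HasCompactSupport ζ) : Integrable (fun x => f x * ζ x) :=
  (hf.mul hζ).integrable_of_hasCompactSupport hs.mul_left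

theorem integral_mul_pd_pd {f ζ : V n → ℝ} (hf : ContDiff ℝ ∞ f) (hζ : ContDiff ℝ ∞ ζ)
    (hs : HasCompactSupport ζ) (i j : Fin n) :
    ∫ x, f x * pd i (pd j ζ) x = ∫ x, pd j (pd i f) x * ζ x := by
  rw [integral_mul_pd hf (contDiff_pd j hζ) (hasCompactSupport_pd hs j) i,
    integral_mul_pd (contDiff_pd i hf) hζ hs j, neg_neg]

theorem integral_mul_lap {f ζ : V n → ℝ} (hf : ContDiff ℝ ∞ f) (hζ : ContDiff ℝ ∞ ζ)
    (hs : HasCompactSupport ζ) : ∫ x, f x * lap ζ x = ∫ x, lap f x * ζ x := by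
  simp only [lap, Finset.mul_sum, Finset.sum_mul]
  rw [integral_finsetSum, integral_finsetSum]
  · exact Finset.sum_congr rfl fun i _ => integral_mul_pd_pd hf hζ hs i i
  · exact fun i _ => integrable_mul_test (contDiff_pd i (contDiff_pd i hf)).continuous
      hζ.continuous hs
  · exact fun i _ => integrable_mul_test hf.continuous
      (contDiff_pd i (contDiff_pd i hζ)).continuous
      (hasCompactSupport_pd (hasCompactSupport_pd hs i) i)

theorem hasCompactSupport_lap {ζ : V n → ℝ} (hs : HasCompactSupport ζ) :
    HasCompactSupport (lap ζ) := by
  refine hs.mono' (f' := lap ζ) fun x hx => ?_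
  by_contra hc
  apply hx
  have h0 : ∀ i, pd i (pd i ζ) x = 0 := fun i =>
    image_eq_zero_of_notMem_tsupport fun h => hc
      (by
        have h1 : tsupport (pd i (pd i ζ)) ⊆ tsupport (pd i ζ) :=
          tsupport_fderiv_apply_subset ℝ _
        have h2 : tsupport (pd i ζ) ⊆ tsupport ζ := tsupport_fderiv_apply_subset ℝ _
        exact h2 (h1 h))
  simp [lap, h0]

variable {U : Fin n → V n → ℝ} {P : V n → ℝ} {R C A : ℝ}

theorem IsSol.lt_norm (_ : IsSol U P R C) (hA : R ^ 2 ≤ A) {x : V n} (hx : A < ‖x‖ ^ 2) :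
    R < ‖x‖ :=
  lt_of_pow_lt_pow_left₀ 2 (norm_nonneg _) (hA.trans_lt hx)

theorem IsSol.integral_transport (h : IsSol U P R C) (hA : R ^ 2 ≤ A) {f ζ : V n → ℝ}
    (hf : ContDiff ℝ ∞ f) (hζ : IsTest A ζ) :
    ∫ x, f x * (lap ζ x + ∑ i, U i x * pd i ζ x) =
      ∫ x, ζ x * (lap f x - ∑ i, U i x * pd i f x) := by
  have s1 : ∀ i, Integrable (fun x => f x * U i x * pd i ζ x) := fun i =>
    integrable_mul_test (hf.mul (h.smooth i)).continuous (contDiff_pd i hζ.smooth).continuous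
      (hasCompactSupport_pd hζ.compact i)
  have s2 : ∀ i, Integrable (fun x => pd i (fun y => f y * U i y) x * ζ x) := fun i =>
    integrable_mul_test (contDiff_pd i (hf.mul (h.smooth i))).continuous hζ.smooth.continuous
      hζ.compact
  have s2' : ∀ i, Integrable (fun x => -(pd i (fun y => f y * U i y) x * ζ x)) := fun i =>
    (s2 i).neg
  have s3 : Integrable (fun x => f x * lap ζ x) :=
    integrable_mul_test hf.continuous (contDiff_lap hζ.smooth).continuous
      (hasCompactSupport_lap hζ.compact)
  have s4 : Integrable (fun x => lap f x * ζ x) :=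
    integrable_mul_test (contDiff_lap hf).continuous hζ.smooth.continuous hζ.compact
  have e1 : (fun x => f x * (lap ζ x + ∑ i, U i x * pd i ζ x)) =
      fun x => f x * lap ζ x + ∑ i, f x * U i x * pd i ζ x := by
    funext x
    rw [mul_add, Finset.mul_sum]
    simp only [mul_assoc]
  have e2 : (fun x => ζ x * (lap f x - ∑ i, U i x * pd i f x)) =
      fun x => lap f x * ζ x + ∑ i, -(pd i (fun y => f y * U i y) x * ζ x) := by
    funext x
    rw [Finset.sum_neg_distrib, ← Finset.sum_mul]
    simp only [fun i => pd_mul hf (h.smooth i) i x]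
    rw [Finset.sum_add_distrib, ← Finset.mul_sum]
    rcases le_or_gt (‖x‖ ^ 2) A with hx | hx
    · rw [hζ.zero x hx]; ring
    · rw [h.div x (h.lt_norm hA hx)]
      simp only [mul_comm (U _ x)]
      ring
  rw [e1, e2, integral_add s3 (integrable_finsetSum _ fun i _ => s1 i),
    integral_add s4 (integrable_finsetSum _ fun i _ => s2' i),
    integral_finsetSum _ fun i _ => s1 i, integral_finsetSum _ fun i _ => s2' i,
    integral_mul_lap hf hζ.smooth hζ.compact]
  congr 1
  refine Finset.sum_congr rfl fun i _ => ?_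
  rw [integral_neg, integral_mul_pd (hf.mul (h.smooth i)) hζ.smooth hζ.compact i]

theorem lap_comp {F : ℝ → ℝ} {f : V n → ℝ} (hF : ContDiff ℝ ∞ F) (hf : ContDiff ℝ ∞ f) (x : V n) :
    lap (fun y => F (f y)) x =
      deriv F (f x) * lap f x + deriv (deriv F) (f x) * ∑ i, pd i f x ^ 2 := by
  unfold lap
  rw [Finset.mul_sum, Finset.mul_sum, ← Finset.sum_add_distrib]
  refine Finset.sum_congr rfl fun i _ => ?_
  have : pd i (fun y => F (f y)) = fun y => deriv F (f y) * pd i f y :=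
    funext fun y => pd_comp hF hf i y
  rw [this, pd_mul (f := fun y => deriv F (f y)) ((contDiff_deriv hF).comp hf) (contDiff_pd i hf),
    pd_comp (contDiff_deriv hF) hf i x]
  ring

theorem IsSol.integral_head (h : IsSol U P R C) (hA : R ^ 2 ≤ A) {F : ℝ → ℝ} {ζ : V n → ℝ}
    (hF : ContDiff ℝ ∞ F) (hζ : IsTest A ζ) :
    ∫ x, F (head U P x) * (lap ζ x + ∑ i, U i x * pd i ζ x) =
      ∫ x, ζ x * (deriv F (head U P x) * ens U x
        + deriv (deriv F) (head U P x) * ∑ i, pd i (head U P) x ^ 2) := by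
  have hH := contDiff_head h.smooth h.smoothP
  rw [h.integral_transport hA (f := fun x => F (head U P x)) (hF.comp hH) hζ]
  congr 1
  funext x
  rcases le_or_gt (‖x‖ ^ 2) A with hx | hx
  · rw [hζ.zero x hx]; ring
  · congr 1
    rw [lap_comp hF hH, h.lap_head x (h.lt_norm hA hx)]
    simp only [pd_comp hF hH]
    have : ∑ i, U i x * (deriv F (head U P x) * pd i (head U P) x) =
        deriv F (head U P x) * ∑ i, U i x * pd i (head U P) x := by
      rw [Finset.mul_sum]; exact Finset.sum_congr rfl fun i _ => by ring
    rw [this]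
    ring

theorem IsSol.integral_pressure (h : IsSol U P R C) (hA : R ^ 2 ≤ A) {ζ : V n → ℝ}
    (hζ : IsTest A ζ) :
    ∫ x, P x * lap ζ x = -∫ x, ∑ i, ∑ j, U i x * U j x * pd i (pd j ζ) x := by
  rw [integral_mul_lap h.smoothP hζ.smooth hζ.compact]
  have s1 : ∀ i j, Integrable (fun x => U i x * U j x * pd i (pd j ζ) x) := fun i j =>
    integrable_mul_test ((h.smooth i).mul (h.smooth j)).continuous
      (contDiff_pd i (contDiff_pd j hζ.smooth)).continuous
      (hasCompactSupport_pd (hasCompactSupport_pd hζ.compact j) i)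
  have s2 : ∀ i j, Integrable (fun x => pd j (pd i (fun y => U i y * U j y)) x * ζ x) :=
    fun i j => integrable_mul_test (contDiff_pd j (contDiff_pd i
      ((h.smooth i).mul (h.smooth j)))).continuous hζ.smooth.continuous hζ.compact
  have e : (fun x => lap P x * ζ x) =
      fun x => -∑ i, ∑ j, pd j (pd i (fun y => U i y * U j y)) x * ζ x := by
    funext x
    rcases le_or_gt (‖x‖ ^ 2) A with hx | hx
    · simp [hζ.zero x hx]
    · rw [h.lap_pressure x (h.lt_norm hA hx)]
      simp only [← Finset.sum_mul]
      ring
  rw [e, integral_neg, integral_finsetSum _ fun i _ => integrable_finsetSum _ fun j _ => s2 i j,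
    integral_finsetSum _ fun i _ => integrable_finsetSum _ fun j _ => s1 i j]
  congr 1
  refine Finset.sum_congr rfl fun i _ => ?_
  rw [integral_finsetSum _ fun j _ => s2 i j, integral_finsetSum _ fun j _ => s1 i j]
  exact Finset.sum_congr rfl fun j _ =>
    (integral_mul_pd_pd ((h.smooth i).mul (h.smooth j)) hζ.smooth hζ.compact i j).symm

end Identities

section Weights

/-- A smooth positive function, equal to `ρ ↦ ρ ^ a` for `ρ ≥ 1 / 2`. -/
noncomputable def pw (a ρ : ℝ) : ℝ := (th (4 * ρ) + (1 - th (4 * ρ)) * ρ) ^ a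

theorem pw_base_pos (ρ : ℝ) : 0 < th (4 * ρ) + (1 - th (4 * ρ)) * ρ := by
  rcases le_or_gt ρ (1 / 4) with h | h
  · rw [th_eq_one (by linarith)]; norm_num
  · have h1 := th_nonneg (4 * ρ)
    have h2 := th_le_one (4 * ρ)
    nlinarith

@[fun_prop]
theorem contDiff_pw (a : ℝ) : ContDiff ℝ ∞ (pw a) := by
  unfold pw
  exact ContDiff.rpow_const_of_ne (by fun_prop) fun ρ => (pw_base_pos ρ).ne'

theorem pw_pos (a ρ : ℝ) : 0 < pw a ρ := Real.rpow_pos_of_pos (pw_base_pos ρ) a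

theorem pw_eq (a : ℝ) {ρ : ℝ} (h : 1 / 2 ≤ ρ) : pw a ρ = ρ ^ a := by
  unfold pw
  rw [th_eq_zero (by linarith)]
  simp

theorem deriv_pw (a : ℝ) {ρ : ℝ} (h : 1 / 2 < ρ) : deriv (pw a) ρ = a * ρ ^ (a - 1) := by
  have : pw a =ᶠ[𝓝 ρ] fun t => t ^ a := by
    filter_upwards [Ioi_mem_nhds h] with t ht using pw_eq a (le_of_lt ht)
  rw [this.deriv_eq, Real.deriv_rpow_const]

theorem deriv_deriv_pw (a : ℝ) {ρ : ℝ} (h : 1 / 2 < ρ) :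
    deriv (deriv (pw a)) ρ = a * ((a - 1) * ρ ^ (a - 2)) := by
  have : deriv (pw a) =ᶠ[𝓝 ρ] fun t => a * t ^ (a - 1) := by
    filter_upwards [Ioi_mem_nhds h] with t ht using deriv_pw a ht
  rw [this.deriv_eq, deriv_const_mul_field, Real.deriv_rpow_const]
  ring_nf

/-- Smooth nonnegative weights with power-like derivative bounds on `[1, ∞)`. -/
structure IsWeight (β : ℝ) (b : ℝ → ℝ) : Prop where
  smooth : ContDiff ℝ ∞ b
  nonneg : ∀ ρ, 0 ≤ b ρ
  const_nonneg : 0 ≤ β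
  bound1 : ∀ ρ, 1 ≤ ρ → |deriv b ρ| ≤ β * b ρ / ρ
  bound2 : ∀ ρ, 1 ≤ ρ → |deriv (deriv b) ρ| ≤ β * b ρ / ρ ^ 2

theorem rpow_sub_one' {a ρ : ℝ} (h : 0 < ρ) : ρ ^ (a - 1) = ρ ^ a / ρ := by
  rw [Real.rpow_sub_one h.ne']

theorem rpow_sub_two' {a ρ : ℝ} (h : 0 < ρ) : ρ ^ (a - 2) = ρ ^ a / ρ ^ 2 := by
  rw [Real.rpow_sub h]; norm_num

theorem isWeight_pw (a : ℝ) : IsWeight (|a| + |a * (a - 1)|) (pw a) where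
  smooth := contDiff_pw a
  nonneg ρ := (pw_pos a ρ).le
  const_nonneg := by positivity
  bound1 ρ h := by
    have h0 : 0 < ρ := by linarith
    have := Real.rpow_pos_of_pos h0 a
    rw [deriv_pw a (by linarith), pw_eq a (by linarith), rpow_sub_one' h0, abs_mul,
      abs_of_pos (div_pos this h0), mul_div_assoc]
    gcongr
    linarith [abs_nonneg (a * (a - 1))]
  bound2 ρ h := by
    have h0 : 0 < ρ := by linarith
    have := Real.rpow_pos_of_pos h0 a
    rw [deriv_deriv_pw a (by linarith), pw_eq a (by linarith), rpow_sub_two' h0, ← mul_assoc,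
      abs_mul, abs_of_pos (div_pos this (pow_pos h0 2)), mul_div_assoc]
    gcongr
    linarith [abs_nonneg a]

/-- A weight interpolating between `ρ ^ ε` and `ρ ^ (-ε) / κ`. -/
noncomputable def bw (ε κ ρ : ℝ) : ℝ := (pw (-ε) ρ + κ * pw ε ρ)⁻¹

theorem bw_base_pos {κ : ℝ} (hκ : 0 ≤ κ) (ε ρ : ℝ) : 0 < pw (-ε) ρ + κ * pw ε ρ :=
  add_pos_of_pos_of_nonneg (pw_pos _ _) (mul_nonneg hκ (pw_pos _ _).le)

theorem isWeight_bw {ε κ : ℝ} (hε : 0 ≤ ε) (hε1 : ε ≤ 1) (hκ : 0 ≤ κ) :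
    IsWeight (4 * ε) (bw ε κ) := by
  obtain ⟨D, hD⟩ : ∃ D, D = fun ρ => pw (-ε) ρ + κ * pw ε ρ := ⟨_, rfl⟩
  have sD : ContDiff ℝ ∞ D := by rw [hD]; fun_prop
  have pD : ∀ ρ, 0 < D ρ := fun ρ => by rw [hD]; exact bw_base_pos hκ ε ρ
  have hb : bw ε κ = fun ρ => (D ρ)⁻¹ := by rw [hD]; rfl
  have hD1 : deriv D = fun ρ => deriv (pw (-ε)) ρ + κ * deriv (pw ε) ρ := by
    funext ρ
    rw [hD]
    exact ((hasDerivAt_of_smooth (contDiff_pw _) ρ).fun_add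
      ((hasDerivAt_of_smooth (contDiff_pw _) ρ).const_mul κ)).deriv
  have hD2 : ∀ ρ, deriv (deriv D) ρ = deriv (deriv (pw (-ε))) ρ + κ * deriv (deriv (pw ε)) ρ := by
    intro ρ
    rw [hD1]
    exact ((hasDerivAt_of_smooth (contDiff_deriv (contDiff_pw _)) ρ).fun_add
      ((hasDerivAt_of_smooth (contDiff_deriv (contDiff_pw _)) ρ).const_mul κ)).deriv
  have bd1 : ∀ ρ, 1 ≤ ρ → |deriv D ρ| ≤ ε * D ρ / ρ := by
    intro ρ h
    have h0 : 0 < ρ := by linarith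
    have p1 := Real.rpow_pos_of_pos h0 ε
    have p2 := Real.rpow_pos_of_pos h0 (-ε)
    rw [hD1, hD]
    beta_reduce
    rw [deriv_pw _ (by linarith), deriv_pw _ (by linarith), pw_eq _ (by linarith),
      pw_eq _ (by linarith), rpow_sub_one' h0, rpow_sub_one' h0,
      show -ε * (ρ ^ (-ε) / ρ) + κ * (ε * (ρ ^ ε / ρ)) =
        ε * (κ * ρ ^ ε - ρ ^ (-ε)) / ρ by ring, abs_div, abs_mul, abs_of_nonneg hε,
      abs_of_pos h0]
    gcongr
    have : 0 ≤ κ * ρ ^ ε := by positivity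
    rw [abs_le]
    constructor <;> linarith
  have bd2 : ∀ ρ, 1 ≤ ρ → |deriv (deriv D) ρ| ≤ 2 * ε * D ρ / ρ ^ 2 := by
    intro ρ h
    have h0 : 0 < ρ := by linarith
    have p1 := Real.rpow_pos_of_pos h0 ε
    have p2 := Real.rpow_pos_of_pos h0 (-ε)
    rw [hD2, hD]
    beta_reduce
    rw [deriv_deriv_pw _ (by linarith), deriv_deriv_pw _ (by linarith), pw_eq _ (by linarith),
      pw_eq _ (by linarith), rpow_sub_two' h0, rpow_sub_two' h0,
      show -ε * ((-ε - 1) * (ρ ^ (-ε) / ρ ^ 2)) + κ * (ε * ((ε - 1) * (ρ ^ ε / ρ ^ 2))) =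
        ε * ((1 + ε) * ρ ^ (-ε) - (1 - ε) * (κ * ρ ^ ε)) / ρ ^ 2 by ring, abs_div, abs_mul,
      abs_of_nonneg hε, abs_of_pos (pow_pos h0 2), mul_comm 2 ε, mul_assoc ε 2]
    gcongr
    have : 0 ≤ κ * ρ ^ ε := by positivity
    rw [abs_le]
    constructor <;> nlinarith
  have hb1 : deriv (bw ε κ) = fun ρ => -deriv D ρ / D ρ ^ 2 := by
    funext ρ
    rw [hb]
    exact ((hasDerivAt_of_smooth sD ρ).fun_inv (pD ρ).ne').deriv
  have hb2 : ∀ ρ, deriv (deriv (bw ε κ)) ρ =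
      -deriv (deriv D) ρ / D ρ ^ 2 + 2 * deriv D ρ ^ 2 / D ρ ^ 3 := by
    intro ρ
    rw [hb1]
    have := ((hasDerivAt_of_smooth (contDiff_deriv sD) ρ).fun_neg.fun_div
      ((hasDerivAt_of_smooth sD ρ).fun_pow 2) (pow_ne_zero 2 (pD ρ).ne')).deriv
    rw [this]
    have := (pD ρ).ne'
    field_simp
    ring
  refine ⟨?_, fun ρ => ?_, by positivity, fun ρ h => ?_, fun ρ h => ?_⟩
  · rw [hb]; exact sD.inv fun ρ => (pD ρ).ne'
  · rw [hb]; exact (inv_pos.2 (pD ρ)).le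
  · have h0 : 0 < ρ := by linarith
    have := pD ρ
    rw [hb1, hb, abs_div, abs_neg, abs_of_pos (pow_pos this 2)]
    calc _ ≤ ε * D ρ / ρ / D ρ ^ 2 := by gcongr; exact bd1 ρ h
      _ = ε * (D ρ)⁻¹ / ρ := by field_simp
      _ ≤ _ := by gcongr; linarith
  · have h0 : 0 < ρ := by linarith
    have := pD ρ
    rw [hb2, hb]
    refine (abs_add_le _ _).trans ?_
    rw [abs_div, abs_div, abs_neg, abs_of_pos (pow_pos this 2), abs_of_pos (pow_pos this 3),
      abs_mul, abs_two, abs_pow]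
    calc _ ≤ 2 * ε * D ρ / ρ ^ 2 / D ρ ^ 2 + 2 * (ε * D ρ / ρ) ^ 2 / D ρ ^ 3 := by
          gcongr
          · exact bd2 ρ h
          · exact bd1 ρ h
      _ = (2 * ε + 2 * ε ^ 2) * (D ρ)⁻¹ / ρ ^ 2 := by field_simp
      _ ≤ _ := by gcongr; nlinarith

/-- A weight localised to the annulus `A ≤ ρ ≤ 2 * S`. -/
noncomputable def lw (A S : ℝ) (b : ℝ → ℝ) (ρ : ℝ) : ℝ := cut A S ρ * b ρ

theorem contDiff_lw (A S : ℝ) {b : ℝ → ℝ} (hb : ContDiff ℝ ∞ b) : ContDiff ℝ ∞ (lw A S b) := by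
  unfold lw; fun_prop

theorem lw_nonneg (A S : ℝ) {b : ℝ → ℝ} (hb : ∀ ρ, 0 ≤ b ρ) (ρ : ℝ) : 0 ≤ lw A S b ρ :=
  mul_nonneg (cut_nonneg _ _ _) (hb ρ)

theorem lw_eq_zero {A ρ : ℝ} (S : ℝ) (b : ℝ → ℝ) (hA : 0 < A) (h : ρ ≤ A) : lw A S b ρ = 0 := by
  unfold lw; rw [cut_eq_zero_of_le S hA h, zero_mul]

theorem deriv_lw_eq_zero {A ρ : ℝ} (S : ℝ) (b : ℝ → ℝ) (hA : 0 < A) (h : ρ < A) :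
    deriv (lw A S b) ρ = 0 := by
  have : lw A S b =ᶠ[𝓝 ρ] fun _ => 0 := by
    filter_upwards [Iio_mem_nhds h] with t ht using lw_eq_zero S b hA (le_of_lt ht)
  rw [this.deriv_eq, deriv_const]

theorem deriv_deriv_lw_eq_zero {A ρ : ℝ} (S : ℝ) (b : ℝ → ℝ) (hA : 0 < A) (h : ρ < A) :
    deriv (deriv (lw A S b)) ρ = 0 := by
  have : deriv (lw A S b) =ᶠ[𝓝 ρ] fun _ => 0 := by
    filter_upwards [Iio_mem_nhds h] with t ht using deriv_lw_eq_zero S b hA ht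
  rw [this.deriv_eq, deriv_const]

theorem exists_lw_bound (β : ℝ) : ∃ K, 0 ≤ K ∧ ∀ A S b, 1 ≤ A → 0 < S → IsWeight β b →
    ∀ ρ, 0 ≤ ρ →
    |deriv (lw A S b) ρ - cut A S ρ * deriv b ρ| ≤ K * (b ρ / ρ * rim A S ρ) ∧
    |deriv (deriv (lw A S b)) ρ - cut A S ρ * deriv (deriv b) ρ| ≤
      K * (b ρ / ρ ^ 2 * rim A S ρ) := by
  obtain ⟨K, hK, hc⟩ := exists_cut_bound
  refine ⟨K * (1 + 2 * |β|), by positivity, fun A S b hA hS hb ρ hρ => ?_⟩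
  have nb := hb.nonneg ρ
  have nr := rim_nonneg A S ρ
  rcases lt_or_ge ρ A with h | h
  · rw [deriv_lw_eq_zero S b (by linarith) h, deriv_deriv_lw_eq_zero S b (by linarith) h,
      cut_eq_zero_of_le S (by linarith) h.le]
    simp only [zero_mul, sub_zero, abs_zero]
    constructor <;> positivity
  have h1 : 1 ≤ ρ := hA.trans h
  have h0 : 0 < ρ := by linarith
  obtain ⟨c1, c2⟩ := hc A S (by linarith) hS ρ hρ
  have e1 : deriv (lw A S b) = fun ρ => deriv (cut A S) ρ * b ρ + cut A S ρ * deriv b ρ := by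
    funext ρ
    exact ((hasDerivAt_of_smooth (contDiff_cut A S) ρ).fun_mul
      (hasDerivAt_of_smooth hb.smooth ρ)).deriv
  have e2 : deriv (deriv (lw A S b)) ρ = deriv (deriv (cut A S)) ρ * b ρ
      + 2 * (deriv (cut A S) ρ * deriv b ρ) + cut A S ρ * deriv (deriv b) ρ := by
    rw [e1]
    have h1 := (hasDerivAt_of_smooth (contDiff_deriv (contDiff_cut A S)) ρ).fun_mul
      (hasDerivAt_of_smooth hb.smooth ρ)
    have h2 := (hasDerivAt_of_smooth (contDiff_cut A S) ρ).fun_mul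
      (hasDerivAt_of_smooth (contDiff_deriv hb.smooth) ρ)
    rw [(h1.fun_add h2).deriv]
    ring
  have nβ := hb.const_nonneg
  rw [e2, e1, abs_of_nonneg nβ]
  constructor
  · rw [add_sub_cancel_right, abs_mul, abs_of_nonneg nb]
    calc _ ≤ K / ρ * rim A S ρ * b ρ := by gcongr
      _ = K * 1 * (b ρ / ρ * rim A S ρ) := by ring
      _ ≤ _ := by gcongr; linarith
  · rw [add_sub_cancel_right]
    refine (abs_add_le _ _).trans ?_
    rw [abs_mul, abs_mul, abs_mul, abs_of_nonneg nb, abs_two]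
    calc _ ≤ K / ρ ^ 2 * rim A S ρ * b ρ + 2 * (K / ρ * rim A S ρ * (β * b ρ / ρ)) := by
          gcongr
          exact hb.bound1 ρ h1
      _ = K * (1 + 2 * β) * (b ρ / ρ ^ 2 * rim A S ρ) := by field_simp
      _ ≤ _ := le_rfl

variable {n : ℕ}

theorem isTest_lw {A S : ℝ} {b : ℝ → ℝ} (hA : 0 < A) (hS : 0 < S) (hb : ContDiff ℝ ∞ b) :
    IsTest A (fun x : V n => lw A S b (‖x‖ ^ 2)) where
  smooth := (contDiff_lw A S hb).comp contDiff_norm_sq'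
  compact := by
    refine HasCompactSupport.intro (isCompact_closedBall (0 : V n) (2 * S + 1)) fun x hx => ?_
    rw [mem_closedBall_zero_iff, not_le] at hx
    unfold lw
    rw [cut_eq_zero_of_ge A hS (by nlinarith), zero_mul]
  zero x hx := lw_eq_zero S b hA hx

end Weights

section Shell

variable {n : ℕ}

theorem measurable_dya (A : ℝ) : Measurable (dya A) := by
  unfold dya
  exact measurable_const.indicator measurableSet_Icc

theorem exists_shell_bound (n : ℕ) : ∃ K, 0 ≤ K ∧ ∀ S, 0 < S →
    Integrable (fun x : V n => (‖x‖ ^ 2) ^ (-(n : ℝ) / 2) * dya S (‖x‖ ^ 2)) ∧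
    ∫ x : V n, (‖x‖ ^ 2) ^ (-(n : ℝ) / 2) * dya S (‖x‖ ^ 2) ≤ K := by
  refine ⟨2 ^ ((n : ℝ) / 2) * volume.real (Metric.ball (0 : V n) 1), by positivity,
    fun S hS => ?_⟩
  have hmeas : Measurable (fun x : V n => (‖x‖ ^ 2) ^ (-(n : ℝ) / 2) * dya S (‖x‖ ^ 2)) :=
    ((measurable_norm.pow_const 2).pow_const _).mul
      ((measurable_dya S).comp (measurable_norm.pow_const 2))
  have hle : ∀ x : V n, (‖x‖ ^ 2) ^ (-(n : ℝ) / 2) * dya S (‖x‖ ^ 2) ≤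
      (Metric.closedBall (0 : V n) (√(2 * S))).indicator (fun _ => S ^ (-(n : ℝ) / 2)) x := by
    intro x
    by_cases h : ‖x‖ ^ 2 ∈ Icc S (2 * S)
    · rw [dya_of_mem h.1 h.2, mul_one, indicator_of_mem]
      · exact Real.rpow_le_rpow_of_nonpos hS h.1
          (by have : (0 : ℝ) ≤ n := Nat.cast_nonneg n
              linarith)
      · rw [mem_closedBall_zero_iff]
        exact Real.le_sqrt_of_sq_le h.2
    · have : dya S (‖x‖ ^ 2) = 0 := by simp [dya, h]
      rw [this, mul_zero]
      exact indicator_nonneg (fun _ _ => by positivity) _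
  have hn0 : ∀ x : V n, 0 ≤ (‖x‖ ^ 2) ^ (-(n : ℝ) / 2) * dya S (‖x‖ ^ 2) := fun x =>
    mul_nonneg (by positivity) (dya_nonneg _ _)
  have hfin : volume (Metric.closedBall (0 : V n) (√(2 * S))) ≠ ⊤ :=
    (isCompact_closedBall _ _).measure_lt_top.ne
  have h_int : Integrable ((Metric.closedBall (0 : V n) (√(2 * S))).indicator
      (fun _ => S ^ (-(n : ℝ) / 2))) :=
    (integrableOn_const hfin).integrable_indicator Metric.isClosed_closedBall.measurableSet
  have hI : Integrable (fun x : V n => (‖x‖ ^ 2) ^ (-(n : ℝ) / 2) * dya S (‖x‖ ^ 2)) :=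
    h_int.mono' hmeas.aestronglyMeasurable (ae_of_all _ fun x => by
      rw [Real.norm_of_nonneg (hn0 x)]; exact hle x)
  refine ⟨hI, (integral_mono hI h_int hle).trans ?_⟩
  rw [integral_indicator Metric.isClosed_closedBall.measurableSet, setIntegral_const,
    measureReal_def, Measure.addHaar_closedBall _ _ (Real.sqrt_nonneg _), ENNReal.toReal_mul,
    ENNReal.toReal_ofReal (by positivity), smul_eq_mul, finrank_euclideanSpace, Fintype.card_fin]
  have e : √(2 * S) ^ n = 2 ^ ((n : ℝ) / 2) * S ^ ((n : ℝ) / 2) := by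
    rw [Real.sqrt_eq_rpow, ← Real.rpow_natCast, ← Real.rpow_mul (by positivity),
      Real.mul_rpow (by norm_num) hS.le]
    congr 2 <;> ring
  have e2 : S ^ ((n : ℝ) / 2) * S ^ (-(n : ℝ) / 2) = 1 := by
    rw [← Real.rpow_add hS]
    ring_nf
    simp
  rw [e, ← measureReal_def]
  apply le_of_eq
  calc _ = 2 ^ ((n : ℝ) / 2) * volume.real (Metric.ball (0 : V n) 1) *
        (S ^ ((n : ℝ) / 2) * S ^ (-(n : ℝ) / 2)) := by ring
    _ = _ := by rw [e2, mul_one]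

theorem exists_rim_bound (n : ℕ) : ∃ K, 0 ≤ K ∧ ∀ A S, 0 < A → 0 < S →
    Integrable (fun x : V n => (‖x‖ ^ 2) ^ (-(n : ℝ) / 2) * rim A S (‖x‖ ^ 2)) ∧
    ∫ x : V n, (‖x‖ ^ 2) ^ (-(n : ℝ) / 2) * rim A S (‖x‖ ^ 2) ≤ K := by
  obtain ⟨K, hK, h⟩ := exists_shell_bound n
  refine ⟨2 * K, by positivity, fun A S hA hS => ?_⟩
  have hA := h A hA
  have hS := h S hS
  simp only [rim, mul_add]
  refine ⟨hA.1.add hS.1, ?_⟩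
  rw [integral_add hA.1 hS.1]
  linarith [hA.2, hS.2]

end Shell

section Operator

variable {n : ℕ}

/-- The radial component of the velocity, times `‖x‖`. -/
noncomputable def rdl (U : Fin n → V n → ℝ) (x : V n) : ℝ := ∑ i, U i x * x i

/-- The squared speed. -/
noncomputable def usq (U : Fin n → V n → ℝ) (x : V n) : ℝ := ∑ i, U i x * U i x

theorem op_radial (U : Fin n → V n → ℝ) {g : ℝ → ℝ} (hg : ContDiff ℝ ∞ g) (x : V n) :
    lap (fun y => g (‖y‖ ^ 2)) x + ∑ i, U i x * pd i (fun y => g (‖y‖ ^ 2)) x =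
      2 * n * deriv g (‖x‖ ^ 2) + 4 * ‖x‖ ^ 2 * deriv (deriv g) (‖x‖ ^ 2)
        + 2 * deriv g (‖x‖ ^ 2) * rdl U x := by
  rw [lap_radial hg, rdl, Finset.mul_sum]
  congr 1
  refine Finset.sum_congr rfl fun i _ => ?_
  rw [pd_radial hg]
  ring

theorem hess_radial (U : Fin n → V n → ℝ) {g : ℝ → ℝ} (hg : ContDiff ℝ ∞ g) (x : V n) :
    ∑ i, ∑ j, U i x * U j x * pd i (pd j (fun y => g (‖y‖ ^ 2))) x =
      2 * usq U x * deriv g (‖x‖ ^ 2) + 4 * rdl U x ^ 2 * deriv (deriv g) (‖x‖ ^ 2) := by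
  simp only [pd_pd_radial hg, mul_add, Finset.sum_add_distrib]
  congr 1
  · simp only [mul_ite, mul_zero, Finset.sum_ite_eq, Finset.mem_univ, if_true, usq]
    rw [Finset.mul_sum, Finset.sum_mul]
    exact Finset.sum_congr rfl fun i _ => by ring
  · rw [rdl, sq (∑ i, U i x * x i), Finset.sum_mul_sum, Finset.mul_sum, Finset.sum_mul]
    refine Finset.sum_congr rfl fun i _ => ?_
    rw [Finset.mul_sum, Finset.sum_mul]
    exact Finset.sum_congr rfl fun j _ => by ring

variable {U : Fin n → V n → ℝ} {P : V n → ℝ} {R C A : ℝ}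

theorem IsSol.abs_rdl_le (h : IsSol U P R C) {x : V n} (hx : R < ‖x‖) :
    |rdl U x| ≤ n * C := by
  have hx0 : 0 < ‖x‖ := by linarith [h.one_le]
  refine abs_sum_le_card_mul _ fun i => ?_
  rw [abs_mul]
  have h1 : |x i| ≤ ‖x‖ := by
    rw [← Real.norm_eq_abs]; exact PiLp.norm_apply_le x i
  have h0 := h.nonneg
  calc _ ≤ C / ‖x‖ * ‖x‖ := by
        gcongr
        exact h.bound x hx i
    _ = C := by field_simp

theorem usq_nonneg (U : Fin n → V n → ℝ) (x : V n) : 0 ≤ usq U x :=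
  Finset.sum_nonneg fun _ _ => mul_self_nonneg _

theorem IsSol.usq_le (h : IsSol U P R C) {x : V n} (hx : R < ‖x‖) :
    usq U x ≤ n * C ^ 2 / ‖x‖ ^ 2 := by
  have hx0 : 0 < ‖x‖ := by linarith [h.one_le]
  rw [mul_div_assoc]
  refine (le_abs_self _).trans (abs_sum_le_card_mul _ fun i => ?_)
  rw [abs_mul, ← div_pow, pow_two]
  have := h.bound x hx i
  have h0 := h.nonneg
  gcongr

theorem IsSol.exists_op_bound (h : IsSol U P R C) (hA : R ^ 2 < A) (β : ℝ) :
    ∃ K, 0 ≤ K ∧ ∀ S b, 0 < S → IsWeight β b → ∀ x,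
      |lap (fun y => lw A S b (‖y‖ ^ 2)) x + ∑ i, U i x * pd i (fun y => lw A S b (‖y‖ ^ 2)) x| ≤
        (2 * n + 4 + 2 * (n * C)) * β * (cut A S (‖x‖ ^ 2) * (b (‖x‖ ^ 2) / ‖x‖ ^ 2))
          + K * (b (‖x‖ ^ 2) / ‖x‖ ^ 2 * rim A S (‖x‖ ^ 2)) := by
  obtain ⟨K, hK, hl⟩ := exists_lw_bound β
  have h0 := h.nonneg
  have hR := h.one_le
  refine ⟨(2 * n + 4 + 2 * (n * C)) * K, by positivity, fun S b hS hb x => ?_⟩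
  have hA1 : 1 ≤ A := by nlinarith
  rw [op_radial U (contDiff_lw A S hb.smooth)]
  obtain ⟨l1, l2⟩ := hl A S b hA1 hS hb (‖x‖ ^ 2) (by positivity)
  have nb := hb.nonneg (‖x‖ ^ 2)
  have nr := rim_nonneg A S (‖x‖ ^ 2)
  have nc := cut_nonneg A S (‖x‖ ^ 2)
  have nβ := hb.const_nonneg
  rcases lt_or_ge (‖x‖ ^ 2) A with hx | hx
  · rw [deriv_lw_eq_zero S b (by linarith) hx, deriv_deriv_lw_eq_zero S b (by linarith) hx]
    simp only [mul_zero, zero_mul, add_zero, abs_zero]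
    positivity
  have hRx : R < ‖x‖ := lt_of_pow_lt_pow_left₀ 2 (norm_nonneg _) (by linarith)
  have hX := h.abs_rdl_le hRx
  have b1 := hb.bound1 (‖x‖ ^ 2) (by linarith)
  have b2 := hb.bound2 (‖x‖ ^ 2) (by linarith)
  have hρ0 : 0 < ‖x‖ ^ 2 := by linarith
  obtain ⟨ρ, hρ⟩ : ∃ ρ, ρ = ‖x‖ ^ 2 := ⟨_, rfl⟩
  rw [← hρ] at l1 l2 nb nr nc b1 b2 hρ0 ⊢
  have t1 : |deriv (lw A S b) ρ| ≤ cut A S ρ * (β * b ρ / ρ) + K * (b ρ / ρ * rim A S ρ) := by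
    calc _ = |cut A S ρ * deriv b ρ + (deriv (lw A S b) ρ - cut A S ρ * deriv b ρ)| := by ring_nf
      _ ≤ _ := by
        refine (abs_add_le _ _).trans ?_
        rw [abs_mul, abs_of_nonneg nc]
        gcongr
  have t2 : |deriv (deriv (lw A S b)) ρ| ≤
      cut A S ρ * (β * b ρ / ρ ^ 2) + K * (b ρ / ρ ^ 2 * rim A S ρ) := by
    calc _ = |cut A S ρ * deriv (deriv b) ρ +
          (deriv (deriv (lw A S b)) ρ - cut A S ρ * deriv (deriv b) ρ)| := by ring_nf
      _ ≤ _ := by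
        refine (abs_add_le _ _).trans ?_
        rw [abs_mul, abs_of_nonneg nc]
        gcongr
  calc _ ≤ |2 * n * deriv (lw A S b) ρ| + |4 * ρ * deriv (deriv (lw A S b)) ρ|
        + |2 * deriv (lw A S b) ρ * rdl U x| :=
        (abs_add_le _ _).trans (add_le_add_left (abs_add_le _ _) _)
    _ = 2 * n * |deriv (lw A S b) ρ| + 4 * ρ * |deriv (deriv (lw A S b)) ρ|
        + 2 * |deriv (lw A S b) ρ| * |rdl U x| := by
        simp only [abs_mul, abs_two, Nat.abs_cast, abs_of_pos hρ0,
          abs_of_pos (four_pos : (0 : ℝ) < 4)]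
    _ ≤ 2 * n * (cut A S ρ * (β * b ρ / ρ) + K * (b ρ / ρ * rim A S ρ))
        + 4 * ρ * (cut A S ρ * (β * b ρ / ρ ^ 2) + K * (b ρ / ρ ^ 2 * rim A S ρ))
        + 2 * (cut A S ρ * (β * b ρ / ρ) + K * (b ρ / ρ * rim A S ρ)) * (n * C) := by
        gcongr
    _ = _ := by
        field_simp

theorem exists_integral_le_add_rim (n : ℕ) : ∃ K, 0 ≤ K ∧ ∀ A S, 0 < A → 0 < S →
    ∀ (f g : V n → ℝ) (M : ℝ), 0 ≤ M → Integrable f → Integrable g →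
    (∀ x, f x ≤ g x + M * ((‖x‖ ^ 2) ^ (-(n : ℝ) / 2) * rim A S (‖x‖ ^ 2))) →
    ∫ x, f x ≤ (∫ x, g x) + M * K := by
  obtain ⟨K, hK, h⟩ := exists_rim_bound n
  refine ⟨K, hK, fun A S hA hS f g M hM hf hg hle => ?_⟩
  obtain ⟨h1, h2⟩ := h A S hA hS
  calc ∫ x, f x ≤ ∫ x, (g x + M * ((‖x‖ ^ 2) ^ (-(n : ℝ) / 2) * rim A S (‖x‖ ^ 2))) :=
        integral_mono hf (hg.add (h1.const_mul M)) hle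
    _ = (∫ x, g x) + M * ∫ x : V n, (‖x‖ ^ 2) ^ (-(n : ℝ) / 2) * rim A S (‖x‖ ^ 2) := by
        rw [integral_add hg (h1.const_mul M), integral_const_mul]
    _ ≤ _ := by gcongr

theorem rim_eq_zero {A S ρ : ℝ} (h1 : ρ < A) (h2 : A ≤ S) : rim A S ρ = 0 := by
  have hA : ρ ∉ Icc A (2 * A) := fun h => absurd h.1 (by linarith)
  have hS : ρ ∉ Icc S (2 * S) := fun h => absurd h.1 (by linarith)
  simp [rim, dya, hA, hS]

end Operator

section Regularisation

/-- A smooth convex regularisation of `s ↦ (2 max s 0) ^ q`. -/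
noncomputable def rg (δ q s : ℝ) : ℝ := (s + √(s ^ 2 + δ ^ 2)) ^ q

variable {δ q : ℝ}

theorem rg_sqrt_pos (hδ : 0 < δ) (s : ℝ) : 0 < √(s ^ 2 + δ ^ 2) :=
  Real.sqrt_pos.2 (by positivity)

theorem rg_abs_lt (hδ : 0 < δ) (s : ℝ) : |s| < √(s ^ 2 + δ ^ 2) := by
  apply Real.lt_sqrt_of_sq_lt
  rw [sq_abs]
  have := pow_pos hδ 2
  linarith

theorem rg_base_pos (hδ : 0 < δ) (s : ℝ) : 0 < s + √(s ^ 2 + δ ^ 2) := by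
  linarith [rg_abs_lt hδ s, neg_abs_le s]

theorem contDiff_rg_sqrt (hδ : 0 < δ) : ContDiff ℝ ∞ (fun s : ℝ => √(s ^ 2 + δ ^ 2)) :=
  ContDiff.sqrt (by fun_prop) fun s => by positivity

theorem contDiff_rg (hδ : 0 < δ) : ContDiff ℝ ∞ (rg δ q) := by
  unfold rg
  exact ContDiff.rpow_const_of_ne (contDiff_id.add (contDiff_rg_sqrt hδ))
    fun s => (rg_base_pos hδ s).ne'

theorem rg_pos (hδ : 0 < δ) (s : ℝ) : 0 < rg δ q s := Real.rpow_pos_of_pos (rg_base_pos hδ s) q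

theorem deriv_rg_sqrt (hδ : 0 < δ) (s : ℝ) :
    HasDerivAt (fun s : ℝ => √(s ^ 2 + δ ^ 2)) (s / √(s ^ 2 + δ ^ 2)) s := by
  have h1 : HasDerivAt (fun s : ℝ => s ^ 2 + δ ^ 2) (2 * s) s :=
    (((hasDerivAt_id s).fun_pow 2).add_const _).congr_deriv (by simp)
  refine (h1.sqrt (by positivity)).congr_deriv ?_
  have := (rg_sqrt_pos hδ s).ne'
  field_simp

theorem deriv_rg (hδ : 0 < δ) : deriv (rg δ q) = fun s => q * rg δ q s / √(s ^ 2 + δ ^ 2) := by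
  funext s
  have hb := rg_base_pos hδ s
  have hs := rg_sqrt_pos hδ s
  have h := ((hasDerivAt_id s).fun_add (deriv_rg_sqrt hδ s)).rpow_const (p := q) (Or.inl hb.ne')
  have h2 : HasDerivAt (rg δ q) _ s := h
  rw [h2.deriv]
  simp only [id]
  rw [rpow_sub_one' hb, rg]
  field_simp
  ring

theorem deriv_deriv_rg (hδ : 0 < δ) (s : ℝ) : deriv (deriv (rg δ q)) s =
    q * rg δ q s / √(s ^ 2 + δ ^ 2) ^ 2 * (q - s / √(s ^ 2 + δ ^ 2)) := by
  have hs := rg_sqrt_pos hδ s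
  have h0 := hasDerivAt_of_smooth (contDiff_rg (q := q) hδ) s
  rw [deriv_rg hδ] at h0 ⊢
  have := ((h0.const_mul q).fun_div (deriv_rg_sqrt hδ s) hs.ne').deriv
  rw [this]
  field_simp
  try ring

theorem deriv_rg_nonneg (hδ : 0 < δ) (hq : 0 ≤ q) (s : ℝ) : 0 ≤ deriv (rg δ q) s := by
  rw [deriv_rg hδ]
  have := rg_sqrt_pos hδ s
  have := rg_pos (q := q) hδ s
  positivity

theorem rg_ratio_le (hδ : 0 < δ) (s : ℝ) : s / √(s ^ 2 + δ ^ 2) ≤ 1 := by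
  rw [div_le_one (rg_sqrt_pos hδ s)]
  exact (le_abs_self s).trans (rg_abs_lt hδ s).le

theorem deriv_rg_sq_le (hδ : 0 < δ) (hq : 3 / 2 ≤ q) (s : ℝ) :
    deriv (rg δ q) s ^ 2 ≤ 3 * (rg δ q s * deriv (deriv (rg δ q)) s) := by
  rw [deriv_deriv_rg hδ, deriv_rg hδ]
  have h1 := rg_sqrt_pos hδ s
  have h2 := rg_pos (q := q) hδ s
  have h3 := rg_ratio_le hδ s
  calc _ = q * rg δ q s ^ 2 / √(s ^ 2 + δ ^ 2) ^ 2 * q := by ring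
    _ ≤ q * rg δ q s ^ 2 / √(s ^ 2 + δ ^ 2) ^ 2 * (3 * (q - s / √(s ^ 2 + δ ^ 2))) := by
      have : 0 ≤ q * rg δ q s ^ 2 / √(s ^ 2 + δ ^ 2) ^ 2 := by positivity
      gcongr
      linarith
    _ = _ := by ring

theorem deriv_deriv_rg_nonneg (hδ : 0 < δ) (hq : 3 / 2 ≤ q) (s : ℝ) :
    0 ≤ deriv (deriv (rg δ q)) s := by
  have h1 := deriv_rg_sq_le hδ hq s
  have h2 := rg_pos (q := q) hδ s
  by_contra! h
  nlinarith [sq_nonneg (deriv (rg δ q) s)]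

theorem rpow_le_rg (hδ : 0 < δ) (hq : 0 ≤ q) (s : ℝ) : max s 0 ^ q ≤ rg δ q s := by
  refine Real.rpow_le_rpow (le_max_right _ _) ?_ hq
  have := rg_abs_lt hδ s
  have h1 := rg_sqrt_pos hδ s
  rcases le_total s 0 with h | h
  · rw [max_eq_right h]; exact (rg_base_pos hδ s).le
  · rw [max_eq_left h]; linarith

theorem rg_le (hδ : 0 < δ) (hq : 0 ≤ q) (s : ℝ) : rg δ q s ≤ (2 * |s| + δ) ^ q := by
  refine Real.rpow_le_rpow (rg_base_pos hδ s).le ?_ hq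
  have h1 : √(s ^ 2 + δ ^ 2) ≤ |s| + δ := by
    apply Real.sqrt_le_iff.2
    refine ⟨by positivity, ?_⟩
    nlinarith [sq_abs s, abs_nonneg s]
  linarith [le_abs_self s]

end Regularisation

section Products

theorem IsWeight.mul {β₁ β₂ : ℝ} {b₁ b₂ : ℝ → ℝ} (h₁ : IsWeight β₁ b₁) (h₂ : IsWeight β₂ b₂) :
    IsWeight (β₁ + β₂ + 2 * (β₁ * β₂)) (fun ρ => b₁ ρ * b₂ ρ) := by
  have n1 := h₁.const_nonneg
  have n2 := h₂.const_nonneg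
  have e1 : deriv (fun ρ => b₁ ρ * b₂ ρ) = fun ρ => deriv b₁ ρ * b₂ ρ + b₁ ρ * deriv b₂ ρ := by
    funext ρ
    exact ((hasDerivAt_of_smooth h₁.smooth ρ).fun_mul (hasDerivAt_of_smooth h₂.smooth ρ)).deriv
  have e2 : ∀ ρ, deriv (deriv (fun ρ => b₁ ρ * b₂ ρ)) ρ = deriv (deriv b₁) ρ * b₂ ρ
      + b₁ ρ * deriv (deriv b₂) ρ + 2 * (deriv b₁ ρ * deriv b₂ ρ) := by
    intro ρ
    rw [e1]
    rw [(((hasDerivAt_of_smooth (contDiff_deriv h₁.smooth) ρ).fun_mul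
      (hasDerivAt_of_smooth h₂.smooth ρ)).fun_add ((hasDerivAt_of_smooth h₁.smooth ρ).fun_mul
      (hasDerivAt_of_smooth (contDiff_deriv h₂.smooth) ρ))).deriv]
    ring
  refine ⟨h₁.smooth.mul h₂.smooth, fun ρ => mul_nonneg (h₁.nonneg ρ) (h₂.nonneg ρ),
    by positivity, fun ρ hρ => ?_, fun ρ hρ => ?_⟩
  · have h0 : 0 < ρ := by linarith
    have m1 := h₁.nonneg ρ
    have m2 := h₂.nonneg ρ
    rw [e1]
    refine (abs_add_le _ _).trans ?_
    rw [abs_mul, abs_mul, abs_of_nonneg m1, abs_of_nonneg m2]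
    calc _ ≤ β₁ * b₁ ρ / ρ * b₂ ρ + b₁ ρ * (β₂ * b₂ ρ / ρ) := by
          gcongr
          · exact h₁.bound1 ρ hρ
          · exact h₂.bound1 ρ hρ
      _ = (β₁ + β₂) * (b₁ ρ * b₂ ρ) / ρ := by ring
      _ ≤ _ := by
        have := mul_nonneg n1 n2
        gcongr ?_ * (b₁ ρ * b₂ ρ) / ρ
        linarith
  · have h0 : 0 < ρ := by linarith
    have m1 := h₁.nonneg ρ
    have m2 := h₂.nonneg ρ
    rw [e2]
    refine (abs_add_le _ _).trans ((add_le_add_left (abs_add_le _ _) _).trans ?_)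
    rw [abs_mul, abs_mul, abs_mul, abs_mul, abs_of_nonneg m1, abs_of_nonneg m2, abs_two]
    calc _ ≤ β₁ * b₁ ρ / ρ ^ 2 * b₂ ρ + b₁ ρ * (β₂ * b₂ ρ / ρ ^ 2)
          + 2 * (β₁ * b₁ ρ / ρ * (β₂ * b₂ ρ / ρ)) := by
          gcongr
          · exact h₁.bound2 ρ hρ
          · exact h₂.bound2 ρ hρ
          · exact h₁.bound1 ρ hρ
          · exact h₂.bound1 ρ hρ
      _ = _ := by field_simp

theorem deriv_mul_pw_neg_one {b : ℝ → ℝ} (hb : ContDiff ℝ ∞ b) {ρ : ℝ} (h : 1 / 2 < ρ) :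
    deriv (fun ρ => b ρ * pw (-1) ρ) ρ = deriv b ρ / ρ - b ρ / ρ ^ 2 := by
  rw [((hasDerivAt_of_smooth hb ρ).fun_mul (hasDerivAt_of_smooth (contDiff_pw (-1)) ρ)).deriv,
    deriv_pw _ h, pw_eq _ h.le, Real.rpow_neg_one, show (-1 - 1 : ℝ) = -(2 : ℕ) by norm_num,
    Real.rpow_neg (by linarith), Real.rpow_natCast]
  ring

variable {n : ℕ}

theorem integral_radial_field {f : V n → ℝ} (hf : ContDiff ℝ ∞ f) {g : ℝ → ℝ}
    (hg : ContDiff ℝ ∞ g) (hs : HasCompactSupport (fun x : V n => g (‖x‖ ^ 2))) :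
    Integrable (fun x => f x * (n * g (‖x‖ ^ 2) + 2 * ‖x‖ ^ 2 * deriv g (‖x‖ ^ 2))) ∧
    ∫ x, f x * (n * g (‖x‖ ^ 2) + 2 * ‖x‖ ^ 2 * deriv g (‖x‖ ^ 2)) =
      -∫ x, (∑ i, pd i f x * x i) * g (‖x‖ ^ 2) := by
  have sg : ContDiff ℝ ∞ (fun x : V n => g (‖x‖ ^ 2)) := hg.comp contDiff_norm_sq'
  have sc : ∀ i, ContDiff ℝ ∞ (fun x : V n => x i) := fun i =>
    (EuclideanSpace.proj i : V n →L[ℝ] ℝ).contDiff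
  have sp : ∀ i, ContDiff ℝ ∞ (fun x : V n => x i * g (‖x‖ ^ 2)) := fun i => (sc i).mul sg
  have cp : ∀ i, HasCompactSupport (fun x : V n => x i * g (‖x‖ ^ 2)) := fun i => hs.mul_left
  have i1 : ∀ i, Integrable (fun x => f x * pd i (fun y : V n => y i * g (‖y‖ ^ 2)) x) := fun i =>
    integrable_mul_test hf.continuous (contDiff_pd i (sp i)).continuous
      (hasCompactSupport_pd (cp i) i)
  have i2 : ∀ i, Integrable (fun x => pd i f x * (x i * g (‖x‖ ^ 2))) := fun i =>
    integrable_mul_test (contDiff_pd i hf).continuous (sp i).continuous (cp i)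
  have e1 : (fun x => f x * (n * g (‖x‖ ^ 2) + 2 * ‖x‖ ^ 2 * deriv g (‖x‖ ^ 2))) =
      fun x => ∑ i, f x * pd i (fun y : V n => y i * g (‖y‖ ^ 2)) x := by
    funext x
    rw [← Finset.mul_sum]
    congr 1
    have : ∀ i, pd i (fun y : V n => y i * g (‖y‖ ^ 2)) x =
        g (‖x‖ ^ 2) + 2 * deriv g (‖x‖ ^ 2) * (x i * x i) := by
      intro i
      rw [pd_mul (sc i) sg, pd_coord, pd_radial hg]
      simp only [if_true]
      ring
    simp only [this]
    rw [Finset.sum_add_distrib, ← Finset.mul_sum, sum_sq_eq]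
    simp
    ring
  rw [e1]
  refine ⟨integrable_finsetSum _ fun i _ => i1 i, ?_⟩
  rw [integral_finsetSum _ fun i _ => i1 i]
  simp only [Finset.sum_mul, mul_assoc]
  rw [integral_finsetSum _ fun i _ => i2 i, ← Finset.sum_neg_distrib]
  exact Finset.sum_congr rfl fun i _ => integral_mul_pd hf (sp i) (cp i) i

end Products

section Interpolating

theorem bw_le {ε κ ρ : ℝ} (hκ : 0 ≤ κ) (h : 1 / 2 ≤ ρ) : bw ε κ ρ ≤ ρ ^ ε := by
  have h0 : 0 < ρ := by linarith
  have h1 := pw_pos (-ε) ρ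
  have h2 := mul_nonneg hκ (pw_pos ε ρ).le
  calc bw ε κ ρ ≤ (pw (-ε) ρ)⁻¹ := by
        unfold bw
        gcongr
        linarith
    _ = ρ ^ ε := by rw [pw_eq _ h, Real.rpow_neg h0.le, inv_inv]

theorem bw_le_one {ε S ρ : ℝ} (hε : 0 ≤ ε) (hS : 1 ≤ S) (h : S ≤ ρ) : bw ε (S ^ (-ε)) ρ ≤ 1 := by
  have hS0 : 0 < S := by linarith
  have h1 := pw_pos (-ε) ρ
  unfold bw
  apply inv_le_one_of_one_le₀
  have : 1 ≤ S ^ (-ε) * pw ε ρ := by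
    rw [pw_eq _ (by linarith), Real.rpow_neg hS0.le, inv_mul_eq_div, one_le_div (by positivity)]
    gcongr
  linarith

theorem le_bw {ε S ρ : ℝ} (hε : 0 ≤ ε) (h : 1 ≤ ρ) (hS : ρ ^ 2 ≤ S) :
    ρ ^ ε / 2 ≤ bw ε (S ^ (-ε)) ρ := by
  have h0 : 0 < ρ := by linarith
  have hS0 : 0 < S := by nlinarith
  have p1 := Real.rpow_pos_of_pos h0 ε
  have : S ^ (-ε) * pw ε ρ ≤ ρ ^ (-ε) := by
    rw [pw_eq _ (by linarith), Real.rpow_neg hS0.le, Real.rpow_neg h0.le, inv_mul_eq_div,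
      div_le_iff₀ (by positivity), inv_mul_eq_div, le_div_iff₀ p1, ← Real.mul_rpow h0.le h0.le]
    refine Real.rpow_le_rpow (by positivity) (by nlinarith) hε
  unfold bw
  rw [le_inv_comm₀ (by positivity) (bw_base_pos (by positivity) ε ρ)]
  rw [pw_eq (-ε) (by linarith)]
  have e : (ρ ^ ε / 2)⁻¹ = 2 * ρ ^ (-ε) := by
    rw [Real.rpow_neg h0.le]; field_simp
  rw [e]
  linarith

theorem bw_mul_rim_le {ε A S ρ : ℝ} (hε : 0 ≤ ε) (hε1 : ε ≤ 1) (hA : 1 ≤ A) (hS : A ≤ S) :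
    bw ε (S ^ (-ε)) ρ * rim A S ρ ≤ 2 * A * rim A S ρ := by
  have hκ : 0 ≤ S ^ (-ε) := Real.rpow_nonneg (by linarith) _
  have h1 : bw ε (S ^ (-ε)) ρ * dya A ρ ≤ 2 * A * dya A ρ := by
    by_cases h : ρ ∈ Icc A (2 * A)
    · have := dya_nonneg A ρ
      gcongr
      calc _ ≤ ρ ^ ε := bw_le hκ (by linarith [h.1])
        _ ≤ ρ ^ (1 : ℝ) := Real.rpow_le_rpow_of_exponent_le (by linarith [h.1]) hε1
        _ = ρ := Real.rpow_one ρ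
        _ ≤ _ := h.2
    · simp [dya, h]
  have h2 : bw ε (S ^ (-ε)) ρ * dya S ρ ≤ 2 * A * dya S ρ := by
    by_cases h : ρ ∈ Icc S (2 * S)
    · have := dya_nonneg S ρ
      gcongr
      linarith [bw_le_one hε (by linarith) h.1]
    · simp [dya, h]
  unfold rim
  linarith

theorem rim_ne_zero {A S ρ : ℝ} (hA : A ≤ S) (h : rim A S ρ ≠ 0) : A ≤ ρ ∧ ρ ≤ 2 * S := by
  by_contra hc
  rw [not_and_or, not_le, not_le] at hc
  apply h
  rcases hc with hc | hc
  · exact rim_eq_zero hc hA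
  · have hA : ρ ∉ Icc A (2 * A) := fun h => absurd h.2 (by linarith)
    have hS : ρ ∉ Icc S (2 * S) := fun h => absurd h.2 (by linarith)
    simp [rim, dya, hA, hS]

end Interpolating

section Head

variable {n : ℕ} {U : Fin n → V n → ℝ} {P : V n → ℝ} {R C A : ℝ}

theorem IsSol.integrable_op (h : IsSol U P R C) {f ζ : V n → ℝ} (hf : Continuous f)
    (hζ : IsTest A ζ) : Integrable (fun x => f x * (lap ζ x + ∑ i, U i x * pd i ζ x)) := by
  have s1 : ∀ i, Integrable (fun x => f x * U i x * pd i ζ x) := fun i =>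
    integrable_mul_test (hf.mul (h.smooth i).continuous) (contDiff_pd i hζ.smooth).continuous
      (hasCompactSupport_pd hζ.compact i)
  have s3 : Integrable (fun x => f x * lap ζ x) :=
    integrable_mul_test hf (contDiff_lap hζ.smooth).continuous (hasCompactSupport_lap hζ.compact)
  refine (s3.add (integrable_finsetSum Finset.univ fun i _ => s1 i)).congr (ae_of_all _ fun x => ?_)
  simp only [Pi.add_apply, mul_add, Finset.mul_sum, mul_assoc]

theorem lw_mul_pw_neg_one {b : ℝ → ℝ} (S : ℝ) (hA : 1 ≤ A) (ρ : ℝ) :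
    lw A S (fun ρ => b ρ * pw (-1) ρ) ρ = cut A S ρ * (b ρ / ρ) := by
  unfold lw
  rcases le_or_gt ρ A with h | h
  · rw [cut_eq_zero_of_le S (by linarith) h]; ring
  · beta_reduce
    rw [pw_eq _ (by linarith), Real.rpow_neg_one]; ring

theorem IsDecaying.rg_head_le (h : IsDecaying U P R C) (hA : R ^ 2 < A) {S q : ℝ} (hq : 0 ≤ q)
    {x : V n} (h1 : A ≤ ‖x‖ ^ 2) (h2 : ‖x‖ ^ 2 ≤ 2 * S) :
    rg (1 / S) q (head U P x) ≤ (2 * C + 2) ^ q * (‖x‖ ^ 2) ^ (-q) := by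
  have hR := h.one_le
  have h0 := h.nonneg
  have hρ : 0 < ‖x‖ ^ 2 := by nlinarith
  have hS : 0 < S := by linarith
  have hRx : R < ‖x‖ := lt_of_pow_lt_pow_left₀ 2 (norm_nonneg _) (by linarith)
  refine (rg_le (by positivity) hq _).trans ?_
  rw [Real.rpow_neg hρ.le, ← div_eq_mul_inv, ← Real.div_rpow (by positivity) hρ.le]
  refine Real.rpow_le_rpow (by positivity) ?_ hq
  have e1 := h.bound_head x hRx
  have e2 : 1 / S ≤ 2 / ‖x‖ ^ 2 := by
    rw [div_le_div_iff₀ hS hρ]; linarith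
  calc _ ≤ 2 * (C / ‖x‖ ^ 2) + 2 / ‖x‖ ^ 2 := by gcongr
    _ = _ := by ring

theorem IsDecaying.rg_head_mul_rim_le (h : IsDecaying U P R C) (hn : 5 ≤ n) (hA : R ^ 2 < A)
    {S ε : ℝ} (hε : 0 ≤ ε) (hε1 : ε ≤ 1) (hS : A ≤ S) (x : V n) :
    rg (1 / S) (n / 2 - 1) (head U P x) *
      (bw ε (S ^ (-ε)) (‖x‖ ^ 2) / ‖x‖ ^ 2 * rim A S (‖x‖ ^ 2)) ≤
      (2 * C + 2) ^ ((n : ℝ) / 2 - 1) * (2 * A) *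
        ((‖x‖ ^ 2) ^ (-(n : ℝ) / 2) * rim A S (‖x‖ ^ 2)) := by
  have hR := h.one_le
  have h0 := h.nonneg
  have hA1 : 1 ≤ A := by nlinarith
  by_cases hr : rim A S (‖x‖ ^ 2) = 0
  · rw [hr]; simp
  obtain ⟨m1, m2⟩ := rim_ne_zero hS hr
  have hρ : 0 < ‖x‖ ^ 2 := by linarith
  have hn' : (5 : ℝ) ≤ n := by exact_mod_cast hn
  have hf := h.rg_head_le hA (q := n / 2 - 1) (by linarith) m1 m2
  have hb := bw_mul_rim_le (ρ := ‖x‖ ^ 2) hε hε1 hA1 hS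
  have nr := rim_nonneg A S (‖x‖ ^ 2)
  have e : (‖x‖ ^ 2) ^ (-((n : ℝ) / 2 - 1)) / ‖x‖ ^ 2 = (‖x‖ ^ 2) ^ (-(n : ℝ) / 2) := by
    rw [← Real.rpow_sub_one hρ.ne']
    ring_nf
  have nbw : 0 ≤ bw ε (S ^ (-ε)) (‖x‖ ^ 2) :=
    (isWeight_bw hε hε1 (Real.rpow_nonneg (by linarith) _)).nonneg _
  calc _ ≤ (2 * C + 2) ^ ((n : ℝ) / 2 - 1) * (‖x‖ ^ 2) ^ (-((n : ℝ) / 2 - 1)) *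
        (2 * A * rim A S (‖x‖ ^ 2) / ‖x‖ ^ 2) := by
        rw [div_mul_eq_mul_div]
        gcongr
    _ = _ := by rw [← e]; ring

/-- The energy estimate for convex functions of the head pressure. -/
theorem IsDecaying.exists_energy_bound (h : IsDecaying U P R C) (hn : 5 ≤ n) (hA : R ^ 2 < A)
    {ε : ℝ} (hε : 0 ≤ ε) (hε1 : ε ≤ 1) :
    ∃ K, 0 ≤ K ∧ ∀ S, A ≤ S →
      ∫ x, (deriv (deriv (rg (1 / S) (n / 2 - 1))) (head U P x) * ∑ i, pd i (head U P) x ^ 2)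
          * lw A S (bw ε (S ^ (-ε))) (‖x‖ ^ 2) ≤
        (2 * n + 4 + 2 * (n * C)) * (4 * ε) * (∫ x, rg (1 / S) (n / 2 - 1) (head U P x) *
          lw A S (fun ρ => bw ε (S ^ (-ε)) ρ * pw (-1) ρ) (‖x‖ ^ 2)) + K := by
  have hR := h.one_le
  have h0 := h.nonneg
  have hA1 : 1 ≤ A := by nlinarith
  have hn' : (5 : ℝ) ≤ n := by exact_mod_cast hn
  obtain ⟨K₀, hK₀, hop⟩ := h.toIsSol.exists_op_bound hA (4 * ε)
  obtain ⟨K₁, hK₁, h_int⟩ := exists_integral_le_add_rim n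
  refine ⟨K₀ * ((2 * C + 2) ^ ((n : ℝ) / 2 - 1) * (2 * A)) * K₁, by positivity, fun S hS => ?_⟩
  have hS0 : 0 < S := by linarith
  have hδ : 0 < 1 / S := by positivity
  have hb : IsWeight (4 * ε) (bw ε (S ^ (-ε))) :=
    isWeight_bw hε hε1 (Real.rpow_nonneg hS0.le _)
  have hζ : IsTest A (fun x : V n => lw A S (bw ε (S ^ (-ε))) (‖x‖ ^ 2)) :=
    isTest_lw (by linarith) hS0 hb.smooth
  have hζ1 : IsTest A (fun x : V n => lw A S (fun ρ => bw ε (S ^ (-ε)) ρ * pw (-1) ρ) (‖x‖ ^ 2)) :=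
    isTest_lw (by linarith) hS0 (hb.smooth.mul (contDiff_pw _))
  have hF : ContDiff ℝ ∞ (rg (1 / S) ((n : ℝ) / 2 - 1)) := contDiff_rg hδ
  have hH := contDiff_head h.smooth h.smoothP
  have hgrad : Continuous (fun x => ∑ i, pd i (head U P) x ^ 2) :=
    continuous_finsetSum _ fun i _ => (contDiff_pd i hH).continuous.pow 2
  have hF1 : Continuous (fun x => deriv (rg (1 / S) ((n : ℝ) / 2 - 1)) (head U P x)) :=
    (contDiff_deriv hF).continuous.comp hH.continuous
  have hF2 : Continuous (fun x => deriv (deriv (rg (1 / S) ((n : ℝ) / 2 - 1))) (head U P x)) :=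
    (contDiff_deriv (contDiff_deriv hF)).continuous.comp hH.continuous
  have hF0 : Continuous (fun x => rg (1 / S) ((n : ℝ) / 2 - 1) (head U P x)) :=
    hF.continuous.comp hH.continuous
  have hE := (contDiff_ens h.smooth).continuous
  have i1 := integrable_mul_test (hF2.mul hgrad) hζ.smooth.continuous hζ.compact
  have i2 := integrable_mul_test ((hF1.mul hE).add (hF2.mul hgrad)) hζ.smooth.continuous hζ.compact
  have i3 := integrable_mul_test hF0 hζ1.smooth.continuous hζ1.compact
  have i4 := h.toIsSol.integrable_op hF0 hζ
  have key := h.toIsSol.integral_head hA.le hF hζ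
  have step1 : ∫ x, (deriv (deriv (rg (1 / S) (n / 2 - 1))) (head U P x) *
      ∑ i, pd i (head U P) x ^ 2) * lw A S (bw ε (S ^ (-ε))) (‖x‖ ^ 2) ≤
      ∫ x, (deriv (rg (1 / S) (n / 2 - 1)) (head U P x) * ens U x +
        deriv (deriv (rg (1 / S) (n / 2 - 1))) (head U P x) *
          ∑ i, pd i (head U P) x ^ 2) * lw A S (bw ε (S ^ (-ε))) (‖x‖ ^ 2) := by
    refine integral_mono i1 i2 fun x => ?_
    have h1 := lw_nonneg A S hb.nonneg (‖x‖ ^ 2)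
    have h2 := deriv_rg_nonneg hδ (q := n / 2 - 1) (by linarith) (head U P x)
    have h3 : 0 ≤ ens U x := by
      unfold ens
      exact mul_nonneg (by norm_num) (Finset.sum_nonneg fun i _ => Finset.sum_nonneg fun j _ =>
        mul_self_nonneg _)
    dsimp only
    gcongr
    have := mul_nonneg h2 h3
    linarith
  refine step1.trans ?_
  simp only [mul_comm _ (lw A S (bw ε (S ^ (-ε))) _)]
  rw [← key, ← integral_const_mul]
  refine h_int A S (by linarith) hS0 _ _ _ (by positivity) i4 (i3.const_mul _) fun x => ?_
  have e1 := hop S _ hS0 hb x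
  have e2 := h.rg_head_mul_rim_le hn hA hε hε1 hS x
  have e3 := (rg_pos (q := n / 2 - 1) hδ (head U P x)).le
  rw [lw_mul_pw_neg_one S hA1]
  calc _ ≤ rg (1 / S) (n / 2 - 1) (head U P x) *
        ((2 * n + 4 + 2 * (n * C)) * (4 * ε) *
          (cut A S (‖x‖ ^ 2) * (bw ε (S ^ (-ε)) (‖x‖ ^ 2) / ‖x‖ ^ 2))
          + K₀ * (bw ε (S ^ (-ε)) (‖x‖ ^ 2) / ‖x‖ ^ 2 * rim A S (‖x‖ ^ 2))) :=
        mul_le_mul_of_nonneg_left ((le_abs_self _).trans e1) e3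
    _ = (2 * n + 4 + 2 * (n * C)) * (4 * ε) * (rg (1 / S) (n / 2 - 1) (head U P x) *
          (cut A S (‖x‖ ^ 2) * (bw ε (S ^ (-ε)) (‖x‖ ^ 2) / ‖x‖ ^ 2)))
          + K₀ * (rg (1 / S) (n / 2 - 1) (head U P x) *
            (bw ε (S ^ (-ε)) (‖x‖ ^ 2) / ‖x‖ ^ 2 * rim A S (‖x‖ ^ 2))) := by ring
    _ ≤ _ := by
      rw [mul_assoc K₀]
      gcongr

end Head

section Hardy

variable {n : ℕ} {U : Fin n → V n → ℝ} {P : V n → ℝ} {R C A : ℝ}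

theorem hardy_pointwise {F F' F'' D N ρ : ℝ} (hF : 0 ≤ F) (hF'' : 0 ≤ F'') (hN : 0 ≤ N)
    (hρ : 0 ≤ ρ) (h1 : F' ^ 2 ≤ 3 * (F * F'')) (h2 : D ^ 2 ≤ N * ρ) :
    -(F' * D) ≤ 1 / 2 * F + 3 / 2 * (F'' * N * ρ) := by
  have h3 : |F' * D| ≤ 1 / 2 * F + 3 / 2 * (F'' * N * ρ) := by
    apply abs_le_of_sq_le_sq _ (by positivity)
    calc (F' * D) ^ 2 = F' ^ 2 * D ^ 2 := by ring
      _ ≤ 3 * (F * F'') * (N * ρ) := by gcongr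
      _ ≤ _ := by nlinarith [sq_nonneg (1 / 2 * F - 3 / 2 * (F'' * N * ρ))]
  linarith [neg_abs_le (F' * D)]

theorem IsDecaying.exists_hardy_bound (h : IsDecaying U P R C) (hn : 5 ≤ n) (hA : R ^ 2 < A) :
    ∃ ε K, 0 < ε ∧ ε ≤ 1 ∧ 0 ≤ K ∧ ∀ S, A ≤ S →
      ∫ x, rg (1 / S) (n / 2 - 1) (head U P x) *
        lw A S (fun ρ => bw ε (S ^ (-ε)) ρ * pw (-1) ρ) (‖x‖ ^ 2) ≤ K := by
  have hR := h.one_le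
  have h0 := h.nonneg
  have hA1 : 1 ≤ A := by nlinarith
  have hn' : (5 : ℝ) ≤ n := by exact_mod_cast hn
  obtain ⟨c, hc⟩ : ∃ c : ℝ, c = 2 * n + 4 + 2 * (n * C) := ⟨_, rfl⟩
  have hc0 : 0 ≤ c := by rw [hc]; positivity
  obtain ⟨ε, hε⟩ : ∃ ε : ℝ, ε = 1 / (8 + 6 * c) := ⟨_, rfl⟩
  have hε0 : 0 < ε := by rw [hε]; positivity
  have hεc : ε * (8 + 6 * c) = 1 := by rw [hε]; field_simp
  have hε1 : ε ≤ 1 := by nlinarith [mul_nonneg hε0.le hc0]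
  obtain ⟨K₀, hK₀, hen⟩ := h.exists_energy_bound hn hA hε0.le hε1
  obtain ⟨K₁, hK₁, h_int⟩ := exists_integral_le_add_rim n
  have hβ := ((isWeight_bw (ε := ε) (κ := 0) hε0.le hε1 le_rfl).mul (isWeight_pw (-1))).const_nonneg
  obtain ⟨K₂, hK₂, hlw⟩ := exists_lw_bound (4 * ε + (|(-1 : ℝ)| + |(-1) * (-1 - 1 : ℝ)|)
    + 2 * (4 * ε * (|(-1 : ℝ)| + |(-1) * (-1 - 1 : ℝ)|)))
  obtain ⟨M, hM⟩ : ∃ M, M = (2 * C + 2) ^ ((n : ℝ) / 2 - 1) * (2 * A) := ⟨_, rfl⟩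
  have hM0 : 0 ≤ M := by rw [hM]; positivity
  refine ⟨ε, 3 / 2 * K₀ + 2 * K₂ * M * K₁, hε0, hε1, by positivity, fun S hS => ?_⟩
  have hS0 : 0 < S := by linarith
  have hδ : 0 < 1 / S := by positivity
  obtain ⟨b, hbd⟩ : ∃ b, b = bw ε (S ^ (-ε)) := ⟨_, rfl⟩
  have hb : IsWeight (4 * ε) b := by
    rw [hbd]; exact isWeight_bw hε0.le hε1 (Real.rpow_nonneg hS0.le _)
  obtain ⟨b₁, hb₁d⟩ : ∃ b₁, b₁ = fun ρ => b ρ * pw (-1) ρ := ⟨_, rfl⟩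
  have hb₁ := hb.mul (isWeight_pw (-1))
  rw [← hb₁d] at hb₁
  obtain ⟨F, hFd⟩ : ∃ F, F = rg (1 / S) ((n : ℝ) / 2 - 1) := ⟨_, rfl⟩
  have hF : ContDiff ℝ ∞ F := by rw [hFd]; exact contDiff_rg hδ
  have hF0 : ∀ s, 0 ≤ F s := fun s => by rw [hFd]; exact (rg_pos hδ s).le
  have hF2 : ∀ s, 0 ≤ deriv (deriv F) s := fun s => by
    rw [hFd]; exact deriv_deriv_rg_nonneg hδ (by linarith) s
  have hF1 : ∀ s, deriv F s ^ 2 ≤ 3 * (F s * deriv (deriv F) s) := fun s => by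
    rw [hFd]; exact deriv_rg_sq_le hδ (by linarith) s
  have hrim : ∀ x, F (head U P x) * (b (‖x‖ ^ 2) / ‖x‖ ^ 2 * rim A S (‖x‖ ^ 2)) ≤
      M * ((‖x‖ ^ 2) ^ (-(n : ℝ) / 2) * rim A S (‖x‖ ^ 2)) := fun x => by
    rw [hFd, hbd, hM]; exact h.rg_head_mul_rim_le hn hA hε0.le hε1 hS x
  have hen' := hen S hS
  rw [← hFd, ← hbd, ← hb₁d, ← hc] at hen'
  rw [← hFd, ← hbd, ← hb₁d]
  have hH := contDiff_head h.smooth h.smoothP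
  have hFH : ContDiff ℝ ∞ (fun x => F (head U P x)) := hF.comp hH
  have hζ : IsTest A (fun x : V n => lw A S b (‖x‖ ^ 2)) := isTest_lw (by linarith) hS0 hb.smooth
  have hζ1 : IsTest A (fun x : V n => lw A S b₁ (‖x‖ ^ 2)) := isTest_lw (by linarith) hS0 hb₁.smooth
  obtain ⟨j1, j2⟩ := integral_radial_field hFH (contDiff_lw A S hb₁.smooth) hζ1.compact
  have hgrad : Continuous (fun x => ∑ i, pd i (head U P) x ^ 2) :=
    continuous_finsetSum _ fun i _ => (contDiff_pd i hH).continuous.pow 2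
  have i1 : Integrable (fun x => (deriv (deriv F) (head U P x) * ∑ i, pd i (head U P) x ^ 2)
      * lw A S b (‖x‖ ^ 2)) := integrable_mul_test (((contDiff_deriv (contDiff_deriv hF)).continuous.comp
    hH.continuous).mul hgrad) hζ.smooth.continuous hζ.compact
  have i3 := integrable_mul_test hFH.continuous hζ1.smooth.continuous hζ1.compact
  have i4 : Integrable (fun x => (∑ i, pd i (fun y => F (head U P y)) x * x i)
      * lw A S b₁ (‖x‖ ^ 2)) := by
    refine integrable_mul_test (continuous_finsetSum _ fun i _ =>
      (contDiff_pd i hFH).continuous.mul ?_) hζ1.smooth.continuous hζ1.compact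
    exact (EuclideanSpace.proj i : V n →L[ℝ] ℝ).continuous
  have hlb : ∀ ρ, lw A S b₁ ρ = cut A S ρ * (b ρ / ρ) := fun ρ => by
    rw [hb₁d]; exact lw_mul_pw_neg_one S hA1 ρ
  -- the lower bound
  have low : (n - 2 - 8 * ε) * ∫ x, F (head U P x) * lw A S b₁ (‖x‖ ^ 2) ≤
      (∫ x, F (head U P x) * (n * lw A S b₁ (‖x‖ ^ 2) +
        2 * ‖x‖ ^ 2 * deriv (lw A S b₁) (‖x‖ ^ 2))) + 2 * K₂ * M * K₁ := by
    rw [← integral_const_mul]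
    refine h_int A S (by linarith) hS0 _ _ _ (by positivity) (i3.const_mul _) j1 fun x => ?_
    have hx0 := hF0 (head U P x)
    have hr := hrim x
    obtain ⟨l1, -⟩ := hlw A S b₁ hA1 hS0 hb₁ (‖x‖ ^ 2) (by positivity)
    have nc := cut_nonneg A S (‖x‖ ^ 2)
    have nr := rim_nonneg A S (‖x‖ ^ 2)
    have nb := hb.nonneg (‖x‖ ^ 2)
    rcases lt_or_ge (‖x‖ ^ 2) A with hx | hx
    · rw [deriv_lw_eq_zero S b₁ (by linarith) hx, lw_eq_zero S b₁ (by linarith) hx.le,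
        rim_eq_zero hx hS]
      simp
    have b1 := hb.bound1 (‖x‖ ^ 2) (by linarith)
    have hd : deriv b₁ (‖x‖ ^ 2) =
        deriv b (‖x‖ ^ 2) / ‖x‖ ^ 2 - b (‖x‖ ^ 2) / (‖x‖ ^ 2) ^ 2 := by
      rw [hb₁d]; exact deriv_mul_pw_neg_one hb.smooth (by linarith)
    have hbb : b₁ (‖x‖ ^ 2) = b (‖x‖ ^ 2) / ‖x‖ ^ 2 := by
      rw [hb₁d]
      beta_reduce
      rw [pw_eq _ (by linarith), Real.rpow_neg_one]; ring
    have hρ : 0 < ‖x‖ ^ 2 := by linarith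
    rw [hbb, hd] at l1
    rw [hlb]
    obtain ⟨ρ, hρd⟩ : ∃ ρ, ρ = ‖x‖ ^ 2 := ⟨_, rfl⟩
    rw [← hρd] at l1 nc nr nb b1 hr hρ ⊢
    have e1 : cut A S ρ * (deriv b ρ / ρ - b ρ / ρ ^ 2) - K₂ * (b ρ / ρ / ρ * rim A S ρ) ≤
        deriv (lw A S b₁) ρ := by linarith [neg_abs_le (deriv (lw A S b₁) ρ -
          cut A S ρ * (deriv b ρ / ρ - b ρ / ρ ^ 2))]
    have e2 : -(4 * ε * b ρ / ρ) / ρ ≤ deriv b ρ / ρ := by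
      gcongr
      linarith [neg_abs_le (deriv b ρ)]
    have e3 : cut A S ρ * (-(4 * ε * b ρ / ρ) / ρ - b ρ / ρ ^ 2) ≤
        cut A S ρ * (deriv b ρ / ρ - b ρ / ρ ^ 2) := by gcongr
    have e4 : 2 * ρ * (cut A S ρ * (-(4 * ε * b ρ / ρ) / ρ - b ρ / ρ ^ 2) -
        K₂ * (b ρ / ρ / ρ * rim A S ρ)) ≤ 2 * ρ * deriv (lw A S b₁) ρ := by
      gcongr
      linarith
    have e5 : 2 * ρ * (cut A S ρ * (-(4 * ε * b ρ / ρ) / ρ - b ρ / ρ ^ 2) -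
        K₂ * (b ρ / ρ / ρ * rim A S ρ)) =
        -((8 * ε + 2) * (cut A S ρ * (b ρ / ρ))) - 2 * K₂ * (b ρ / ρ * rim A S ρ) := by
      field_simp
      ring
    rw [e5] at e4
    have e6 : (n - 2 - 8 * ε) * (cut A S ρ * (b ρ / ρ)) - 2 * K₂ * (b ρ / ρ * rim A S ρ) ≤
        n * (cut A S ρ * (b ρ / ρ)) + 2 * ρ * deriv (lw A S b₁) ρ := by linarith
    have e7 := mul_le_mul_of_nonneg_left e6 hx0
    have e8 := mul_le_mul_of_nonneg_left hr (by positivity : 0 ≤ 2 * K₂)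
    linarith
  -- the upper bound
  have up : (∫ x, F (head U P x) * (n * lw A S b₁ (‖x‖ ^ 2) +
        2 * ‖x‖ ^ 2 * deriv (lw A S b₁) (‖x‖ ^ 2))) ≤
      1 / 2 * (∫ x, F (head U P x) * lw A S b₁ (‖x‖ ^ 2)) +
      3 / 2 * ∫ x, (deriv (deriv F) (head U P x) * ∑ i, pd i (head U P) x ^ 2)
        * lw A S b (‖x‖ ^ 2) := by
    rw [j2, ← integral_neg, ← integral_const_mul, ← integral_const_mul,
      ← integral_add (i3.const_mul _) (i1.const_mul _)]
    refine integral_mono i4.neg ((i3.const_mul _).add (i1.const_mul _)) fun x => ?_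
    dsimp only [Pi.add_apply, Function.comp]
    rcases lt_or_ge (‖x‖ ^ 2) A with hx | hx
    · rw [lw_eq_zero S b₁ (by linarith) hx.le, lw_eq_zero S b (by linarith) hx.le]
      simp
    have hρ : 0 < ‖x‖ ^ 2 := by linarith
    have e1 : ∑ i, pd i (fun y => F (head U P y)) x * x i =
        deriv F (head U P x) * ∑ i, pd i (head U P) x * x i := by
      rw [Finset.mul_sum]
      exact Finset.sum_congr rfl fun i _ => by rw [pd_comp hF hH]; ring
    have e2 : (∑ i, pd i (head U P) x * x i) ^ 2 ≤ (∑ i, pd i (head U P) x ^ 2) * ‖x‖ ^ 2 := by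
      rw [← sum_sq_eq]
      simp only [← sq]
      exact Finset.sum_mul_sq_le_sq_mul_sq _ _ _
    have e3 := hardy_pointwise (hF0 (head U P x)) (hF2 (head U P x))
      (Finset.sum_nonneg fun i _ => sq_nonneg (pd i (head U P) x)) hρ.le (hF1 _) e2
    have e4 : lw A S b (‖x‖ ^ 2) = ‖x‖ ^ 2 * lw A S b₁ (‖x‖ ^ 2) := by
      rw [hlb, lw, mul_left_comm, mul_div_cancel₀ _ hρ.ne']
    have e5 := mul_le_mul_of_nonneg_right e3 (lw_nonneg A S hb₁.nonneg (‖x‖ ^ 2))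
    rw [e1, e4]
    linarith
  have hJ : 0 ≤ ∫ x, F (head U P x) * lw A S b₁ (‖x‖ ^ 2) :=
    integral_nonneg fun x => mul_nonneg (hF0 _) (lw_nonneg A S hb₁.nonneg _)
  obtain ⟨J, hJd⟩ : ∃ J, J = ∫ x, F (head U P x) * lw A S b₁ (‖x‖ ^ 2) := ⟨_, rfl⟩
  rw [← hJd] at low up hen' hJ ⊢
  have hfin : (n - 2 - 8 * ε - 1 / 2 - 6 * (c * ε)) * J ≤ 3 / 2 * K₀ + 2 * K₂ * M * K₁ := by
    linarith
  have hcoef : 1 ≤ (n - 2 - 8 * ε - 1 / 2 - 6 * (c * ε) : ℝ) := by linarith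
  nlinarith

end Hardy

section PositivePart

variable {n : ℕ} {U : Fin n → V n → ℝ} {P : V n → ℝ} {R C A : ℝ}

theorem young_rpow {h ρ q ε : ℝ} (hh : 0 ≤ h) (hρ : 1 ≤ ρ) (hq : 1 < q) :
    h * ρ ^ (-q) ≤ h ^ q * ρ ^ (ε - 1) + ρ ^ (-(q + 1) - ε / (q - 1)) := by
  have h0 : 0 < ρ := by linarith
  have hq1 : q - 1 ≠ 0 := by linarith
  obtain ⟨T, hT⟩ : ∃ T, T = ρ ^ (-1 - ε / (q - 1)) := ⟨_, rfl⟩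
  have T0 : 0 < T := by rw [hT]; positivity
  rcases le_or_gt h T with hle | hgt
  · calc h * ρ ^ (-q) ≤ T * ρ ^ (-q) := by gcongr
      _ = ρ ^ (-(q + 1) - ε / (q - 1)) := by
        rw [hT, ← Real.rpow_add h0]; congr 1; ring
      _ ≤ _ := by
        have : 0 ≤ h ^ q * ρ ^ (ε - 1) := by positivity
        linarith
  · have hh0 : 0 < h := T0.trans hgt
    calc h * ρ ^ (-q) = h ^ q * h ^ (-(q - 1)) * ρ ^ (-q) := by
          rw [← Real.rpow_add hh0, show q + -(q - 1) = 1 by ring, Real.rpow_one]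
      _ ≤ h ^ q * T ^ (-(q - 1)) * ρ ^ (-q) := by
          gcongr ?_ * ?_ * ?_
          exact Real.rpow_le_rpow_of_nonpos T0 hgt.le (by linarith)
      _ = h ^ q * ρ ^ (ε - 1) := by
          rw [mul_assoc, hT, ← Real.rpow_mul h0.le, ← Real.rpow_add h0]
          congr 2
          field_simp
          ring
      _ ≤ _ := by
        have : 0 ≤ ρ ^ (-(q + 1) - ε / (q - 1)) := by positivity
        linarith

theorem norm_sq_rpow_le {x : V n} {r : ℝ} (hr : 0 ≤ r) (hx : 1 ≤ ‖x‖) :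
    (‖x‖ ^ 2) ^ (-r / 2) ≤ 2 ^ r * (1 + ‖x‖) ^ (-r) := by
  have h0 : 0 < ‖x‖ := by linarith
  rw [← Real.rpow_natCast, ← Real.rpow_mul h0.le, Real.rpow_neg (by positivity),
    ← div_eq_mul_inv, le_div_iff₀ (by positivity)]
  have : ((2 : ℕ) : ℝ) * (-r / 2) = -r := by push_cast; ring
  rw [this, Real.rpow_neg h0.le, inv_mul_eq_div, div_le_iff₀ (by positivity),
    ← Real.mul_rpow (by norm_num) h0.le]
  exact Real.rpow_le_rpow (by positivity) (by linarith) hr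

theorem cut_le_cut {A S S' ρ : ℝ} (hS : 0 < S) (h : 2 * S ≤ S') : cut A S ρ ≤ cut A S' ρ := by
  rcases le_or_gt ρ (2 * S) with h1 | h1
  · have h2 : th (ρ / S') = 1 := th_eq_one ((div_le_one (by linarith)).2 (by linarith))
    unfold cut
    rw [h2]
    have := th_le_one (ρ / A)
    exact mul_le_mul_of_nonneg_left (th_le_one _) (by linarith)
  · rw [cut_eq_zero_of_ge A hS h1.le]
    exact cut_nonneg _ _ _

theorem IsDecaying.exists_posPart_bound (h : IsDecaying U P R C) (hn : 5 ≤ n) (hA : R ^ 2 < A) :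
    ∃ K, 0 ≤ K ∧ ∀ S, A ≤ S →
      ∫ x, max (head U P x) 0 * lw A S (pw (1 - n / 2)) (‖x‖ ^ 2) ≤ K := by
  have hR := h.one_le
  have hA1 : 1 ≤ A := by nlinarith
  have hn' : (5 : ℝ) ≤ n := by exact_mod_cast hn
  obtain ⟨ε, K, hε, hε1, hK, hb⟩ := h.exists_hardy_bound hn hA
  obtain ⟨q, hq⟩ : ∃ q : ℝ, q = n / 2 - 1 := ⟨_, rfl⟩
  have hq1 : 1 < q := by rw [hq]; linarith
  obtain ⟨r, hr⟩ : ∃ r : ℝ, r = n + 2 * (ε / (q - 1)) := ⟨_, rfl⟩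
  have hd : 0 < ε / (q - 1) := div_pos hε (by linarith)
  have h_int : Integrable (fun x : V n => 2 ^ r * (1 + ‖x‖) ^ (-r)) := by
    refine (integrable_one_add_norm ?_).const_mul _
    rw [finrank_euclideanSpace_fin, hr]; linarith
  refine ⟨2 * K + ∫ x : V n, 2 ^ r * (1 + ‖x‖) ^ (-r), ?_, fun S hS => ?_⟩
  · have : 0 ≤ ∫ x : V n, 2 ^ r * (1 + ‖x‖) ^ (-r) := integral_nonneg fun x => by positivity
    linarith
  have hS0 : 0 < S := by linarith
  obtain ⟨S', hS'⟩ : ∃ S', S' = (2 * S) ^ 2 := ⟨_, rfl⟩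
  have hSS : 2 * S ≤ S' := by rw [hS']; nlinarith
  have hb' := hb S' (by linarith)
  rw [← hq] at hb'
  have hδ : 0 < 1 / S' := by have : 0 < S' := by linarith
                             positivity
  have hw : IsWeight (4 * ε) (bw ε (S' ^ (-ε))) :=
    isWeight_bw hε.le hε1 (Real.rpow_nonneg (by linarith) _)
  have hw1 := hw.mul (isWeight_pw (-1))
  have hH := contDiff_head h.smooth h.smoothP
  have hζ : IsTest A (fun x : V n => lw A S (pw (1 - n / 2)) (‖x‖ ^ 2)) :=
    isTest_lw (by linarith) hS0 (contDiff_pw _)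
  have hζ1 : IsTest A (fun x : V n => lw A S' (fun ρ => bw ε (S' ^ (-ε)) ρ * pw (-1) ρ) (‖x‖ ^ 2)) :=
    isTest_lw (by linarith) (by linarith) hw1.smooth
  have i1 : Integrable (fun x => max (head U P x) 0 * lw A S (pw (1 - n / 2)) (‖x‖ ^ 2)) :=
    integrable_mul_test (hH.continuous.max continuous_const) hζ.smooth.continuous hζ.compact
  have i2 : Integrable (fun x => rg (1 / S') q (head U P x) *
      lw A S' (fun ρ => bw ε (S' ^ (-ε)) ρ * pw (-1) ρ) (‖x‖ ^ 2)) :=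
    integrable_mul_test ((contDiff_rg hδ).continuous.comp hH.continuous)
      hζ1.smooth.continuous hζ1.compact
  calc ∫ x, max (head U P x) 0 * lw A S (pw (1 - n / 2)) (‖x‖ ^ 2) ≤
      ∫ x, (2 * (rg (1 / S') q (head U P x) *
        lw A S' (fun ρ => bw ε (S' ^ (-ε)) ρ * pw (-1) ρ) (‖x‖ ^ 2)) +
          2 ^ r * (1 + ‖x‖) ^ (-r)) := by
        refine integral_mono i1 ((i2.const_mul 2).add h_int) fun x => ?_
        beta_reduce
        have hrg := rpow_le_rg hδ (by linarith : 0 ≤ q) (head U P x)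
        have hrg0 := (rg_pos (q := q) hδ (head U P x)).le
        have hw0 := lw_nonneg A S' hw1.nonneg (‖x‖ ^ 2)
        have hl : 0 ≤ 2 ^ r * (1 + ‖x‖) ^ (-r) := by positivity
        rcases le_or_gt (‖x‖ ^ 2) A with hx | hx
        · rw [lw_eq_zero S _ (by linarith) hx, mul_zero]
          positivity
        rcases le_or_gt (2 * S) (‖x‖ ^ 2) with hx2 | hx2
        · rw [lw, cut_eq_zero_of_ge A hS0 hx2, zero_mul, mul_zero]
          positivity
        have hx1 : 1 ≤ ‖x‖ := by
          have := h.lt_norm hA.le hx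
          linarith
        have l1 := le_bw hε.le (by linarith : 1 ≤ ‖x‖ ^ 2) (S := S')
          (by rw [hS']; gcongr)
        have l2 := norm_sq_rpow_le (r := r) (by rw [hr]; positivity) hx1
        rw [lw_mul_pw_neg_one S' hA1, lw, pw_eq _ (by linarith)]
        obtain ⟨ρ, hρd⟩ : ∃ ρ, ρ = ‖x‖ ^ 2 := ⟨_, rfl⟩
        rw [← hρd] at hx hx2 l1 l2 hw0 ⊢
        have hρ : 0 < ρ := by linarith
        have y := young_rpow (ε := ε) (le_max_right (head U P x) 0) (by linarith : 1 ≤ ρ) hq1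
        have e1 : (1 - n / 2 : ℝ) = -q := by rw [hq]; ring
        have e2 : -(q + 1) - ε / (q - 1) = -r / 2 := by rw [hr, hq]; ring
        rw [e2] at y
        rw [e1]
        have c0 := cut_nonneg A S ρ
        have c1 := cut_le_one A S ρ
        have c3 := cut_nonneg A S' ρ
        have c2 : cut A S ρ ≤ cut A S' ρ := cut_le_cut hS0 hSS
        calc max (head U P x) 0 * (cut A S ρ * ρ ^ (-q))
            = cut A S ρ * (max (head U P x) 0 * ρ ^ (-q)) := by ring
          _ ≤ cut A S ρ * (max (head U P x) 0 ^ q * ρ ^ (ε - 1) + ρ ^ (-r / 2)) := by gcongr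
          _ = cut A S ρ * (max (head U P x) 0 ^ q * ρ ^ (ε - 1)) + cut A S ρ * ρ ^ (-r / 2) := by
            ring
          _ ≤ cut A S' ρ * (rg (1 / S') q (head U P x) * ρ ^ (ε - 1)) + 1 * ρ ^ (-r / 2) := by
            gcongr
          _ ≤ cut A S' ρ * (rg (1 / S') q (head U P x) * (2 * (bw ε (S' ^ (-ε)) ρ / ρ))) +
              2 ^ r * (1 + ‖x‖) ^ (-r) := by
            rw [one_mul]
            gcongr
            rw [rpow_sub_one' hρ, ← mul_div_assoc]
            gcongr
            linarith
          _ = _ := by ring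
    _ = 2 * (∫ x, rg (1 / S') q (head U P x) *
        lw A S' (fun ρ => bw ε (S' ^ (-ε)) ρ * pw (-1) ρ) (‖x‖ ^ 2)) +
          ∫ x : V n, 2 ^ r * (1 + ‖x‖) ^ (-r) := by
        rw [integral_add (i2.const_mul 2) h_int, integral_const_mul]
    _ ≤ _ := by gcongr

end PositivePart

section AbsoluteValue

variable {n : ℕ} {U : Fin n → V n → ℝ} {P : V n → ℝ} {R C A : ℝ}

theorem head_eq (U : Fin n → V n → ℝ) (P : V n → ℝ) (x : V n) :
    head U P x = 1 / 2 * usq U x + P x := by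
  unfold head usq
  ring

theorem IsSol.integral_head_lap (h : IsSol U P R C) (hA : R ^ 2 ≤ A) {ζ : V n → ℝ}
    (hζ : IsTest A ζ) :
    Integrable (fun x => 1 / 2 * usq U x * lap ζ x - ∑ i, ∑ j, U i x * U j x * pd i (pd j ζ) x) ∧
    ∫ x, head U P x * lap ζ x =
      ∫ x, (1 / 2 * usq U x * lap ζ x - ∑ i, ∑ j, U i x * U j x * pd i (pd j ζ) x) := by
  have hl := hasCompactSupport_lap hζ.compact
  have cl := (contDiff_lap hζ.smooth).continuous
  have s1 : Integrable (fun x => P x * lap ζ x) := integrable_mul_test h.smoothP.continuous cl hl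
  have hu : Continuous (usq U) := continuous_finsetSum _ fun i _ =>
    ((h.smooth i).mul (h.smooth i)).continuous
  have s2 : Integrable (fun x => 1 / 2 * usq U x * lap ζ x) :=
    integrable_mul_test (hu.const_mul (1 / 2)) cl hl
  have s3 : Integrable (fun x => ∑ i, ∑ j, U i x * U j x * pd i (pd j ζ) x) :=
    integrable_finsetSum _ fun i _ => integrable_finsetSum _ fun j _ =>
      integrable_mul_test ((h.smooth i).mul (h.smooth j)).continuous
        (contDiff_pd i (contDiff_pd j hζ.smooth)).continuous
        (hasCompactSupport_pd (hasCompactSupport_pd hζ.compact j) i)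
  refine ⟨s2.sub s3, ?_⟩
  rw [integral_sub s2 s3, sub_eq_add_neg, ← h.integral_pressure hA hζ, ← integral_add s2 s1]
  congr 1
  funext x
  rw [head_eq]
  ring

theorem head_lap_pointwise {H ν a c ρ K E D₁ D₂ C : ℝ} (hν : 0 ≤ ν)
    (h1 : |D₁ - a * ρ * c| ≤ K * ρ * E) (h2 : |D₂ - a * (a - 1) * c| ≤ K * E) (hρ : 0 ≤ ρ)
    (ha : 2 * a = 4 - ν) (hKE : 0 ≤ K * E) (hH : |H| * ρ ≤ C) :
    4 * a * (H * (ρ * c)) ≤ H * (2 * ν * D₁ + 4 * ρ * D₂) + C * ((2 * ν + 4) * (K * E)) := by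
  have e : H * (2 * ν * D₁ + 4 * ρ * D₂) - 4 * a * (H * (ρ * c)) =
      H * (2 * ν * (D₁ - a * ρ * c) + 4 * ρ * (D₂ - a * (a - 1) * c)) := by
    have : ν = 4 - 2 * a := by linarith
    rw [this]; ring
  have b : |H * (2 * ν * (D₁ - a * ρ * c) + 4 * ρ * (D₂ - a * (a - 1) * c))| ≤
      C * ((2 * ν + 4) * (K * E)) := by
    rw [abs_mul]
    calc _ ≤ |H| * (2 * ν * |D₁ - a * ρ * c| + 4 * ρ * |D₂ - a * (a - 1) * c|) := by
          gcongr
          refine (abs_add_le _ _).trans (le_of_eq ?_)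
          rw [abs_mul (2 * ν), abs_mul (4 * ρ), abs_of_nonneg (by positivity : 0 ≤ 2 * ν),
            abs_of_nonneg (by positivity : 0 ≤ 4 * ρ)]
      _ ≤ |H| * (2 * ν * (K * ρ * E) + 4 * ρ * (K * E)) := by gcongr
      _ = |H| * ρ * ((2 * ν + 4) * (K * E)) := by ring
      _ ≤ _ := by gcongr
  have := neg_abs_le (H * (2 * ν * (D₁ - a * ρ * c) + 4 * ρ * (D₂ - a * (a - 1) * c)))
  linarith

theorem pressure_pointwise {u r ν a c ρ K E D₁ D₂ C₁ C₂ : ℝ} (hν : 2 ≤ ν)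
    (h1 : |D₁ - a * ρ * c| ≤ K * ρ * E) (h2 : |D₂ - a * (a - 1) * c| ≤ K * E) (hρ : 0 ≤ ρ)
    (ha : 2 * a = 4 - ν) (ha0 : a ≤ 0) (hc : 0 ≤ c) (hKE : 0 ≤ K * E) (hu0 : 0 ≤ u)
    (hu : u * ρ ≤ C₁) (hr : r ^ 2 ≤ C₂) :
    1 / 2 * u * (2 * ν * D₁ + 4 * ρ * D₂) - (2 * u * D₁ + 4 * r ^ 2 * D₂) ≤
      (C₁ * ν + 4 * C₂) * (K * E) := by
  have e : 1 / 2 * u * (2 * ν * D₁ + 4 * ρ * D₂) - (2 * u * D₁ + 4 * r ^ 2 * D₂) =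
      u * ((ν - 2) * (D₁ - a * ρ * c) + 2 * ρ * (D₂ - a * (a - 1) * c))
      + 4 * r ^ 2 * -(D₂ - a * (a - 1) * c) - 4 * r ^ 2 * (a * (a - 1) * c) := by
    have : ν = 4 - 2 * a := by linarith
    rw [this]; ring
  have p : 0 ≤ 4 * r ^ 2 * (a * (a - 1) * c) := by
    have : 0 ≤ a * (a - 1) := mul_nonneg_of_nonpos_of_nonpos ha0 (by linarith)
    positivity
  have b1 : D₁ - a * ρ * c ≤ K * ρ * E := (le_abs_self _).trans h1
  have b2 : D₂ - a * (a - 1) * c ≤ K * E := (le_abs_self _).trans h2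
  have b3 : -(D₂ - a * (a - 1) * c) ≤ K * E := (neg_le_abs _).trans h2
  have hν0 : 0 ≤ ν - 2 := by linarith
  rw [e]
  calc _ ≤ u * ((ν - 2) * (K * ρ * E) + 2 * ρ * (K * E)) + 4 * r ^ 2 * (K * E) - 0 := by gcongr
    _ = (u * ρ * ν + 4 * r ^ 2) * (K * E) := by ring
    _ ≤ _ := by gcongr

theorem IsDecaying.exists_head_lower_bound (h : IsDecaying U P R C) (hn : 5 ≤ n)
    (hA : R ^ 2 < A) :
    ∃ K, 0 ≤ K ∧ ∀ S, A ≤ S →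
      -K ≤ ∫ x, head U P x * lw A S (pw (1 - n / 2)) (‖x‖ ^ 2) := by
  have hR := h.one_le
  have h0 := h.nonneg
  have hA1 : 1 ≤ A := by nlinarith
  have hn' : (5 : ℝ) ≤ n := by exact_mod_cast hn
  obtain ⟨a, ha⟩ : ∃ a : ℝ, a = 2 - n / 2 := ⟨_, rfl⟩
  have ha0 : a < 0 := by rw [ha]; linarith
  obtain ⟨K₀, hK₀, hl⟩ := exists_lw_bound (|a| + |a * (a - 1)|)
  obtain ⟨K₁, hK₁, h_int⟩ := exists_integral_le_add_rim n
  obtain ⟨M, hM⟩ : ∃ M : ℝ, M = C * ((2 * n + 4) * K₀) := ⟨_, rfl⟩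
  obtain ⟨N, hN⟩ : ∃ N : ℝ, N = (n * C ^ 2 * n + 4 * (n * C) ^ 2) * K₀ := ⟨_, rfl⟩
  have hM0 : 0 ≤ M := by rw [hM]; positivity
  have hN0 : 0 ≤ N := by rw [hN]; positivity
  refine ⟨(M * K₁ + N * K₁) / (-(4 * a)), div_nonneg (by positivity) (by linarith),
    fun S hS => ?_⟩
  have hS0 : 0 < S := by linarith
  have hb := isWeight_pw a
  have hζ : IsTest A (fun x : V n => lw A S (pw a) (‖x‖ ^ 2)) :=
    isTest_lw (by linarith) hS0 hb.smooth
  have hζ1 : IsTest A (fun x : V n => lw A S (pw (1 - n / 2)) (‖x‖ ^ 2)) :=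
    isTest_lw (by linarith) hS0 (contDiff_pw _)
  have hH := contDiff_head h.smooth h.smoothP
  have i1 : Integrable (fun x => 4 * a * (head U P x * lw A S (pw (1 - n / 2)) (‖x‖ ^ 2))) :=
    (integrable_mul_test hH.continuous hζ1.smooth.continuous hζ1.compact).const_mul _
  have i2 : Integrable (fun x => head U P x * lap (fun y : V n => lw A S (pw a) (‖y‖ ^ 2)) x) :=
    integrable_mul_test hH.continuous (contDiff_lap hζ.smooth).continuous
      (hasCompactSupport_lap hζ.compact)
  obtain ⟨i3, e3⟩ := h.integral_head_lap hA.le hζ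
  have key : ∀ x : V n, A ≤ ‖x‖ ^ 2 →
      |deriv (lw A S (pw a)) (‖x‖ ^ 2) - a * ‖x‖ ^ 2 *
        (cut A S (‖x‖ ^ 2) * (‖x‖ ^ 2) ^ (-(n : ℝ) / 2))| ≤
        K₀ * ‖x‖ ^ 2 * ((‖x‖ ^ 2) ^ (-(n : ℝ) / 2) * rim A S (‖x‖ ^ 2)) ∧
      |deriv (deriv (lw A S (pw a))) (‖x‖ ^ 2) - a * (a - 1) *
        (cut A S (‖x‖ ^ 2) * (‖x‖ ^ 2) ^ (-(n : ℝ) / 2))| ≤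
        K₀ * ((‖x‖ ^ 2) ^ (-(n : ℝ) / 2) * rim A S (‖x‖ ^ 2)) := fun x hx => by
    obtain ⟨l1, l2⟩ := hl A S (pw a) hA1 hS0 hb (‖x‖ ^ 2) (by positivity)
    rw [deriv_pw a (by linarith), pw_eq a (by linarith)] at l1
    rw [deriv_deriv_pw a (by linarith), pw_eq a (by linarith)] at l2
    obtain ⟨ρ, hρ⟩ : ∃ ρ, ρ = ‖x‖ ^ 2 := ⟨_, rfl⟩
    rw [← hρ] at l1 l2 hx ⊢
    have hρ0 : 0 < ρ := by linarith
    have e2 : ρ ^ (a - 2) = ρ ^ (-(n : ℝ) / 2) := by congr 1; rw [ha]; ring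
    have e1 : ρ ^ a = ρ ^ 2 * ρ ^ (-(n : ℝ) / 2) := by
      rw [← e2, rpow_sub_two' hρ0]; field_simp
    rw [rpow_sub_one' hρ0, e1] at l1
    rw [e2, e1] at l2
    constructor
    · convert l1 using 1
      · congr 2; field_simp
      · field_simp
    · convert l2 using 1
      · congr 2; ring
      · field_simp
  have rim0 : ∀ x : V n, 0 ≤ (‖x‖ ^ 2) ^ (-(n : ℝ) / 2) * rim A S (‖x‖ ^ 2) := fun x =>
    mul_nonneg (by positivity) (rim_nonneg _ _ _)
  have hlap : ∀ x : V n, lap (fun y : V n => lw A S (pw a) (‖y‖ ^ 2)) x = _ := fun x =>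
    lap_radial (contDiff_lw A S hb.smooth) x
  have p1 := h_int A S (by linarith) hS0 _ _ M hM0 i1 i2 fun x => by
    rw [hlap]
    rcases lt_or_ge (‖x‖ ^ 2) A with hx | hx
    · rw [lw_eq_zero S _ (by linarith) hx.le, deriv_lw_eq_zero S _ (by linarith) hx,
        deriv_deriv_lw_eq_zero S _ (by linarith) hx, rim_eq_zero hx hS]
      simp
    obtain ⟨k1, k2⟩ := key x hx
    have hxR : R < ‖x‖ := h.lt_norm le_rfl (hA.trans_le hx)
    have hρ : 0 < ‖x‖ ^ 2 := by linarith
    have hH1 := h.bound_head x hxR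
    rw [le_div_iff₀ hρ] at hH1
    have q := head_lap_pointwise (by linarith : (0 : ℝ) ≤ n) k1 k2 hρ.le (by rw [ha]; ring)
      (mul_nonneg hK₀ (rim0 x)) hH1
    rw [lw, pw_eq _ (by linarith), show (1 - n / 2 : ℝ) = -(n : ℝ) / 2 + 1 by ring,
      Real.rpow_add_one hρ.ne']
    rw [hM]
    linarith
  have p2 := h_int A S (by linarith) hS0 _ (fun _ => 0) N hN0 i3 (integrable_zero _ _ _) fun x => by
    rw [hess_radial U (contDiff_lw A S hb.smooth), hlap]
    rcases lt_or_ge (‖x‖ ^ 2) A with hx | hx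
    · rw [deriv_lw_eq_zero S _ (by linarith) hx,
        deriv_deriv_lw_eq_zero S _ (by linarith) hx, rim_eq_zero hx hS]
      simp
    obtain ⟨k1, k2⟩ := key x hx
    have hxR : R < ‖x‖ := h.lt_norm le_rfl (hA.trans_le hx)
    have hρ : 0 < ‖x‖ ^ 2 := by linarith
    have hu := h.usq_le hxR
    rw [le_div_iff₀ hρ] at hu
    have hr : rdl U x ^ 2 ≤ (n * C) ^ 2 := sq_le_sq' (abs_le.1 (h.abs_rdl_le hxR)).1
      (abs_le.1 (h.abs_rdl_le hxR)).2
    have q := pressure_pointwise (by linarith : (2 : ℝ) ≤ n) k1 k2 hρ.le (by rw [ha]; ring)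
      ha0.le (mul_nonneg (cut_nonneg _ _ _) (by positivity)) (mul_nonneg hK₀ (rim0 x))
      (usq_nonneg U x) hu hr
    rw [hN]
    linarith
  rw [integral_const_mul] at p1
  rw [integral_zero, zero_add] at p2
  rw [e3] at p1
  have h4 : 0 < -(4 * a) := by linarith
  rw [← neg_div, div_le_iff₀ h4]
  linarith

theorem IsDecaying.exists_abs_head_bound (h : IsDecaying U P R C) (hn : 5 ≤ n)
    (hA : R ^ 2 < A) :
    ∃ K, 0 ≤ K ∧ ∀ S, A ≤ S →
      ∫ x, |head U P x| * lw A S (pw (1 - n / 2)) (‖x‖ ^ 2) ≤ K := by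
  have hR := h.one_le
  have hA1 : 1 ≤ A := by nlinarith
  obtain ⟨K₁, hK₁, h₁⟩ := h.exists_posPart_bound hn hA
  obtain ⟨K₂, hK₂, h₂⟩ := h.exists_head_lower_bound hn hA
  refine ⟨2 * K₁ + K₂, by positivity, fun S hS => ?_⟩
  have hH := contDiff_head h.smooth h.smoothP
  have hζ : IsTest A (fun x : V n => lw A S (pw (1 - n / 2)) (‖x‖ ^ 2)) :=
    isTest_lw (by linarith) (by linarith) (contDiff_pw _)
  have i1 : Integrable (fun x => max (head U P x) 0 * lw A S (pw (1 - n / 2)) (‖x‖ ^ 2)) :=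
    integrable_mul_test (hH.continuous.max continuous_const) hζ.smooth.continuous hζ.compact
  have i2 : Integrable (fun x => head U P x * lw A S (pw (1 - n / 2)) (‖x‖ ^ 2)) :=
    integrable_mul_test hH.continuous hζ.smooth.continuous hζ.compact
  have e : ∀ x, |head U P x| * lw A S (pw (1 - n / 2)) (‖x‖ ^ 2) =
      2 * (max (head U P x) 0 * lw A S (pw (1 - n / 2)) (‖x‖ ^ 2)) -
        head U P x * lw A S (pw (1 - n / 2)) (‖x‖ ^ 2) := fun x => by
    have : |head U P x| = 2 * max (head U P x) 0 - head U P x := by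
      rcases le_total 0 (head U P x) with h | h
      · rw [abs_of_nonneg h, max_eq_left h]; ring
      · rw [abs_of_nonpos h, max_eq_right h]; ring
    rw [this]; ring
  simp only [e]
  rw [integral_sub (i1.const_mul 2) i2, integral_const_mul]
  linarith [h₁ S hS, h₂ S hS]

end AbsoluteValue

section VorticityDecay

variable {n : ℕ} {U : Fin n → V n → ℝ} {P : V n → ℝ} {R C A : ℝ}

theorem ens_nonneg (U : Fin n → V n → ℝ) (x : V n) : 0 ≤ ens U x := by
  unfold ens
  have : 0 ≤ ∑ i, ∑ j, om U i j x * om U i j x :=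
    Finset.sum_nonneg fun i _ => Finset.sum_nonneg fun j _ => mul_self_nonneg _
  linarith

theorem sq_om_le_ens (U : Fin n → V n → ℝ) (i j : Fin n) (x : V n) :
    om U i j x ^ 2 / 2 ≤ ens U x := by
  unfold ens
  have h1 : om U i j x * om U i j x ≤ ∑ j, om U i j x * om U i j x :=
    Finset.single_le_sum (f := fun j => om U i j x * om U i j x)
      (fun j _ => mul_self_nonneg _) (Finset.mem_univ j)
  have h2 : ∑ j, om U i j x * om U i j x ≤ ∑ i, ∑ j, om U i j x * om U i j x :=
    Finset.single_le_sum (f := fun i => ∑ j, om U i j x * om U i j x)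
      (fun i _ => Finset.sum_nonneg fun j _ => mul_self_nonneg _) (Finset.mem_univ i)
  linarith [sq (om U i j x)]

theorem IsDecaying.exists_ens_bound (h : IsDecaying U P R C) (hn : 4 ≤ n) (hA : R ^ 2 < A) :
    ∃ K, 0 ≤ K ∧ ∀ S, A ≤ S → ∫ x, ens U x * lw A S (pw (2 - n / 2)) (‖x‖ ^ 2) ≤ K := by
  have hR := h.one_le
  have h0 := h.nonneg
  have hA1 : 1 ≤ A := by nlinarith
  obtain ⟨a, ha⟩ : ∃ a : ℝ, a = 2 - n / 2 := ⟨_, rfl⟩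
  obtain ⟨β, hβ⟩ : ∃ β : ℝ, β = |a| + |a * (a - 1)| := ⟨_, rfl⟩
  have hb := isWeight_pw a
  rw [← hβ] at hb
  have hβ0 := hb.const_nonneg
  obtain ⟨K₀, hK₀, hop⟩ := h.exists_op_bound hA β
  obtain ⟨K₁, hK₁, h_int⟩ := exists_integral_le_add_rim n
  obtain ⟨c, hc⟩ : ∃ c : ℝ, c = 2 * n + 4 + 2 * (n * C) := ⟨_, rfl⟩
  have hc0 : 0 ≤ c := by rw [hc]; positivity
  obtain ⟨K₂, hK₂, habs⟩ : ∃ K, 0 ≤ K ∧ ∀ S, A ≤ S →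
      c * β * ∫ x, |head U P x| * lw A S (pw (1 - n / 2)) (‖x‖ ^ 2) ≤ K := by
    rcases eq_or_lt_of_le hn with h4 | h5
    · refine ⟨0, le_rfl, fun S _ => ?_⟩
      have : β = 0 := by rw [hβ, ha, ← h4]; norm_num
      rw [this]; simp
    · obtain ⟨K, hK, hb⟩ := h.exists_abs_head_bound h5 hA
      exact ⟨c * β * K, by positivity, fun S hS =>
        mul_le_mul_of_nonneg_left (hb S hS) (by positivity)⟩
  refine ⟨K₂ + C * K₀ * K₁, by positivity, fun S hS => ?_⟩
  have hS0 : 0 < S := by linarith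
  have hH := contDiff_head h.smooth h.smoothP
  have hζ : IsTest A (fun x : V n => lw A S (pw a) (‖x‖ ^ 2)) :=
    isTest_lw (by linarith) hS0 hb.smooth
  have hζ1 : IsTest A (fun x : V n => lw A S (pw (1 - n / 2)) (‖x‖ ^ 2)) :=
    isTest_lw (by linarith) hS0 (contDiff_pw _)
  have i1 := h.integrable_op (f := head U P) hH.continuous hζ
  have i2 : Integrable (fun x => |head U P x| * lw A S (pw (1 - n / 2)) (‖x‖ ^ 2)) :=
    integrable_mul_test hH.continuous.abs hζ1.smooth.continuous hζ1.compact
  have e := h.integral_head hA.le (F := fun s => s) contDiff_id hζ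
  have e' : ∫ x, ens U x * lw A S (pw (2 - n / 2)) (‖x‖ ^ 2) =
      ∫ x, head U P x * (lap (fun y : V n => lw A S (pw a) (‖y‖ ^ 2)) x +
        ∑ i, U i x * pd i (fun y : V n => lw A S (pw a) (‖y‖ ^ 2)) x) := by
    rw [e, ← ha]
    congr 1
    funext x
    have d1 : deriv (fun s : ℝ => s) = fun _ => 1 := by funext s; simp
    rw [d1]
    simp
    ring
  rw [e']
  refine (h_int A S (by linarith) hS0 _ _ (C * K₀) (by positivity) i1 (i2.const_mul (c * β))
    fun x => ?_).trans ?_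
  · refine (le_abs_self _).trans ?_
    rw [abs_mul]
    refine (mul_le_mul_of_nonneg_left (hop S _ hS0 hb x) (abs_nonneg _)).trans ?_
    rw [← hc]
    rcases lt_or_ge (‖x‖ ^ 2) A with hx | hx
    · rw [cut_eq_zero_of_le S (by linarith) hx.le, lw_eq_zero S _ (by linarith) hx.le,
        rim_eq_zero hx hS]
      simp
    have hρ : 0 < ‖x‖ ^ 2 := by linarith
    have hH1 := h.bound_head x (h.lt_norm le_rfl (hA.trans_le hx))
    rw [pw_eq _ (by linarith), lw, pw_eq _ (by linarith)]
    obtain ⟨ρ, hρd⟩ : ∃ ρ, ρ = ‖x‖ ^ 2 := ⟨_, rfl⟩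
    rw [← hρd] at hρ hH1 ⊢
    have e1 : ρ ^ a / ρ = ρ ^ (1 - n / 2 : ℝ) := by
      rw [← rpow_sub_one' hρ, ha]; congr 1; ring
    have e2 : ρ ^ (1 - n / 2 : ℝ) = ρ ^ (-(n : ℝ) / 2) * ρ := by
      rw [← Real.rpow_add_one hρ.ne']; congr 1; ring
    have hr := rim_nonneg A S ρ
    have hp : 0 ≤ ρ ^ (-(n : ℝ) / 2) := by positivity
    rw [le_div_iff₀ hρ] at hH1
    rw [e1]
    calc _ = c * β * (|head U P x| * (cut A S ρ * ρ ^ (1 - n / 2 : ℝ))) +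
          |head U P x| * ρ * K₀ * (ρ ^ (-(n : ℝ) / 2) * rim A S ρ) := by rw [e2]; ring
      _ ≤ _ := by gcongr
  · rw [integral_const_mul]
    linarith [habs S hS]

theorem IsDecaying.exists_tail (h : IsDecaying U P R C) (hn : 4 ≤ n) (hA : R ^ 2 < A) :
    Integrable (fun x => ens U x * ((1 - th (‖x‖ ^ 2 / A)) * pw (2 - n / 2) (‖x‖ ^ 2))) := by
  have hR := h.one_le
  have hA1 : 1 ≤ A := by nlinarith
  obtain ⟨K, hK, hb⟩ := h.exists_ens_bound hn hA
  have hcont : Continuous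
      (fun x => ens U x * ((1 - th (‖x‖ ^ 2 / A)) * pw (2 - n / 2) (‖x‖ ^ 2))) := by
    refine (contDiff_ens h.smooth).continuous.mul ((continuous_const.sub ?_).mul ?_)
    · exact contDiff_th.continuous.comp ((continuous_norm.pow 2).div_const A)
    · exact (contDiff_pw _).continuous.comp (continuous_norm.pow 2)
  have hnn : ∀ x, 0 ≤ ens U x * ((1 - th (‖x‖ ^ 2 / A)) * pw (2 - n / 2) (‖x‖ ^ 2)) := fun x =>
    mul_nonneg (ens_nonneg U x) (mul_nonneg (by linarith [th_le_one (‖x‖ ^ 2 / A)])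
      (pw_pos _ _).le)
  have hcov : AECover (volume : Measure (V n)) atTop
      (fun k : ℕ => Metric.closedBall (0 : V n) (k : ℝ)) :=
    aecover_closedBall tendsto_natCast_atTop_atTop
  refine hcov.integrable_of_integral_bounded_of_nonneg_ae K
    (fun k => hcont.continuousOn.integrableOn_compact (isCompact_closedBall _ _))
    (Eventually.of_forall hnn) ?_
  filter_upwards [eventually_ge_atTop (Nat.ceil A)] with k hk
  have hkA : A ≤ k := Nat.ceil_le.1 hk
  have hkS : A ≤ (k : ℝ) ^ 2 := by nlinarith
  have hζ : IsTest A (fun x : V n => lw A ((k : ℝ) ^ 2) (pw (2 - n / 2)) (‖x‖ ^ 2)) :=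
    isTest_lw (by linarith) (by linarith) (contDiff_pw _)
  have i1 : Integrable (fun x => ens U x * lw A ((k : ℝ) ^ 2) (pw (2 - n / 2)) (‖x‖ ^ 2)) :=
    integrable_mul_test (contDiff_ens h.smooth).continuous hζ.smooth.continuous hζ.compact
  calc _ = ∫ x in Metric.closedBall (0 : V n) k,
        ens U x * lw A ((k : ℝ) ^ 2) (pw (2 - n / 2)) (‖x‖ ^ 2) := by
        refine setIntegral_congr_fun Metric.isClosed_closedBall.measurableSet fun x hx => ?_
        rw [mem_closedBall_zero_iff] at hx
        rw [lw, cut, th_eq_one (t := ‖x‖ ^ 2 / (k : ℝ) ^ 2), mul_one]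
        exact (div_le_one (by linarith)).2 (by gcongr)
    _ ≤ ∫ x, ens U x * lw A ((k : ℝ) ^ 2) (pw (2 - n / 2)) (‖x‖ ^ 2) :=
        setIntegral_le_integral i1 (Eventually.of_forall fun x =>
          mul_nonneg (ens_nonneg U x) (lw_nonneg _ _ (fun ρ => (pw_pos _ ρ).le) _))
    _ ≤ K := hb _ hkS

theorem IsDecaying.exists_om_le (h : IsDecaying U P R C) (hn : 4 ≤ n) {ε : ℝ} (hε : 0 < ε) :
    ∃ R', R ≤ R' ∧ ∀ x, R' ≤ ‖x‖ → ∀ i j, |om U i j x| ≤ ε / ‖x‖ ^ 2 := by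
  have hR := h.one_le
  have h0 := h.nonneg
  obtain ⟨A, hAd⟩ : ∃ A, A = R ^ 2 + 1 := ⟨_, rfl⟩
  have hA : R ^ 2 < A := by linarith
  have hA1 : 1 ≤ A := by nlinarith
  obtain ⟨a, ha⟩ : ∃ a : ℝ, a = 2 - n / 2 := ⟨_, rfl⟩
  have hn' : (4 : ℝ) ≤ n := by exact_mod_cast hn
  have ha0 : a ≤ 0 := by rw [ha]; linarith
  have h_int := h.exists_tail hn hA
  rw [← ha] at h_int
  obtain ⟨f, hf⟩ : ∃ f : V n → ℝ, f = fun x => ens U x *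
    ((1 - th (‖x‖ ^ 2 / A)) * pw a (‖x‖ ^ 2)) := ⟨_, rfl⟩
  rw [← hf] at h_int
  have hnn : ∀ x, 0 ≤ f x := fun x => by
    rw [hf]
    exact mul_nonneg (ens_nonneg U x) (mul_nonneg (by linarith [th_le_one (‖x‖ ^ 2 / A)])
      (pw_pos _ _).le)
  have hmeas : ∀ k : ℕ, MeasurableSet {x : V n | (k : ℝ) ≤ ‖x‖} := fun k =>
    (isClosed_le continuous_const continuous_norm).measurableSet
  have htail : Tendsto (fun k : ℕ => ∫ x in {x : V n | (k : ℝ) ≤ ‖x‖}, f x) atTop (𝓝 0) := by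
    have := tendsto_setIntegral_of_antitone (f := f) (μ := volume)
      (s := fun k : ℕ => {x : V n | (k : ℝ) ≤ ‖x‖}) hmeas (fun k l hkl x (hx : (l : ℝ) ≤ ‖x‖) =>
        show (k : ℝ) ≤ ‖x‖ from (Nat.cast_le.2 hkl).trans hx) ⟨0, h_int.integrableOn⟩
    have he : ⋂ k : ℕ, {x : V n | (k : ℝ) ≤ ‖x‖} = ∅ := by
      ext x
      simp only [mem_iInter, mem_ofPred_eq, mem_empty_iff_false, iff_false, not_forall, not_le]
      exact exists_nat_gt ‖x‖
    rwa [he, setIntegral_empty] at this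
  obtain ⟨l, hl⟩ : ∃ l, l = min (1 / 2) (ε / (16 * (n * C) + 1)) := ⟨_, rfl⟩
  have hl0 : 0 < l := by rw [hl]; positivity
  have hl1 : l ≤ 1 / 2 := by rw [hl]; exact min_le_left _ _
  have hl2 : 16 * (n * C) * l ≤ ε := by
    have : l ≤ ε / (16 * (n * C) + 1) := by rw [hl]; exact min_le_right _ _
    rw [le_div_iff₀ (by positivity)] at this
    linarith
  obtain ⟨vb, hvb⟩ : ∃ vb, vb = volume.real (Metric.ball (0 : V n) 1) := ⟨_, rfl⟩
  have hvb0 : 0 < vb := by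
    rw [hvb]; exact ENNReal.toReal_pos (Metric.measure_ball_pos _ _ one_pos).ne'
      measure_ball_lt_top.ne
  obtain ⟨c, hc⟩ : ∃ c : ℝ, c = ε ^ 2 / 8 * 4 ^ a * l ^ n * vb := ⟨_, rfl⟩
  have hc0 : 0 < c := by rw [hc]; positivity
  obtain ⟨k, hk⟩ := (htail.eventually (gt_mem_nhds hc0)).exists
  refine ⟨2 * k + 4 * A + 2 * R, by nlinarith [Nat.cast_nonneg (α := ℝ) k], fun x hx i j => ?_⟩
  obtain ⟨r, hr⟩ : ∃ r, r = ‖x‖ := ⟨_, rfl⟩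
  have hk0 := Nat.cast_nonneg (α := ℝ) k
  have hr0 : 0 < ‖x‖ := by linarith
  by_contra hcon
  rw [not_le] at hcon
  have hball : ∀ y ∈ Metric.closedBall x (l * ‖x‖),
      ε ^ 2 / 8 * 4 ^ a * (‖x‖ ^ 2) ^ a / ‖x‖ ^ 4 ≤ f y := fun y hy => by
    have hy1 : y ∈ Metric.closedBall x (‖x‖ / 2) :=
      Metric.closedBall_subset_closedBall (by nlinarith) hy
    have hyl := norm_ge_of_mem_ball hy1
    have hyu := norm_le_of_mem_ball hy1
    have hx1 : x ∈ Metric.closedBall x (‖x‖ / 2) := Metric.mem_closedBall_self (by positivity)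
    have hdiff := abs_sub_le_of_pd_le (contDiff_om h.smooth i j) (convex_closedBall x (‖x‖ / 2))
      (B := 8 * C / ‖x‖ ^ 3) (fun z hz k => by
        have hz1 := norm_ge_of_mem_ball hz
        refine (h.bound_pd_om z (by linarith) k i j).trans ?_
        calc C / ‖z‖ ^ 3 ≤ C / (‖x‖ / 2) ^ 3 := by gcongr
          _ = _ := by field_simp; norm_num) hx1 hy1
    have hyx : ‖y - x‖ ≤ l * ‖x‖ := by rwa [← mem_closedBall_iff_norm]
    have hd2 : |om U i j y - om U i j x| ≤ ε / ‖x‖ ^ 2 / 2 := by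
      calc _ ≤ n * (8 * C / ‖x‖ ^ 3) * (l * ‖x‖) := hdiff.trans (by gcongr)
        _ = 16 * (n * C) * l / ‖x‖ ^ 2 / 2 := by field_simp; ring
        _ ≤ _ := by gcongr
    have hom : ε / ‖x‖ ^ 2 / 2 ≤ |om U i j y| := by
      have := abs_sub_abs_le_abs_sub (om U i j x) (om U i j y)
      rw [abs_sub_comm] at this
      linarith
    have hens : ε ^ 2 / 8 / ‖x‖ ^ 4 ≤ ens U y := by
      refine le_trans ?_ (sq_om_le_ens U i j y)
      rw [← sq_abs (om U i j y)]
      calc ε ^ 2 / 8 / ‖x‖ ^ 4 = (ε / ‖x‖ ^ 2 / 2) ^ 2 / 2 := by field_simp; norm_num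
        _ ≤ _ := by gcongr
    have hAx : 2 * A ≤ ‖x‖ / 2 := by linarith
    have hρ : 2 * A ≤ ‖y‖ ^ 2 := by nlinarith
    have hpw : 4 ^ a * (‖x‖ ^ 2) ^ a ≤ pw a (‖y‖ ^ 2) := by
      rw [pw_eq _ (by linarith), ← Real.mul_rpow (by norm_num) (by positivity)]
      exact Real.rpow_le_rpow_of_nonpos (by linarith) (by nlinarith) ha0
    rw [hf]
    beta_reduce
    rw [th_eq_zero ((le_div_iff₀ (by linarith)).2 hρ), sub_zero, one_mul]
    calc _ = ε ^ 2 / 8 / ‖x‖ ^ 4 * (4 ^ a * (‖x‖ ^ 2) ^ a) := by ring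
      _ ≤ _ := by
        have := ens_nonneg U y
        gcongr
  have hsub : Metric.closedBall x (l * ‖x‖) ⊆ {y : V n | (k : ℝ) ≤ ‖y‖} := fun y hy => by
    have hy1 : y ∈ Metric.closedBall x (‖x‖ / 2) :=
      Metric.closedBall_subset_closedBall (by nlinarith) hy
    have := norm_ge_of_mem_ball hy1
    show (k : ℝ) ≤ ‖y‖
    linarith
  have hvol := setIntegral_ge_of_const_le_real (μ := volume)
    Metric.isClosed_closedBall.measurableSet (isCompact_closedBall x (l * ‖x‖)).measure_ne_top
    hball h_int.integrableOn
  have hmono : ∫ y in Metric.closedBall x (l * ‖x‖), f y ≤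
      ∫ y in {y : V n | (k : ℝ) ≤ ‖y‖}, f y :=
    setIntegral_mono_set h_int.integrableOn (Eventually.of_forall hnn) hsub.eventuallyLE
  rw [Measure.addHaar_real_closedBall _ _ (by positivity), finrank_euclideanSpace_fin, ← hvb] at hvol
  have hxa : (‖x‖ ^ 2) ^ a * ‖x‖ ^ n = ‖x‖ ^ 4 := by
    rw [← Real.rpow_natCast ‖x‖ 2, ← Real.rpow_mul hr0.le, ← Real.rpow_natCast ‖x‖ n,
      ← Real.rpow_add hr0, ← Real.rpow_natCast ‖x‖ 4]
    congr 1
    rw [ha]; push_cast; ring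
  have hce : ε ^ 2 / 8 * 4 ^ a * (‖x‖ ^ 2) ^ a / ‖x‖ ^ 4 * ((l * ‖x‖) ^ n * vb) = c := by
    calc _ = ε ^ 2 / 8 * 4 ^ a * l ^ n * vb * ((‖x‖ ^ 2) ^ a * ‖x‖ ^ n) / ‖x‖ ^ 4 := by
          rw [mul_pow]; ring
      _ = c := by rw [hxa, hc]; field_simp
  linarith

end VorticityDecay

section Kernel

variable {n : ℕ}

/-- The model kernel `‖y‖ ^ (-p) * (s + ‖y‖) ^ (-q)`. -/
noncomputable def ker (s p q : ℝ) (y : V n) : ℝ := ‖y‖ ^ (-p) * (s + ‖y‖) ^ (-q)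

theorem measurable_ker (s p q : ℝ) : Measurable (ker s p q : V n → ℝ) := by
  unfold ker
  fun_prop

theorem ker_nonneg {s : ℝ} (hs : 0 ≤ s) (p q : ℝ) (y : V n) : 0 ≤ ker s p q y :=
  mul_nonneg (Real.rpow_nonneg (norm_nonneg _) _) (Real.rpow_nonneg (by positivity) _)

theorem integrable_ker_one (hn : 1 ≤ n) {p q : ℝ} (hp : 0 ≤ p) (_hq : 0 ≤ q) (hpn : p < n)
    (hpq : n < p + q) : Integrable (ker 1 p q : V n → ℝ) := by
  have hfr : Module.finrank ℝ (V n) = n := by simp [V]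
  rw [← integrableOn_univ, ← union_compl_self (Metric.ball (0 : V n) 1)]
  refine IntegrableOn.union ?_ ?_
  · refine integrableOn_ball_of_norm_le_rpow (C := 1) (α := p) (by rwa [hfr]) (by rwa [hfr]) ?_
      (measurable_ker 1 p q).aestronglyMeasurable
    refine ae_of_all _ fun y => ?_
    rw [Real.norm_of_nonneg (ker_nonneg zero_le_one _ _ _), ker, one_mul]
    refine mul_le_of_le_one_right (Real.rpow_nonneg (norm_nonneg _) _) ?_
    exact Real.rpow_le_one_of_one_le_of_nonpos (by linarith [norm_nonneg y]) (by linarith)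
  · have h1 : Integrable (fun y : V n => 2 ^ p * (1 + ‖y‖) ^ (-(p + q))) :=
      (integrable_one_add_norm (by rw [hfr]; exact hpq)).const_mul _
    refine h1.integrableOn.mono' (measurable_ker 1 p q).aestronglyMeasurable ?_
    refine (ae_restrict_mem measurableSet_ball.compl).mono fun y hy => ?_
    have hy1 : 1 ≤ ‖y‖ := by simpa using hy
    have hy0 : 0 < ‖y‖ := by linarith
    rw [Real.norm_of_nonneg (ker_nonneg zero_le_one _ _ _), ker, neg_add, Real.rpow_add (by linarith),
      ← mul_assoc]
    refine mul_le_mul_of_nonneg_right ?_ (Real.rpow_nonneg (by linarith) _)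
    have h2 : ((1 + ‖y‖) / 2) ^ (-p) = 2 ^ p * (1 + ‖y‖) ^ (-p) := by
      rw [Real.div_rpow (by linarith) (by norm_num), Real.rpow_neg zero_le_two, div_inv_eq_mul,
        mul_comm]
    rw [← h2]
    exact Real.rpow_le_rpow_of_nonpos (by linarith) (by linarith) (by linarith)

theorem ker_smul {s : ℝ} (hs : 0 < s) (p q : ℝ) (y : V n) :
    ker s p q (s • y) = s ^ (-p - q) * ker 1 p q y := by
  have h1 : s + s * ‖y‖ = s * (1 + ‖y‖) := by ring
  rw [ker, ker, norm_smul, Real.norm_of_nonneg hs.le, h1, Real.mul_rpow hs.le (norm_nonneg _),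
    Real.mul_rpow hs.le (by positivity), sub_eq_add_neg, Real.rpow_add hs]
  ring

theorem integrable_ker (hn : 1 ≤ n) {s p q : ℝ} (hs : 0 < s) (hp : 0 ≤ p) (hq : 0 ≤ q)
    (hpn : p < n) (hpq : n < p + q) : Integrable (ker s p q : V n → ℝ) := by
  rw [← integrable_comp_smul_iff volume _ hs.ne']
  simp_rw [ker_smul hs]
  exact (integrable_ker_one hn hp hq hpn hpq).const_mul _

theorem integral_ker {s : ℝ} (hs : 0 < s) (p q : ℝ) :
    ∫ y : V n, ker s p q y = s ^ ((n : ℝ) - p - q) * ∫ y : V n, ker 1 p q y := by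
  have hfr : Module.finrank ℝ (V n) = n := by simp [V]
  have h1 := Measure.integral_comp_smul_of_nonneg volume (ker s p q : V n → ℝ) s (hR := hs.le)
  simp_rw [ker_smul hs] at h1
  rw [integral_const_mul, hfr, smul_eq_mul] at h1
  have h2 : s ^ ((n : ℝ) - p - q) = s ^ n * s ^ (-p - q) := by
    rw [sub_sub, sub_eq_add_neg, Real.rpow_add hs, Real.rpow_natCast, neg_add, sub_eq_add_neg]
  rw [h2, mul_assoc, h1, ← mul_assoc, mul_inv_cancel₀ (by positivity), one_mul]

theorem conv_le (hn : 2 ≤ n) {a : ℝ} (ha : 0 ≤ a) (x y : V n) :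
    ‖y‖ ^ (-((n : ℝ) - 1)) * (1 + ‖x + y‖) ^ (-a) ≤
      3 ^ a * ker (1 + ‖x‖) (n - 1) a y +
        5 ^ ((n : ℝ) - 1) *
          ((1 + ‖x + y‖) ^ (-a) * (1 + ‖x‖ + ‖x + y‖) ^ (-((n : ℝ) - 1))) := by
  have hn' : (2 : ℝ) ≤ n := by exact_mod_cast hn
  have hx := norm_nonneg x
  have hy := norm_nonneg y
  have hz := norm_nonneg (x + y)
  have h1 : ‖x‖ - ‖y‖ ≤ ‖x + y‖ := by
    have := norm_sub_norm_le x (-y)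
    rwa [norm_neg, sub_neg_eq_add] at this
  have h2 := norm_add_le x y
  have p1 : 0 ≤ 3 ^ a * ker (1 + ‖x‖) ((n : ℝ) - 1) a y :=
    mul_nonneg (by positivity) (ker_nonneg (by positivity) _ _ _)
  rcases le_or_gt ‖y‖ ((1 + ‖x‖) / 2) with h | h
  · refine le_trans ?_ (le_add_of_nonneg_right (by positivity))
    rw [ker, mul_left_comm]
    refine mul_le_mul_of_nonneg_left ?_ (by positivity)
    have h3 : ((1 + ‖x‖ + ‖y‖) / 3) ^ (-a) = 3 ^ a * (1 + ‖x‖ + ‖y‖) ^ (-a) := by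
      rw [Real.div_rpow (by linarith) (by norm_num), Real.rpow_neg (by norm_num : (0:ℝ) ≤ 3),
        div_inv_eq_mul, mul_comm]
    rw [← h3]
    exact Real.rpow_le_rpow_of_nonpos (by linarith) (by linarith) (by linarith)
  · refine le_trans ?_ (le_add_of_nonneg_left p1)
    rw [mul_comm (‖y‖ ^ _), mul_left_comm]
    refine mul_le_mul_of_nonneg_left ?_ (by positivity)
    have h3 : ((1 + ‖x‖ + ‖x + y‖) / 5) ^ (-((n : ℝ) - 1)) =
        5 ^ ((n : ℝ) - 1) * (1 + ‖x‖ + ‖x + y‖) ^ (-((n : ℝ) - 1)) := by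
      rw [Real.div_rpow (by linarith) (by norm_num), Real.rpow_neg (by norm_num : (0:ℝ) ≤ 5),
        div_inv_eq_mul, mul_comm]
    rw [← h3]
    exact Real.rpow_le_rpow_of_nonpos (by linarith) (by linarith) (by linarith)

theorem integrable_far (hn : 2 ≤ n) {a : ℝ} (ha : 1 < a) (x : V n) :
    Integrable fun z : V n => (1 + ‖z‖) ^ (-a) * (1 + ‖x‖ + ‖z‖) ^ (-((n : ℝ) - 1)) := by
  have hfr : Module.finrank ℝ (V n) = n := by simp [V]
  have hn' : (2 : ℝ) ≤ n := by exact_mod_cast hn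
  have h1 : Integrable (fun y : V n => (1 + ‖y‖) ^ (-(a + ((n : ℝ) - 1)))) :=
    integrable_one_add_norm (by rw [hfr]; linarith)
  refine h1.mono' (Measurable.aestronglyMeasurable (by fun_prop)) (ae_of_all _ fun z => ?_)
  rw [Real.norm_of_nonneg (by positivity), neg_add, Real.rpow_add (by positivity)]
  refine mul_le_mul_of_nonneg_left ?_ (by positivity)
  exact Real.rpow_le_rpow_of_nonpos (by positivity) (by linarith [norm_nonneg x]) (by linarith)

theorem integrable_conv (hn : 2 ≤ n) {a : ℝ} (ha : 1 < a) (x : V n) :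
    Integrable fun y : V n => ‖y‖ ^ (-((n : ℝ) - 1)) * (1 + ‖x + y‖) ^ (-a) := by
  have hn' : (2 : ℝ) ≤ n := by exact_mod_cast hn
  have h1 := (integrable_ker (n := n) (by omega) (show 0 < 1 + ‖x‖ by positivity)
    (show 0 ≤ (n : ℝ) - 1 by linarith) (show 0 ≤ a by linarith) (by linarith)
    (by linarith)).const_mul (3 ^ a)
  have h2 := ((integrable_far hn ha x).comp_add_left x).const_mul (5 ^ ((n : ℝ) - 1))
  refine (h1.add h2).mono' (Measurable.aestronglyMeasurable (by fun_prop))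
    (ae_of_all _ fun y => ?_)
  rw [Real.norm_of_nonneg (by positivity)]
  exact conv_le hn (by linarith) x y

theorem integral_conv_le_aux (hn : 2 ≤ n) {a : ℝ} (ha : 1 < a) (x : V n) :
    ∫ y : V n, ‖y‖ ^ (-((n : ℝ) - 1)) * (1 + ‖x + y‖) ^ (-a) ≤
      3 ^ a * ((1 + ‖x‖) ^ (1 - a) * ∫ y : V n, ker 1 (n - 1) a y) +
        5 ^ ((n : ℝ) - 1) *
          ∫ z : V n, (1 + ‖z‖) ^ (-a) * (1 + ‖x‖ + ‖z‖) ^ (-((n : ℝ) - 1)) := by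
  have hn' : (2 : ℝ) ≤ n := by exact_mod_cast hn
  have h1 := (integrable_ker (n := n) (by omega) (show 0 < 1 + ‖x‖ by positivity)
    (show 0 ≤ (n : ℝ) - 1 by linarith) (show 0 ≤ a by linarith) (by linarith)
    (by linarith)).const_mul (3 ^ a)
  have h2 := ((integrable_far hn ha x).comp_add_left x).const_mul (5 ^ ((n : ℝ) - 1))
  refine (integral_mono (integrable_conv hn ha x) (h1.add h2)
    fun y => conv_le hn (by linarith) x y).trans_eq ?_
  rw [integral_add' h1 h2, integral_const_mul, integral_const_mul, integral_ker (by positivity)]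
  have e : (n : ℝ) - (n - 1) - a = 1 - a := by ring
  rw [e]
  congr 2
  · exact integral_add_left_eq_self (μ := volume)
      (fun z : V n => (1 + ‖z‖) ^ (-a) * (1 + ‖x‖ + ‖z‖) ^ (-((n : ℝ) - 1))) x

theorem exists_conv_le (hn : 2 ≤ n) {a : ℝ} (ha : 1 < a) (han : a < n) : ∃ K, 0 ≤ K ∧ ∀ x : V n,
    ∫ y : V n, ‖y‖ ^ (-((n : ℝ) - 1)) * (1 + ‖x + y‖) ^ (-a) ≤ K * (1 + ‖x‖) ^ (1 - a) := by
  have hn' : (2 : ℝ) ≤ n := by exact_mod_cast hn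
  have i1 : 0 ≤ ∫ y : V n, ker 1 (n - 1) a y := integral_nonneg fun y => ker_nonneg zero_le_one _ _ y
  have i2 : 0 ≤ ∫ y : V n, ker 1 a (n - 1) y := integral_nonneg fun y => ker_nonneg zero_le_one _ _ y
  refine ⟨3 ^ a * (∫ y : V n, ker 1 (n - 1) a y) + 5 ^ ((n : ℝ) - 1) *
    ∫ y : V n, ker 1 a (n - 1) y, by positivity, fun x => (integral_conv_le_aux hn ha x).trans ?_⟩
  have h1 : ∫ z : V n, (1 + ‖z‖) ^ (-a) * (1 + ‖x‖ + ‖z‖) ^ (-((n : ℝ) - 1)) ≤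
      (1 + ‖x‖) ^ (1 - a) * ∫ y : V n, ker 1 a (n - 1) y := by
    have e : (n : ℝ) - a - (n - 1) = 1 - a := by ring
    rw [← e, ← integral_ker (by positivity)]
    refine integral_mono_ae (integrable_far hn ha x) (integrable_ker (by omega) (by positivity)
      (by linarith) (by linarith) han (by linarith)) ?_
    have : Nontrivial (V n) := by
      have : Nonempty (Fin n) := ⟨⟨0, by omega⟩⟩
      infer_instance
    filter_upwards [compl_mem_ae_iff.2 (measure_singleton (0 : V n))] with z hz
    have hz0 : 0 < ‖z‖ := norm_pos_iff.2 (by simpa using hz)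
    refine mul_le_mul_of_nonneg_right ?_ (by positivity)
    exact Real.rpow_le_rpow_of_nonpos hz0 (by linarith) (by linarith)
  calc _ ≤ 3 ^ a * ((1 + ‖x‖) ^ (1 - a) * ∫ y : V n, ker 1 (n - 1) a y) +
        5 ^ ((n : ℝ) - 1) * ((1 + ‖x‖) ^ (1 - a) * ∫ y : V n, ker 1 a (n - 1) y) := by gcongr
    _ = _ := by ring

theorem exists_conv_le_of_lt (hn : 2 ≤ n) {a : ℝ} (han : n < a) : ∃ K, 0 ≤ K ∧ ∀ x : V n,
    ∫ y : V n, ‖y‖ ^ (-((n : ℝ) - 1)) * (1 + ‖x + y‖) ^ (-a) ≤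
      K * (1 + ‖x‖) ^ (1 - (n : ℝ)) := by
  have hn' : (2 : ℝ) ≤ n := by exact_mod_cast hn
  have hfr : Module.finrank ℝ (V n) = n := by simp [V]
  have ha : 1 < a := by linarith
  have i1 : 0 ≤ ∫ y : V n, ker 1 (n - 1) a y := integral_nonneg fun y => ker_nonneg zero_le_one _ _ y
  have i2 : 0 ≤ ∫ y : V n, (1 + ‖y‖) ^ (-a) := integral_nonneg fun y => by positivity
  refine ⟨3 ^ a * (∫ y : V n, ker 1 (n - 1) a y) + 5 ^ ((n : ℝ) - 1) *
    ∫ y : V n, (1 + ‖y‖) ^ (-a), by positivity, fun x => (integral_conv_le_aux hn ha x).trans ?_⟩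
  have h1 : ∫ z : V n, (1 + ‖z‖) ^ (-a) * (1 + ‖x‖ + ‖z‖) ^ (-((n : ℝ) - 1)) ≤
      (1 + ‖x‖) ^ (1 - (n : ℝ)) * ∫ y : V n, (1 + ‖y‖) ^ (-a) := by
    rw [← integral_const_mul]
    refine integral_mono (integrable_far hn ha x)
      ((integrable_one_add_norm (by rw [hfr]; exact han)).const_mul _) fun z => ?_
    beta_reduce
    rw [mul_comm, neg_sub]
    refine mul_le_mul_of_nonneg_right ?_ (by positivity)
    exact Real.rpow_le_rpow_of_nonpos (by positivity) (by linarith [norm_nonneg z]) (by linarith)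
  have h2 : (1 + ‖x‖) ^ (1 - a) ≤ (1 + ‖x‖) ^ (1 - (n : ℝ)) :=
    Real.rpow_le_rpow_of_exponent_le (by linarith [norm_nonneg x]) (by linarith)
  calc _ ≤ 3 ^ a * ((1 + ‖x‖) ^ (1 - (n : ℝ)) * ∫ y : V n, ker 1 (n - 1) a y) +
        5 ^ ((n : ℝ) - 1) * ((1 + ‖x‖) ^ (1 - (n : ℝ)) * ∫ y : V n, (1 + ‖y‖) ^ (-a)) := by gcongr
    _ = _ := by ring

end Kernel

section Potential

variable {n : ℕ}

theorem exists_truncated_power (a : ℝ) : ∃ K, 0 ≤ K ∧ ∃ G : ℝ → ℝ → ℝ, ∀ S, 0 < S →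
    ContDiff ℝ ∞ (G S) ∧ (∀ ρ, 2 * S ≤ ρ → G S ρ = 0) ∧
    (∀ ρ, 0 ≤ ρ → |deriv (G S) ρ| ≤ K * (ρ + 3) ^ (a - 1) ∧
      |deriv (deriv (G S)) ρ| ≤ K * (ρ + 3) ^ (a - 2)) ∧
    ∀ ρ, 0 ≤ ρ → ρ + 3 < S → deriv (G S) ρ = a * (ρ + 3) ^ (a - 1) ∧
      deriv (deriv (G S)) ρ = a * (a - 1) * (ρ + 3) ^ (a - 2) := by
  obtain ⟨β, hβ⟩ : ∃ β, β = |a| + |a * (a - 1)| := ⟨_, rfl⟩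
  have hw : IsWeight β (pw a) := hβ ▸ isWeight_pw a
  obtain ⟨K, hK, hl⟩ := exists_lw_bound β
  have hb0 := hw.const_nonneg
  refine ⟨β + 2 * K, by positivity, fun S ρ => lw 1 S (pw a) (ρ + 3), fun S hS => ?_⟩
  have hd : deriv (fun ρ => lw 1 S (pw a) (ρ + 3)) = fun ρ => deriv (lw 1 S (pw a)) (ρ + 3) :=
    funext fun ρ => deriv_comp_add_const _ _ _
  have hdd : deriv (deriv (fun ρ => lw 1 S (pw a) (ρ + 3))) =
      fun ρ => deriv (deriv (lw 1 S (pw a))) (ρ + 3) := by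
    rw [hd]
    exact funext fun ρ => deriv_comp_add_const _ _ _
  refine ⟨(contDiff_lw 1 S (contDiff_pw a)).comp (by fun_prop), fun ρ hρ => ?_, fun ρ hρ => ?_,
    fun ρ hρ hρS => ?_⟩
  · simp only [lw, cut_eq_zero_of_ge 1 hS (show 2 * S ≤ ρ + 3 by linarith), zero_mul]
  · have h0 : 0 < ρ + 3 := by linarith
    have hp := pw_eq a (show 1 / 2 ≤ ρ + 3 by linarith)
    obtain ⟨h1, h2⟩ := hl 1 S (pw a) le_rfl hS hw (ρ + 3) h0.le
    have b1 := hw.bound1 (ρ + 3) (by linarith)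
    have b2 := hw.bound2 (ρ + 3) (by linarith)
    have hr : rim 1 S (ρ + 3) ≤ 2 := by
      unfold rim
      linarith [dya_le_one 1 (ρ + 3), dya_le_one S (ρ + 3)]
    have hc : |cut 1 S (ρ + 3)| ≤ 1 := by
      rw [abs_of_nonneg (cut_nonneg _ _ _)]
      exact cut_le_one _ _ _
    rw [hp] at h1 h2 b1 b2
    have q := Real.rpow_pos_of_pos h0 a
    rw [hdd, hd, rpow_sub_one' h0, rpow_sub_two' h0]
    constructor
    · have e : deriv (lw 1 S (pw a)) (ρ + 3) = cut 1 S (ρ + 3) * deriv (pw a) (ρ + 3) +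
        (deriv (lw 1 S (pw a)) (ρ + 3) - cut 1 S (ρ + 3) * deriv (pw a) (ρ + 3)) := by ring
      beta_reduce
      rw [e]
      refine (abs_add_le _ _).trans ?_
      rw [abs_mul]
      calc _ ≤ 1 * (β * (ρ + 3) ^ a / (ρ + 3)) + K * ((ρ + 3) ^ a / (ρ + 3) * 2) := by
            gcongr
            exact h1.trans (by gcongr)
        _ = _ := by ring
    · have e : deriv (deriv (lw 1 S (pw a))) (ρ + 3) =
        cut 1 S (ρ + 3) * deriv (deriv (pw a)) (ρ + 3) + (deriv (deriv (lw 1 S (pw a))) (ρ + 3) -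
          cut 1 S (ρ + 3) * deriv (deriv (pw a)) (ρ + 3)) := by ring
      beta_reduce
      rw [e]
      refine (abs_add_le _ _).trans ?_
      rw [abs_mul]
      calc _ ≤ 1 * (β * (ρ + 3) ^ a / (ρ + 3) ^ 2) + K * ((ρ + 3) ^ a / (ρ + 3) ^ 2 * 2) := by
            gcongr
            exact h2.trans (by gcongr)
        _ = _ := by ring
  · have h0 : 0 < ρ + 3 := by linarith
    obtain ⟨h1, h2⟩ := hl 1 S (pw a) le_rfl hS hw (ρ + 3) h0.le
    have hr : rim 1 S (ρ + 3) = 0 := by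
      have e1 : ρ + 3 ∉ Icc (1 : ℝ) (2 * 1) := fun h => by linarith [h.2]
      have e2 : ρ + 3 ∉ Icc S (2 * S) := fun h => by linarith [h.1]
      unfold rim dya
      rw [indicator_of_notMem e1, indicator_of_notMem e2, add_zero]
    have hc : cut 1 S (ρ + 3) = 1 := by
      unfold cut
      rw [th_eq_zero (by linarith), th_eq_one (by rw [div_le_one hS]; exact hρS.le)]
      norm_num
    rw [hr, mul_zero, mul_zero, hc, one_mul, abs_nonpos_iff, sub_eq_zero] at h1 h2
    rw [hdd, hd]
    beta_reduce
    rw [h1, h2, deriv_pw a (by linarith), deriv_deriv_pw a (by linarith)]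
    exact ⟨rfl, (mul_assoc _ _ _).symm⟩

/-- A smooth, integrable, positive averaging kernel. -/
noncomputable def avg (y : V n) : ℝ := (‖y‖ ^ 2 + 3) ^ (-(n : ℝ) / 2 - 1)

theorem avg_pos (y : V n) : 0 < avg y := Real.rpow_pos_of_pos (by positivity) _

theorem rpow_half_le {b : ℝ} (hb : 0 ≤ b) (y : V n) :
    (‖y‖ ^ 2 + 3) ^ (-b / 2) ≤ 2 ^ (b / 2) * (1 + ‖y‖) ^ (-b) := by
  have h1 : (1 + ‖y‖) ^ 2 / 2 ≤ ‖y‖ ^ 2 + 3 := by nlinarith [sq_nonneg (‖y‖ - 1)]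
  have h2 : 0 < 1 + ‖y‖ := by positivity
  have h3 : ((1 + ‖y‖) ^ 2 / 2) ^ (-b / 2) = 2 ^ (b / 2) * (1 + ‖y‖) ^ (-b) := by
    rw [Real.div_rpow (by positivity) zero_le_two, ← Real.rpow_natCast, ← Real.rpow_mul h2.le,
      show -b / 2 = -(b / 2) by ring, Real.rpow_neg zero_le_two, div_inv_eq_mul, mul_comm]
    congr 2
    push_cast
    ring
  rw [← h3]
  exact Real.rpow_le_rpow_of_nonpos (by positivity) h1 (by linarith)

theorem continuous_avg : Continuous (avg : V n → ℝ) := by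
  unfold avg
  refine Continuous.rpow_const (by fun_prop) fun y => Or.inl (by positivity)

theorem integrable_avg : Integrable (avg : V n → ℝ) := by
  have hfr : Module.finrank ℝ (V n) = n := by simp [V]
  have h1 : Integrable (fun y : V n => 2 ^ (((n : ℝ) + 2) / 2) * (1 + ‖y‖) ^ (-((n : ℝ) + 2))) :=
    (integrable_one_add_norm (by rw [hfr]; linarith)).const_mul _
  refine h1.mono' continuous_avg.aestronglyMeasurable (ae_of_all _ fun y => ?_)
  rw [Real.norm_of_nonneg (avg_pos y).le]
  have := rpow_half_le (show 0 ≤ (n : ℝ) + 2 by positivity) y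
  rwa [show -((n : ℝ) + 2) / 2 = -(n : ℝ) / 2 - 1 by ring] at this

theorem integral_avg_pos : 0 < ∫ y : V n, avg y := by
  rw [integral_pos_iff_support_of_nonneg (fun y => (avg_pos y).le) integrable_avg,
    Function.support_eq_univ fun y => (avg_pos y).ne']
  exact isOpen_univ.measure_pos volume univ_nonempty

/-- `lap w` is the divergence of the field `F`, with `w` decaying and `F` dominated by `B`. -/
structure IsDivForm (w : V n → ℝ) (F : Fin n → V n → ℝ) (B : V n → ℝ) (A : ℝ) : Prop where
  smooth : ContDiff ℝ ∞ w
  smoothF : ∀ k, ContDiff ℝ ∞ (F k)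
  lap_eq : ∀ x, lap w x = ∑ k, pd k (F k) x
  bound : ∀ x, |w x| ≤ A * (1 + ‖x‖)⁻¹
  boundF : ∀ k x, |F k x| ≤ B x

theorem exists_avg_le (hn : 3 ≤ n) : ∃ K, 0 ≤ K ∧ ∀ (w : V n → ℝ) F B A, IsDivForm w F B A →
    Integrable (fun y => ‖y‖ ^ (-((n : ℝ) - 1)) * B y) →
    |∫ y, w y * avg y| ≤ K * ∫ y, ‖y‖ ^ (-((n : ℝ) - 1)) * B y := by
  have hfr : Module.finrank ℝ (V n) = n := by simp [V]
  have hn' : (3 : ℝ) ≤ n := by exact_mod_cast hn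
  obtain ⟨a, ha⟩ : ∃ a : ℝ, a = 1 - n / 2 := ⟨_, rfl⟩
  obtain ⟨K, hK, G, hG⟩ := exists_truncated_power a
  have hc : 0 < 3 * (n : ℝ) * (n - 2) := by nlinarith
  refine ⟨n * (2 * K) / (3 * (n : ℝ) * (n - 2)), by positivity, fun w F B A h hB => ?_⟩
  have main : ∀ S, 0 < S → |∫ y, w y * lap (fun y => G S (‖y‖ ^ 2)) y| ≤
      n * (2 * K) * ∫ y, ‖y‖ ^ (-((n : ℝ) - 1)) * B y := by
    intro S hS
    obtain ⟨s1, s2, s3, -⟩ := hG S hS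
    have hψ : ContDiff ℝ ∞ (fun y : V n => G S (‖y‖ ^ 2)) := s1.comp contDiff_norm_sq'
    have hs : HasCompactSupport (fun y : V n => G S (‖y‖ ^ 2)) := by
      refine HasCompactSupport.intro (isCompact_closedBall (0 : V n) (2 * S + 1)) fun x hx => ?_
      rw [mem_closedBall_zero_iff, not_le] at hx
      exact s2 _ (by nlinarith)
    have e1 : ∫ y, w y * lap (fun y => G S (‖y‖ ^ 2)) y =
        - ∑ k, ∫ y, F k y * pd k (fun y => G S (‖y‖ ^ 2)) y := by
      rw [integral_mul_lap h.smooth hψ hs]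
      simp_rw [h.lap_eq, Finset.sum_mul]
      rw [integral_finsetSum _ fun k _ => integrable_mul_test
        (contDiff_pd k (h.smoothF k)).continuous hψ.continuous hs, ← Finset.sum_neg_distrib]
      refine Finset.sum_congr rfl fun k _ => ?_
      rw [integral_mul_pd (h.smoothF k) hψ hs k, neg_neg]
    have e2 : ∀ k, |∫ y, F k y * pd k (fun y => G S (‖y‖ ^ 2)) y| ≤
        2 * K * ∫ y, ‖y‖ ^ (-((n : ℝ) - 1)) * B y := by
      intro k
      rw [← integral_const_mul, ← Real.norm_eq_abs]
      refine norm_integral_le_of_norm_le (hB.const_mul _) (ae_of_all _ fun y => ?_)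
      rw [pd_radial s1, Real.norm_eq_abs, abs_mul, abs_mul, abs_mul, abs_two]
      have c1 : |y k| ≤ ‖y‖ := by simpa using PiLp.norm_apply_le y k
      have c2 := (s3 (‖y‖ ^ 2) (by positivity)).1
      have c3 := h.boundF k y
      have c4 : 0 ≤ B y := (abs_nonneg _).trans c3
      have c5 : ‖y‖ * (‖y‖ ^ 2 + 3) ^ (a - 1) ≤ ‖y‖ ^ (-((n : ℝ) - 1)) := by
        rcases (norm_nonneg y).eq_or_lt with hy | hy
        · rw [← hy, zero_mul]
          positivity
        · have : ‖y‖ ^ (-((n : ℝ) - 1)) = ‖y‖ * (‖y‖ ^ 2) ^ (a - 1) := by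
            rw [← Real.rpow_natCast, ← Real.rpow_mul hy.le, neg_sub, Real.rpow_sub hy,
              show ((2 : ℕ) : ℝ) * (a - 1) = -n by rw [ha]; push_cast; ring, Real.rpow_one,
              Real.rpow_neg hy.le, div_eq_mul_inv]
          rw [this]
          refine mul_le_mul_of_nonneg_left ?_ hy.le
          exact Real.rpow_le_rpow_of_nonpos (by positivity) (by linarith) (by rw [ha]; linarith)
      calc _ ≤ B y * (2 * ‖y‖ * (K * (‖y‖ ^ 2 + 3) ^ (a - 1))) := by gcongr
        _ = 2 * K * (‖y‖ * (‖y‖ ^ 2 + 3) ^ (a - 1) * B y) := by ring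
        _ ≤ _ := by gcongr
    rw [e1, abs_neg]
    refine (Finset.abs_sum_le_sum_abs _ _).trans ((Finset.sum_le_sum fun k _ => e2 k).trans_eq ?_)
    rw [Finset.sum_const, Finset.card_univ, Fintype.card_fin, nsmul_eq_mul]
    ring
  have lim : Tendsto (fun m : ℕ => ∫ y, w y * lap (fun y => G ((m : ℝ) + 1) (‖y‖ ^ 2)) y) atTop
      (𝓝 (∫ y, w y * (-(3 * (n : ℝ) * (n - 2)) * avg y))) := by
    have hI : Integrable (fun y : V n => A * ((2 * n + 4) * K * 2 ^ ((n : ℝ) / 2)) *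
        (1 + ‖y‖) ^ (-((n : ℝ) + 1))) :=
      (integrable_one_add_norm (by rw [hfr]; linarith)).const_mul _
    refine tendsto_integral_of_dominated_convergence _ (fun m => ?_) hI (fun m => ?_) ?_
    · obtain ⟨s1, -⟩ := hG ((m : ℝ) + 1) (by positivity)
      have hψ : ContDiff ℝ ∞ (fun y : V n => G ((m : ℝ) + 1) (‖y‖ ^ 2)) := s1.comp contDiff_norm_sq'
      exact (h.smooth.continuous.mul (contDiff_lap hψ).continuous).aestronglyMeasurable
    · obtain ⟨s1, s2, s3, -⟩ := hG ((m : ℝ) + 1) (by positivity)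
      refine ae_of_all _ fun y => ?_
      rw [Real.norm_eq_abs, abs_mul, lap_radial s1]
      obtain ⟨d1, d2⟩ := s3 (‖y‖ ^ 2) (by positivity)
      have c1 := h.bound y
      have c2 : |2 * n * deriv (G ((m : ℝ) + 1)) (‖y‖ ^ 2) +
          4 * ‖y‖ ^ 2 * deriv (deriv (G ((m : ℝ) + 1))) (‖y‖ ^ 2)| ≤
          (2 * n + 4) * K * (‖y‖ ^ 2 + 3) ^ (a - 1) := by
        refine (abs_add_le _ _).trans ?_
        rw [abs_mul, abs_mul (4 * ‖y‖ ^ 2), abs_of_nonneg (show 0 ≤ 2 * (n : ℝ) by positivity),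
          abs_of_nonneg (show 0 ≤ 4 * ‖y‖ ^ 2 by positivity)]
        have hx : ‖y‖ ^ 2 * (‖y‖ ^ 2 + 3) ^ (a - 2) ≤ (‖y‖ ^ 2 + 3) ^ (a - 1) := by
          rw [show a - 1 = 1 + (a - 2) by ring, Real.rpow_add (by positivity), Real.rpow_one]
          gcongr
          linarith
        calc _ ≤ 2 * n * (K * (‖y‖ ^ 2 + 3) ^ (a - 1)) +
              4 * ‖y‖ ^ 2 * (K * (‖y‖ ^ 2 + 3) ^ (a - 2)) := by gcongr
          _ = 2 * n * (K * (‖y‖ ^ 2 + 3) ^ (a - 1)) +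
              4 * K * (‖y‖ ^ 2 * (‖y‖ ^ 2 + 3) ^ (a - 2)) := by ring
          _ ≤ 2 * n * (K * (‖y‖ ^ 2 + 3) ^ (a - 1)) + 4 * K * (‖y‖ ^ 2 + 3) ^ (a - 1) := by gcongr
          _ = _ := by ring
      have c3 := rpow_half_le (show 0 ≤ (n : ℝ) by positivity) y
      rw [show -(n : ℝ) / 2 = a - 1 by rw [ha]; ring] at c3
      have c4 : 0 ≤ A * (1 + ‖y‖)⁻¹ := (abs_nonneg _).trans c1
      calc _ ≤ A * (1 + ‖y‖)⁻¹ * ((2 * n + 4) * K * (2 ^ ((n : ℝ) / 2) * (1 + ‖y‖) ^ (-(n : ℝ)))) :=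
            mul_le_mul c1 (c2.trans (by gcongr)) (abs_nonneg _) c4
        _ = _ := by
          rw [neg_add, Real.rpow_add (by positivity), Real.rpow_neg_one]
          ring
    · refine ae_of_all _ fun y => ?_
      refine tendsto_const_nhds.congr' ?_
      obtain ⟨N, hN⟩ := exists_nat_gt (‖y‖ ^ 2 + 3)
      filter_upwards [eventually_ge_atTop N] with m hm
      have hm' : (N : ℝ) ≤ m := by exact_mod_cast hm
      obtain ⟨s1, -, -, s4⟩ := hG ((m : ℝ) + 1) (by positivity)
      obtain ⟨d1, d2⟩ := s4 (‖y‖ ^ 2) (by positivity) (by linarith)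
      rw [lap_radial s1, d1, d2, avg, show -(n : ℝ) / 2 - 1 = a - 2 by rw [ha]; ring,
        show a - 1 = 1 + (a - 2) by ring, Real.rpow_add (by positivity), Real.rpow_one, ha]
      ring
  have hle := le_of_tendsto lim.abs (Eventually.of_forall fun m : ℕ => main ((m : ℝ) + 1)
    (by positivity))
  have e : ∫ y, w y * (-(3 * (n : ℝ) * (n - 2)) * avg y) =
      -(3 * (n : ℝ) * (n - 2)) * ∫ y, w y * avg y := by
    rw [← integral_const_mul]
    congr 1
    funext y
    ring
  rw [e, abs_mul, abs_neg, abs_of_pos hc] at hle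
  rw [div_mul_eq_mul_div, le_div_iff₀ hc]
  linarith

theorem pd_comp_affine {f : V n → ℝ} (hf : ContDiff ℝ ∞ f) (x : V n) (δ : ℝ) (i : Fin n) (z : V n) :
    pd i (fun z => f (x + δ • z)) z = δ * pd i f (x + δ • z) := by
  unfold pd
  have h1 : HasFDerivAt f (fderiv ℝ f (x + δ • z)) (x + δ • z) :=
    (hf.differentiable (by simp) _).hasFDerivAt
  have h2 : HasFDerivAt (fun z : V n => x + δ • z) (δ • ContinuousLinearMap.id ℝ (V n)) z :=
    ((hasFDerivAt_id z).const_smul δ).const_add x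
  have h3 : HasFDerivAt (fun z => f (x + δ • z)) _ z := h1.comp z h2
  rw [h3.fderiv]
  simp

theorem contDiff_comp_affine {f : V n → ℝ} (hf : ContDiff ℝ ∞ f) (x : V n) (δ : ℝ) :
    ContDiff ℝ ∞ fun z => f (x + δ • z) := hf.comp (by fun_prop)

theorem IsDivForm.rescale {w : V n → ℝ} {F : Fin n → V n → ℝ} {B : V n → ℝ} {A : ℝ}
    (h : IsDivForm w F B A) (hA : 0 ≤ A) (x : V n) {δ : ℝ} (hδ : 0 < δ) :
    IsDivForm (fun z => w (x + δ • z)) (fun k z => δ * F k (x + δ • z))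
      (fun z => δ * B (x + δ • z)) (A * (1 + (1 + ‖x‖) / δ)) where
  smooth := contDiff_comp_affine h.smooth x δ
  smoothF k := contDiff_const.mul (contDiff_comp_affine (h.smoothF k) x δ)
  lap_eq z := by
    have e1 : lap (fun z => w (x + δ • z)) z = δ ^ 2 * lap w (x + δ • z) := by
      unfold lap
      rw [Finset.mul_sum]
      refine Finset.sum_congr rfl fun i _ => ?_
      have : pd i (fun z => w (x + δ • z)) = fun z => δ * pd i w (x + δ • z) :=
        funext fun z => pd_comp_affine h.smooth x δ i z
      rw [this, pd_const_mul δ (contDiff_comp_affine (contDiff_pd i h.smooth) x δ),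
        pd_comp_affine (contDiff_pd i h.smooth)]
      ring
    rw [e1, h.lap_eq, Finset.mul_sum]
    refine Finset.sum_congr rfl fun k _ => ?_
    rw [pd_const_mul δ (contDiff_comp_affine (h.smoothF k) x δ), pd_comp_affine (h.smoothF k)]
    ring
  bound z := by
    refine (h.bound _).trans ?_
    rw [mul_assoc]
    refine mul_le_mul_of_nonneg_left ?_ hA
    rw [inv_le_iff_one_le_mul₀ (by positivity), ← div_eq_mul_inv, div_mul_eq_mul_div,
      one_le_div (by positivity)]
    have h1 : δ * ‖z‖ ≤ ‖x + δ • z‖ + ‖x‖ := by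
      have : ‖δ • z‖ ≤ ‖x + δ • z‖ + ‖x‖ := by
        have := norm_sub_le (x + δ • z) x
        rwa [add_sub_cancel_left] at this
      rwa [norm_smul, Real.norm_of_nonneg hδ.le] at this
    have h2 : ‖z‖ ≤ (‖x + δ • z‖ + ‖x‖) / δ := by
      rw [le_div_iff₀ hδ]
      linarith
    have h3 : (‖x + δ • z‖ + ‖x‖) / δ ≤ (1 + ‖x‖) / δ * (1 + ‖x + δ • z‖) := by
      rw [div_mul_eq_mul_div]
      gcongr
      nlinarith [norm_nonneg x, norm_nonneg (x + δ • z),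
        mul_nonneg (norm_nonneg x) (norm_nonneg (x + δ • z))]
    nlinarith [norm_nonneg (x + δ • z)]
  boundF k z := by
    rw [abs_mul, abs_of_pos hδ]
    exact mul_le_mul_of_nonneg_left (h.boundF k _) hδ.le

theorem exists_potential_bound (hn : 3 ≤ n) : ∃ K, 0 ≤ K ∧ ∀ (w : V n → ℝ) F B A,
    IsDivForm w F B A → 0 ≤ A → ∀ x : V n,
    Integrable (fun y => ‖y‖ ^ (-((n : ℝ) - 1)) * B (x + y)) →
    |w x| ≤ K * ∫ y, ‖y‖ ^ (-((n : ℝ) - 1)) * B (x + y) := by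
  have hfr : Module.finrank ℝ (V n) = n := by simp [V]
  obtain ⟨K, hK, hP⟩ := exists_avg_le hn
  have hI := integral_avg_pos (n := n)
  refine ⟨K / ∫ y : V n, avg y, by positivity, fun w F B A h hA x hB => ?_⟩
  have hscale : ∀ δ : ℝ, 0 < δ → ∀ z : V n, ‖z‖ ^ (-((n : ℝ) - 1)) * (δ * B (x + δ • z)) =
      δ ^ n * (‖δ • z‖ ^ (-((n : ℝ) - 1)) * B (x + δ • z)) := by
    intro δ hδ z
    rw [norm_smul, Real.norm_of_nonneg hδ.le, Real.mul_rpow hδ.le (norm_nonneg _), neg_sub,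
      Real.rpow_sub hδ, Real.rpow_one, Real.rpow_natCast]
    field_simp
  have main : ∀ δ : ℝ, 0 < δ → |∫ z, w (x + δ • z) * avg z| ≤
      K * ∫ y, ‖y‖ ^ (-((n : ℝ) - 1)) * B (x + y) := by
    intro δ hδ
    have h1 := hP _ _ _ _ (h.rescale hA x hδ)
    beta_reduce at h1
    simp_rw [hscale δ hδ] at h1
    rw [integral_const_mul, Measure.integral_comp_smul_of_nonneg volume
      (fun y : V n => ‖y‖ ^ (-((n : ℝ) - 1)) * B (x + y)) δ (hR := hδ.le), hfr, smul_eq_mul,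
      mul_inv_cancel_left₀ (by positivity)] at h1
    exact h1 (((integrable_comp_smul_iff volume
      (fun y : V n => ‖y‖ ^ (-((n : ℝ) - 1)) * B (x + y)) hδ.ne').2 hB).const_mul _)
  have lim : Tendsto (fun m : ℕ => ∫ z, w (x + (1 / ((m : ℝ) + 1)) • z) * avg z) atTop
      (𝓝 (∫ z : V n, w x * avg z)) := by
    refine tendsto_integral_of_dominated_convergence (fun z => A * avg z) (fun m => ?_)
      (integrable_avg.const_mul _) (fun m => ?_) ?_
    · exact ((contDiff_comp_affine h.smooth x _).continuous.mul continuous_avg).aestronglyMeasurable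
    · refine ae_of_all _ fun z => ?_
      rw [Real.norm_eq_abs, abs_mul, abs_of_pos (avg_pos z)]
      refine mul_le_mul_of_nonneg_right ((h.bound _).trans ?_) (avg_pos z).le
      refine mul_le_of_le_one_right hA (inv_le_one_of_one_le₀ ?_)
      linarith [norm_nonneg (x + (1 / ((m : ℝ) + 1)) • z)]
    · refine ae_of_all _ fun z => Tendsto.mul_const _ ?_
      have h1 : Tendsto (fun m : ℕ => x + (1 / ((m : ℝ) + 1)) • z) atTop (𝓝 (x + (0 : ℝ) • z)) :=
        (tendsto_one_div_add_atTop_nhds_zero_nat.smul_const z).const_add x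
      rw [zero_smul, add_zero] at h1
      exact (h.smooth.continuous.tendsto x).comp h1
  have hle := le_of_tendsto lim.abs (Eventually.of_forall fun m : ℕ => main (1 / ((m : ℝ) + 1))
    (by positivity))
  rw [integral_const_mul, abs_mul, abs_of_pos hI] at hle
  rwa [div_mul_eq_mul_div, le_div_iff₀ hI]

theorem exists_potential_bound_rpow (hn : 3 ≤ n) {a b : ℝ} (ha : 1 < a) (han : a < n) (hb : 1 < b)
    (hbn : b < n) : ∃ K, 0 ≤ K ∧ ∀ (w : V n → ℝ) F A M N, 0 ≤ A → 0 ≤ M → 0 ≤ N →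
    IsDivForm w F (fun y => M * (1 + ‖y‖) ^ (-a) + N * (1 + ‖y‖) ^ (-b)) A →
    ∀ x : V n, |w x| ≤ K * (M * (1 + ‖x‖) ^ (1 - a) + N * (1 + ‖x‖) ^ (1 - b)) := by
  obtain ⟨K, hK, hP⟩ := exists_potential_bound hn
  obtain ⟨Ka, hKa, ha'⟩ := exists_conv_le (n := n) (by omega) ha han
  obtain ⟨Kb, hKb, hb'⟩ := exists_conv_le (n := n) (by omega) hb hbn
  refine ⟨K * (Ka + Kb), by positivity, fun w F A M N hA hM hN h x => ?_⟩
  have i1 := (integrable_conv (n := n) (by omega) ha x).const_mul M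
  have i2 := (integrable_conv (n := n) (by omega) hb x).const_mul N
  have e : (fun y : V n => ‖y‖ ^ (-((n : ℝ) - 1)) *
      (M * (1 + ‖x + y‖) ^ (-a) + N * (1 + ‖x + y‖) ^ (-b))) =
      (fun y => M * (‖y‖ ^ (-((n : ℝ) - 1)) * (1 + ‖x + y‖) ^ (-a))) +
        fun y => N * (‖y‖ ^ (-((n : ℝ) - 1)) * (1 + ‖x + y‖) ^ (-b)) := by
    funext y
    rw [Pi.add_apply]
    ring
  have h1 := hP w F _ A h hA x
  beta_reduce at h1
  rw [e, integral_add' i1 i2, integral_const_mul, integral_const_mul] at h1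
  have q1 : 0 ≤ (1 + ‖x‖) ^ (1 - a) := by positivity
  have q2 : 0 ≤ (1 + ‖x‖) ^ (1 - b) := by positivity
  have t1 := ha' x
  have t2 := hb' x
  calc |w x| ≤ _ := h1 (i1.add i2)
    _ ≤ K * (M * (Ka * (1 + ‖x‖) ^ (1 - a)) + N * (Kb * (1 + ‖x‖) ^ (1 - b))) := by gcongr
    _ ≤ K * (M * ((Ka + Kb) * (1 + ‖x‖) ^ (1 - a)) + N * ((Ka + Kb) * (1 + ‖x‖) ^ (1 - b))) := by
        gcongr <;> linarith
    _ = _ := by ring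

theorem exists_potential_bound_of_lt (hn : 3 ≤ n) {a : ℝ} (han : n < a) :
    ∃ K, 0 ≤ K ∧ ∀ (w : V n → ℝ) F A M, 0 ≤ A → 0 ≤ M →
    IsDivForm w F (fun y => M * (1 + ‖y‖) ^ (-a)) A →
    ∀ x : V n, |w x| ≤ K * (M * (1 + ‖x‖) ^ (1 - (n : ℝ))) := by
  obtain ⟨K, hK, hP⟩ := exists_potential_bound hn
  have hn' : (3 : ℝ) ≤ n := by exact_mod_cast hn
  obtain ⟨Ka, hKa, ha'⟩ := exists_conv_le_of_lt (n := n) (by omega) han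
  refine ⟨K * Ka, by positivity, fun w F A M hA hM h x => ?_⟩
  have i1 := (integrable_conv (n := n) (by omega) (show 1 < a by linarith) x).const_mul M
  have e : (fun y : V n => ‖y‖ ^ (-((n : ℝ) - 1)) * (M * (1 + ‖x + y‖) ^ (-a))) =
      fun y => M * (‖y‖ ^ (-((n : ℝ) - 1)) * (1 + ‖x + y‖) ^ (-a)) := by
    funext y
    ring
  have h1 := hP w F _ A h hA x
  beta_reduce at h1
  rw [e, integral_const_mul] at h1
  have t1 := ha' x
  calc |w x| ≤ _ := h1 i1
    _ ≤ K * (M * (Ka * (1 + ‖x‖) ^ (1 - (n : ℝ)))) := by gcongr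
    _ = _ := by ring

end Potential

section Bootstrap

variable {n : ℕ} {U : Fin n → V n → ℝ} {P : V n → ℝ} {R C : ℝ}

/-- A globally defined smooth field which coincides with `lamb U` on the exterior domain. -/
noncomputable def src (U : Fin n → V n → ℝ) (P : V n → ℝ) (j : Fin n) (x : V n) : ℝ :=
  lap (U j) x - pd j (head U P) x

/-- The divergence of `U`. -/
noncomputable def dv (U : Fin n → V n → ℝ) (x : V n) : ℝ := ∑ i, pd i (U i) x

theorem contDiff_src (hU : ∀ j, ContDiff ℝ ∞ (U j)) (hP : ContDiff ℝ ∞ P) (j : Fin n) :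
    ContDiff ℝ ∞ (src U P j) :=
  (contDiff_lap (hU j)).sub (contDiff_pd j (contDiff_head hU hP))

theorem contDiff_dv (hU : ∀ j, ContDiff ℝ ∞ (U j)) : ContDiff ℝ ∞ (dv U) :=
  ContDiff.sum fun i _ => contDiff_pd i (hU i)

theorem exists_compact_bound {ι : Type*} [Fintype ι] {f : ι → V n → ℝ} (hf : ∀ i, Continuous (f i))
    (R q : ℝ) : ∃ M, 0 ≤ M ∧ ∀ x, ‖x‖ ≤ R → ∀ i, |f i x| ≤ M * (1 + ‖x‖) ^ (-q) := by
  have h1 : ∀ i, ∃ M, ∀ x ∈ Metric.closedBall (0 : V n) R, ‖f i x * (1 + ‖x‖) ^ q‖ ≤ M := fun i =>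
    (isCompact_closedBall (0 : V n) R).exists_bound_of_continuousOn ((hf i).mul
      (Continuous.rpow_const (by fun_prop) fun x => Or.inl (by positivity))).continuousOn
  choose M hM using h1
  refine ⟨∑ i, |M i|, by positivity, fun x hx i => ?_⟩
  have h2 := hM i x (by simpa using hx)
  have h3 : M i ≤ ∑ i, |M i| := (le_abs_self _).trans
    (Finset.single_le_sum (f := fun i => |M i|) (fun i _ => abs_nonneg _) (Finset.mem_univ i))
  have hp : 0 < (1 + ‖x‖) ^ q := by positivity
  rw [Real.norm_eq_abs, abs_mul, abs_of_pos hp] at h2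
  rw [Real.rpow_neg (by positivity), ← div_eq_mul_inv, le_div_iff₀ hp]
  exact h2.trans h3

theorem exists_isDivForm_om (hU : ∀ j, ContDiff ℝ ∞ (U j)) (hP : ContDiff ℝ ∞ P) {A : ℝ}
    {B : V n → ℝ} (hA : ∀ i j x, |om U i j x| ≤ A * (1 + ‖x‖)⁻¹)
    (hB : ∀ j x, 2 * |src U P j x| ≤ B x) (i j : Fin n) : ∃ F, IsDivForm (om U i j) F B A := by
  have hs := fun j => contDiff_src hU hP j
  have hH := contDiff_head hU hP
  have s1 : ∀ i j k : Fin n, ContDiff ℝ ∞ (fun x => (if k = i then 1 else 0) * src U P j x) :=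
    fun i j k => contDiff_const.mul (hs j)
  refine ⟨fun k x => (if k = i then 1 else 0) * src U P j x -
    (if k = j then 1 else 0) * src U P i x, contDiff_om hU i j,
    fun k => (s1 i j k).sub (s1 j i k), fun x => ?_, hA i j, fun k x => ?_⟩
  · have e : ∀ k, pd k (fun x => (if k = i then 1 else 0) * src U P j x -
        (if k = j then 1 else 0) * src U P i x) x = (if k = i then 1 else 0) * pd k (src U P j) x -
        (if k = j then 1 else 0) * pd k (src U P i) x := fun k => by
      rw [pd_sub (s1 i j k) (s1 j i k), pd_const_mul _ (hs j), pd_const_mul _ (hs i)]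
    simp_rw [e, Finset.sum_sub_distrib]
    simp only [ite_mul, one_mul, zero_mul, Finset.sum_ite_eq', Finset.mem_univ, if_true]
    have e1 : ∀ i j, pd i (src U P j) x = pd i (lap (U j)) x - pd i (pd j (head U P)) x :=
      fun i j => pd_sub (contDiff_lap (hU j)) (contDiff_pd j hH) i x
    have e2 : lap (om U i j) x = lap (pd i (U j)) x - lap (pd j (U i)) x := by
      unfold lap om
      rw [← Finset.sum_sub_distrib]
      refine Finset.sum_congr rfl fun k _ => ?_
      have : pd k (fun x => pd i (U j) x - pd j (U i) x) =
          fun x => pd k (pd i (U j)) x - pd k (pd j (U i)) x := funext fun y =>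
        pd_sub (contDiff_pd i (hU j)) (contDiff_pd j (hU i)) k y
      rw [this, pd_sub (contDiff_pd _ (contDiff_pd i (hU j)))
        (contDiff_pd _ (contDiff_pd j (hU i)))]
    rw [e2, lap_pd _ (hU j), lap_pd _ (hU i), e1, e1, pd_comm hH j i]
    ring
  · have b1 := hB j x
    have b2 := hB i x
    have c1 : |(if k = i then (1 : ℝ) else 0)| ≤ 1 := by split_ifs <;> simp
    have c2 : |(if k = j then (1 : ℝ) else 0)| ≤ 1 := by split_ifs <;> simp
    refine (abs_sub _ _).trans ?_
    rw [abs_mul, abs_mul]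
    nlinarith [mul_le_mul_of_nonneg_right c1 (abs_nonneg (src U P j x)),
      mul_le_mul_of_nonneg_right c2 (abs_nonneg (src U P i x))]

theorem exists_isDivForm (hU : ∀ j, ContDiff ℝ ∞ (U j)) {A : ℝ} {B : V n → ℝ}
    (hA : ∀ j x, |U j x| ≤ A * (1 + ‖x‖)⁻¹) (hB : ∀ i j x, |om U i j x| + |dv U x| ≤ B x)
    (j : Fin n) : ∃ F, IsDivForm (U j) F B A := by
  have hd := contDiff_dv hU
  have s1 : ∀ k : Fin n, ContDiff ℝ ∞ (fun x => (if k = j then 1 else 0) * dv U x) :=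
    fun k => contDiff_const.mul hd
  refine ⟨fun k x => om U k j x + (if k = j then 1 else 0) * dv U x, hU j,
    fun k => (contDiff_om hU k j).add (s1 k), fun x => ?_, hA j, fun k x => ?_⟩
  · have e : ∀ k, pd k (fun x => om U k j x + (if k = j then 1 else 0) * dv U x) x =
        pd k (om U k j) x + (if k = j then 1 else 0) * pd k (dv U) x := fun k => by
      rw [pd_add (contDiff_om hU k j) (s1 k), pd_const_mul _ hd]
    have e1 : ∀ k, pd k (om U k j) x = pd k (pd k (U j)) x - pd j (pd k (U k)) x := by
      intro k
      unfold om
      rw [pd_sub (contDiff_pd k (hU j)) (contDiff_pd j (hU k)), pd_comm (hU k) k j]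
    have e2 : pd j (dv U) x = ∑ k, pd j (pd k (U k)) x := by
      unfold dv
      rw [pd_sum _ fun k => contDiff_pd k (hU k)]
    simp_rw [e, Finset.sum_add_distrib, e1, Finset.sum_sub_distrib]
    simp only [ite_mul, one_mul, zero_mul, Finset.sum_ite_eq', Finset.mem_univ, if_true]
    rw [e2]
    simp [lap]
  · have c2 : |(if k = j then (1 : ℝ) else 0)| ≤ 1 := by split_ifs <;> simp
    refine (abs_add_le _ _).trans ?_
    rw [abs_mul]
    nlinarith [mul_le_mul_of_nonneg_right c2 (abs_nonneg (dv U x)), hB k j x]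

theorem IsSol.src_eq (h : IsSol U P R C) {x : V n} (hx : R < ‖x‖) (j : Fin n) :
    src U P j x = lamb U j x := by
  rw [src, h.lap_eq_head x hx]
  ring

theorem inv_norm_le {x : V n} (hx : 1 ≤ ‖x‖) : 1 / ‖x‖ ≤ 2 * (1 + ‖x‖)⁻¹ := by
  rw [← div_eq_mul_inv, div_le_div_iff₀ (by linarith) (by linarith)]
  linarith

theorem IsDecaying.exists_global_bound (h : IsDecaying U P R C) : ∃ A, 0 ≤ A ∧
    (∀ j x, |U j x| ≤ A * (1 + ‖x‖)⁻¹) ∧ ∀ i j x, |om U i j x| ≤ A * (1 + ‖x‖)⁻¹ := by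
  have hC := h.nonneg
  obtain ⟨M, hM, hM'⟩ := exists_compact_bound (fun j => (h.smooth j).continuous) R 1
  obtain ⟨N, hN, hN'⟩ := exists_compact_bound
    (fun p : Fin n × Fin n => (contDiff_om h.smooth p.1 p.2).continuous) R 1
  refine ⟨4 * C + M + N, by positivity, fun j x => ?_, fun i j x => ?_⟩
  · rcases le_or_gt ‖x‖ R with hx | hx
    · refine (hM' x hx j).trans ?_
      rw [Real.rpow_neg_one]
      gcongr
      linarith
    · refine (h.bound x hx j).trans ?_
      have := inv_norm_le (h.one_le.trans hx.le)
      calc C / ‖x‖ = C * (1 / ‖x‖) := by ring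
        _ ≤ C * (2 * (1 + ‖x‖)⁻¹) := by gcongr
        _ = (2 * C) * (1 + ‖x‖)⁻¹ := by ring
        _ ≤ _ := by gcongr; linarith
  · rcases le_or_gt ‖x‖ R with hx | hx
    · refine (hN' x hx (i, j)).trans ?_
      rw [Real.rpow_neg_one]
      gcongr
      linarith
    · have h1 := h.one_le.trans hx.le
      refine (abs_om_le (h.bound_pd x hx) i j).trans ?_
      have := inv_norm_le h1
      calc 2 * (C / ‖x‖ ^ 2) ≤ 2 * (C / ‖x‖ ^ 1) := by gcongr; simp
        _ = 2 * C * (1 / ‖x‖) := by rw [pow_one]; ring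
        _ ≤ 2 * C * (2 * (1 + ‖x‖)⁻¹) := by gcongr
        _ = (4 * C) * (1 + ‖x‖)⁻¹ := by ring
        _ ≤ _ := by gcongr; linarith

theorem exists_om_step (hn : 3 ≤ n) {a b : ℝ} (ha : 1 < a) (han : a < n) (hb : 1 < b)
    (hbn : b < n) : ∃ K, 0 ≤ K ∧ ∀ (U : Fin n → V n → ℝ) (P : V n → ℝ) A M N,
    (∀ j, ContDiff ℝ ∞ (U j)) → ContDiff ℝ ∞ P → 0 ≤ A → 0 ≤ M → 0 ≤ N →
    (∀ i j x, |om U i j x| ≤ A * (1 + ‖x‖)⁻¹) →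
    (∀ j x, 2 * |src U P j x| ≤ M * (1 + ‖x‖) ^ (-a) + N * (1 + ‖x‖) ^ (-b)) →
    ∀ i j x, |om U i j x| ≤ K * (M * (1 + ‖x‖) ^ (1 - a) + N * (1 + ‖x‖) ^ (1 - b)) := by
  obtain ⟨K, hK, h⟩ := exists_potential_bound_rpow hn ha han hb hbn
  refine ⟨K, hK, fun U P A M N hU hP hA hM hN hom hs i j x => ?_⟩
  obtain ⟨F, hF⟩ := exists_isDivForm_om hU hP hom hs i j
  exact h _ F A M N hA hM hN hF x

theorem exists_velocity_step (hn : 3 ≤ n) {a b : ℝ} (ha : 1 < a) (han : a < n) (hb : 1 < b)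
    (hbn : b < n) : ∃ K, 0 ≤ K ∧ ∀ (U : Fin n → V n → ℝ) A M N,
    (∀ j, ContDiff ℝ ∞ (U j)) → 0 ≤ A → 0 ≤ M → 0 ≤ N → (∀ j x, |U j x| ≤ A * (1 + ‖x‖)⁻¹) →
    (∀ i j x, |om U i j x| + |dv U x| ≤ M * (1 + ‖x‖) ^ (-a) + N * (1 + ‖x‖) ^ (-b)) →
    ∀ j x, |U j x| ≤ K * (M * (1 + ‖x‖) ^ (1 - a) + N * (1 + ‖x‖) ^ (1 - b)) := by
  obtain ⟨K, hK, h⟩ := exists_potential_bound_rpow hn ha han hb hbn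
  refine ⟨K, hK, fun U A M N hU hA hM hN hb hs j x => ?_⟩
  obtain ⟨F, hF⟩ := exists_isDivForm hU hb hs j
  exact h _ F A M N hA hM hN hF x

theorem IsSol.exists_dv_bound (h : IsSol U P R C) (q : ℝ) :
    ∃ M, 0 ≤ M ∧ ∀ x, |dv U x| ≤ M * (1 + ‖x‖) ^ (-q) := by
  obtain ⟨M, hM, hM'⟩ := exists_compact_bound (f := fun _ : Unit => dv U)
    (fun _ => (contDiff_dv h.smooth).continuous) R q
  refine ⟨M, hM, fun x => ?_⟩
  rcases le_or_gt ‖x‖ R with hx | hx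
  · exact hM' x hx ()
  · rw [dv, h.div x hx, abs_zero]
    positivity

theorem IsDecaying.exists_src_bound (h : IsDecaying U P R C) (hn : 4 ≤ n) (q : ℝ) {ε : ℝ}
    (hε : 0 < ε) : ∃ M, 0 ≤ M ∧ ∀ x B, 0 ≤ B → (∀ k, |U k x| ≤ B) → ∀ j,
      |src U P j x| ≤ ε * (B * (1 + ‖x‖) ^ (-2 : ℝ)) + M * (1 + ‖x‖) ^ (-q) := by
  have hn0 : (0 : ℝ) < n := by
    have : 0 < n := by omega
    exact_mod_cast this
  obtain ⟨R', hR, hR'⟩ := h.exists_om_le hn (show 0 < ε / (4 * n) by positivity)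
  obtain ⟨M, hM, hM'⟩ := exists_compact_bound
    (fun j => (contDiff_src h.smooth h.smoothP j).continuous) R' q
  refine ⟨M, hM, fun x B hB hU j => ?_⟩
  rcases le_or_gt ‖x‖ R' with hx | hx
  · exact (hM' x hx j).trans (le_add_of_nonneg_left (by positivity))
  · refine le_trans ?_ (le_add_of_nonneg_right (by positivity))
    have h1 : 1 ≤ ‖x‖ := h.one_le.trans (hR.trans hx.le)
    rw [h.src_eq (hR.trans_lt hx)]
    refine (abs_lamb_le hB hU (hR' x hx.le) j).trans ?_
    have h2 : 1 / ‖x‖ ^ 2 ≤ 4 * (1 + ‖x‖) ^ (-2 : ℝ) := by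
      have e : (1 + ‖x‖) ^ (-2 : ℝ) = 1 / (1 + ‖x‖) ^ 2 := by
        rw [Real.rpow_neg (by positivity), one_div]
        norm_cast
      rw [e, mul_one_div, div_le_div_iff₀ (by positivity) (by positivity)]
      nlinarith
    calc (n : ℝ) * (B * (ε / (4 * n) / ‖x‖ ^ 2)) = ε / 4 * B * (1 / ‖x‖ ^ 2) := by
          field_simp
      _ ≤ ε / 4 * B * (4 * (1 + ‖x‖) ^ (-2 : ℝ)) := by gcongr
      _ = _ := by ring

theorem IsDecaying.exists_improved_decay (h : IsDecaying U P R C) (hn : 4 ≤ n) :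
    ∃ D, 0 ≤ D ∧ (∀ j x, |U j x| ≤ D * (1 + ‖x‖) ^ ((9 : ℝ) / 4 - n)) ∧
      ∀ i j x, |om U i j x| ≤ D * (1 + ‖x‖) ^ ((5 : ℝ) / 4 - n) := by
  have hn' : (4 : ℝ) ≤ n := by exact_mod_cast hn
  obtain ⟨A, hA, hAU, hAom⟩ := h.exists_global_bound
  obtain ⟨K₁, hK₁, hom⟩ := exists_om_step (n := n) (by omega) (a := (n : ℝ) - 1 / 4) (b := 3)
    (by linarith) (by linarith) (by linarith) (by linarith)
  obtain ⟨K₂, hK₂, hvel⟩ := exists_velocity_step (n := n) (by omega) (a := (n : ℝ) - 5 / 4) (b := 2)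
    (by linarith) (by linarith) (by linarith) (by linarith)
  obtain ⟨M₂, hM₂, hdv⟩ := h.exists_dv_bound ((n : ℝ) - 5 / 4)
  obtain ⟨ε, hεd⟩ : ∃ ε, ε = 1 / (4 * K₁ * K₂ + 1) := ⟨_, rfl⟩
  have hε : 0 < ε := by rw [hεd]; positivity
  have hεK : 2 * ε * K₁ * K₂ ≤ 1 / 2 := by
    rw [hεd, mul_one_div, div_mul_eq_mul_div, div_mul_eq_mul_div, div_le_iff₀ (by positivity)]
    nlinarith [mul_nonneg hK₁ hK₂]
  obtain ⟨M₁, hM₁, hsrc⟩ := h.exists_src_bound hn ((n : ℝ) - 1 / 4) hε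
  have step1 : ∀ N κ : ℝ, 0 ≤ N → 0 ≤ κ → (∀ j x, |U j x| ≤
      N * ((1 + ‖x‖) ^ ((9 : ℝ) / 4 - n) + κ * (1 + ‖x‖) ^ (-1 : ℝ))) → ∀ i j x,
      |om U i j x| ≤ K₁ * (2 * ε * N + 2 * M₁) *
        ((1 + ‖x‖) ^ ((5 : ℝ) / 4 - n) + κ * (1 + ‖x‖) ^ (-2 : ℝ)) := by
    intro N κ hN hκ hU i j x
    have h1 := hom U P A (2 * ε * N + 2 * M₁) ((2 * ε * N + 2 * M₁) * κ) h.smooth h.smoothP hA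
      (by positivity) (by positivity) hAom (fun j x => ?_) i j x
    · rw [show 1 - ((n : ℝ) - 1 / 4) = 5 / 4 - n by ring, show (1 : ℝ) - 3 = -2 by norm_num] at h1
      refine h1.trans_eq ?_
      ring
    · have hx : 0 < 1 + ‖x‖ := by positivity
      have h2 := hsrc x _ (by positivity) (fun k => hU k x) j
      have e1 : (1 + ‖x‖) ^ (-((n : ℝ) - 1 / 4)) =
          (1 + ‖x‖) ^ ((9 : ℝ) / 4 - n) * (1 + ‖x‖) ^ (-2 : ℝ) := by
        rw [← Real.rpow_add hx]
        congr 1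
        ring
      have e2 : (1 + ‖x‖) ^ (-3 : ℝ) = (1 + ‖x‖) ^ (-1 : ℝ) * (1 + ‖x‖) ^ (-2 : ℝ) := by
        rw [← Real.rpow_add hx]
        norm_num
      have q2 : 0 ≤ M₁ * κ * (1 + ‖x‖) ^ (-3 : ℝ) := by positivity
      rw [e1] at h2 ⊢
      rw [e2] at q2 ⊢
      linarith
  have step2 : ∀ N κ : ℝ, 0 ≤ N → 0 ≤ κ → (∀ j x, |U j x| ≤
      N * ((1 + ‖x‖) ^ ((9 : ℝ) / 4 - n) + κ * (1 + ‖x‖) ^ (-1 : ℝ))) → ∀ j x,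
      |U j x| ≤ (N / 2 + K₂ * (2 * K₁ * M₁ + M₂)) *
        ((1 + ‖x‖) ^ ((9 : ℝ) / 4 - n) + κ * (1 + ‖x‖) ^ (-1 : ℝ)) := by
    intro N κ hN hκ hU j x
    have h1 := hvel U A (K₁ * (2 * ε * N + 2 * M₁) + M₂) ((K₁ * (2 * ε * N + 2 * M₁) + M₂) * κ)
      h.smooth hA (by positivity) (by positivity) hAU (fun i j x => ?_) j x
    · rw [show 1 - ((n : ℝ) - 5 / 4) = 9 / 4 - n by ring, show (1 : ℝ) - 2 = -1 by norm_num] at h1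
      calc |U j x| ≤ _ := h1
        _ = (2 * ε * K₁ * K₂ * N + K₂ * (2 * K₁ * M₁ + M₂)) *
          ((1 + ‖x‖) ^ ((9 : ℝ) / 4 - n) + κ * (1 + ‖x‖) ^ (-1 : ℝ)) := by ring
        _ ≤ (1 / 2 * N + K₂ * (2 * K₁ * M₁ + M₂)) *
          ((1 + ‖x‖) ^ ((9 : ℝ) / 4 - n) + κ * (1 + ‖x‖) ^ (-1 : ℝ)) := by gcongr
        _ = _ := by ring
    · have h2 := step1 N κ hN hκ hU i j x
      have h3 := hdv x
      rw [neg_sub] at h3 ⊢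
      have q2 : 0 ≤ M₂ * κ * (1 + ‖x‖) ^ (-2 : ℝ) := by positivity
      linarith
  obtain ⟨D, hD⟩ : ∃ D, D = 2 * (K₂ * (2 * K₁ * M₁ + M₂)) := ⟨_, rfl⟩
  have hD0 : 0 ≤ D := by rw [hD]; positivity
  have iter : ∀ κ : ℝ, 0 < κ → ∀ m : ℕ, ∀ j x, |U j x| ≤ (A / κ * (1 / 2) ^ m + D) *
      ((1 + ‖x‖) ^ ((9 : ℝ) / 4 - n) + κ * (1 + ‖x‖) ^ (-1 : ℝ)) := by
    intro κ hκ m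
    induction m with
    | zero =>
      intro j x
      have h1 := hAU j x
      rw [← Real.rpow_neg_one] at h1
      calc |U j x| ≤ A * (1 + ‖x‖) ^ (-1 : ℝ) := h1
        _ = (A / κ * (1 / 2) ^ 0 + 0) * (0 + κ * (1 + ‖x‖) ^ (-1 : ℝ)) := by field_simp; ring
        _ ≤ _ := by gcongr; positivity
    | succ m ih =>
      intro j x
      refine (step2 _ κ (by positivity) hκ.le ih j x).trans_eq ?_
      rw [hD, pow_succ]
      ring
  have lim1 : ∀ κ : ℝ, 0 < κ → ∀ j x, |U j x| ≤ D *
      ((1 + ‖x‖) ^ ((9 : ℝ) / 4 - n) + κ * (1 + ‖x‖) ^ (-1 : ℝ)) := by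
    intro κ hκ j x
    have t : Tendsto (fun m : ℕ => (A / κ * (1 / 2) ^ m + D) *
        ((1 + ‖x‖) ^ ((9 : ℝ) / 4 - n) + κ * (1 + ‖x‖) ^ (-1 : ℝ))) atTop (𝓝 ((A / κ * 0 + D) *
        ((1 + ‖x‖) ^ ((9 : ℝ) / 4 - n) + κ * (1 + ‖x‖) ^ (-1 : ℝ)))) :=
      (((tendsto_pow_atTop_nhds_zero_of_lt_one (by norm_num) (by norm_num)).const_mul _).add_const
        _).mul_const _
    rw [mul_zero, zero_add] at t
    exact ge_of_tendsto t (Eventually.of_forall fun m => iter κ hκ m j x)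
  have lim2 : ∀ j x, |U j x| ≤ D *
      ((1 + ‖x‖) ^ ((9 : ℝ) / 4 - n) + 0 * (1 + ‖x‖) ^ (-1 : ℝ)) := by
    intro j x
    have t : Tendsto (fun κ : ℝ => D * ((1 + ‖x‖) ^ ((9 : ℝ) / 4 - n) +
        κ * (1 + ‖x‖) ^ (-1 : ℝ))) (𝓝[>] 0) (𝓝 (D * ((1 + ‖x‖) ^ ((9 : ℝ) / 4 - n) +
        0 * (1 + ‖x‖) ^ (-1 : ℝ)))) :=
      ((((continuous_id.mul continuous_const).const_add _).const_mul D).tendsto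
        (0 : ℝ)).mono_left nhdsWithin_le_nhds
    exact ge_of_tendsto t (eventually_nhdsWithin_of_forall fun κ hκ => lim1 κ hκ j x)
  have hom' := step1 D 0 hD0 le_rfl lim2
  refine ⟨D + K₁ * (2 * ε * D + 2 * M₁), by positivity, fun j x => (lim2 j x).trans ?_,
    fun i j x => (hom' i j x).trans ?_⟩
  · rw [zero_mul, add_zero]
    refine mul_le_mul_of_nonneg_right (le_add_of_nonneg_right (by positivity)) (by positivity)
  · rw [zero_mul, add_zero]
    refine mul_le_mul_of_nonneg_right (le_add_of_nonneg_left hD0) (by positivity)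

theorem IsDecaying.exists_optimal_decay (h : IsDecaying U P R C) (hn : 4 ≤ n) :
    ∃ D, 0 ≤ D ∧ ∀ j x, |U j x| ≤ D * (1 + ‖x‖) ^ (2 - (n : ℝ)) := by
  have hn' : (4 : ℝ) ≤ n := by exact_mod_cast hn
  obtain ⟨A, hA, hAU, hAom⟩ := h.exists_global_bound
  obtain ⟨D, hD, hDU, hDom⟩ := h.exists_improved_decay hn
  obtain ⟨M, hM, hM'⟩ := exists_compact_bound
    (fun j => (contDiff_src h.smooth h.smoothP j).continuous) R (2 * n - 7 / 2)
  obtain ⟨M₂, hM₂, hdv⟩ := h.exists_dv_bound ((n : ℝ) - 1)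
  obtain ⟨K₁, hK₁, hp⟩ := exists_potential_bound_of_lt (n := n) (by omega)
    (a := 2 * n - 7 / 2) (by linarith)
  obtain ⟨K₂, hK₂, hvel⟩ := exists_velocity_step (n := n) (by omega) (a := (n : ℝ) - 1) (b := 2)
    (by linarith) (by linarith) (by linarith) (by linarith)
  have hs : ∀ j x, 2 * |src U P j x| ≤ 2 * (M + n * (D * D)) * (1 + ‖x‖) ^ (-(2 * (n : ℝ) - 7 / 2)) := by
    intro j x
    rw [mul_assoc]
    refine mul_le_mul_of_nonneg_left ?_ zero_le_two
    rcases le_or_gt ‖x‖ R with hx | hx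
    · refine (hM' x hx j).trans ?_
      gcongr
      exact le_add_of_nonneg_right (by positivity)
    · rw [h.src_eq hx]
      refine (abs_lamb_le (by positivity) (fun k => hDU k x) (fun i j => hDom i j x) j).trans ?_
      have e : (1 + ‖x‖) ^ (-(2 * (n : ℝ) - 7 / 2)) =
          (1 + ‖x‖) ^ ((9 : ℝ) / 4 - n) * (1 + ‖x‖) ^ ((5 : ℝ) / 4 - n) := by
        rw [← Real.rpow_add (by positivity)]
        congr 1
        ring
      rw [e]
      have : 0 ≤ M * ((1 + ‖x‖) ^ ((9 : ℝ) / 4 - n) * (1 + ‖x‖) ^ ((5 : ℝ) / 4 - n)) := by positivity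
      linarith
  have hom : ∀ i j x, |om U i j x| ≤
      K₁ * (2 * (M + n * (D * D)) * (1 + ‖x‖) ^ (1 - (n : ℝ))) := by
    intro i j x
    obtain ⟨F, hF⟩ := exists_isDivForm_om h.smooth h.smoothP hAom hs i j
    exact hp _ F A _ hA (by positivity) hF x
  refine ⟨K₂ * (K₁ * (2 * (M + n * (D * D))) + M₂), by positivity, fun j x => ?_⟩
  have h1 := hvel U A (K₁ * (2 * (M + n * (D * D))) + M₂) 0 h.smooth hA (by positivity) le_rfl hAU
    (fun i j x => ?_) j x
  · refine h1.trans_eq ?_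
    rw [zero_mul, add_zero, ← mul_assoc, show 1 - ((n : ℝ) - 1) = 2 - n by ring]
  · have h2 := hdv x
    rw [neg_sub] at h2 ⊢
    linarith [hom i j x]

end Bootstrap

section Extension

variable {n : ℕ}

theorem exists_smooth_extension {f : V n → ℝ} (hf : ContDiffOn ℝ ∞ f {x : V n | 1 < ‖x‖}) :
    ∃ g : V n → ℝ, ContDiff ℝ ∞ g ∧ ∀ x, 2 < ‖x‖ → g x = f x := by
  refine ⟨fun x => (1 - th (‖x‖ ^ 2 / 2)) * f x, contDiff_iff_contDiffAt.2 fun x => ?_,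
    fun x hx => ?_⟩
  · rcases lt_or_ge 1 ‖x‖ with hx | hx
    · have h1 : ContDiff ℝ ∞ (fun x : V n => 1 - th (‖x‖ ^ 2 / 2)) :=
        contDiff_const.sub (contDiff_th.comp (contDiff_norm_sq'.div_const 2))
      exact h1.contDiffAt.mul (hf.contDiffAt ((isOpen_ext 1).mem_nhds hx))
    · have h1 : (fun x : V n => (1 - th (‖x‖ ^ 2 / 2)) * f x) =ᶠ[𝓝 x] fun _ => 0 := by
        have : ∀ᶠ y : V n in 𝓝 x, ‖y‖ ^ 2 < 2 :=
          (continuous_norm.pow 2).continuousAt.eventually_lt_const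
            (show ‖x‖ ^ 2 < 2 by nlinarith [norm_nonneg x])
        filter_upwards [this] with y hy
        rw [th_eq_one (show ‖y‖ ^ 2 / 2 ≤ 1 by have : ‖y‖ ^ 2 < 2 := hy; linarith), sub_self,
          zero_mul]
      exact contDiffAt_const.congr_of_eventuallyEq h1
  · beta_reduce
    rw [th_eq_zero (by nlinarith), sub_zero, one_mul]

end Extension

theorem exists_exterior_decay_bound {n : ℕ} (hn : 4 ≤ n)
    (u : EuclideanSpace ℝ (Fin n) → EuclideanSpace ℝ (Fin n))
    (p : EuclideanSpace ℝ (Fin n) → ℝ)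
    (hu : ContDiffOn ℝ (⊤ : ℕ∞) u {x : EuclideanSpace ℝ (Fin n) | 1 < ‖x‖})
    (hp : ContDiffOn ℝ (⊤ : ℕ∞) p {x : EuclideanSpace ℝ (Fin n) | 1 < ‖x‖})
    (hNS : ∀ x : EuclideanSpace ℝ (Fin n), 1 < ‖x‖ → ∀ j : Fin n,
      -(∑ i : Fin n, fderiv ℝ (fun y => fderiv ℝ (fun z => u z j) y
            (EuclideanSpace.single i 1)) x (EuclideanSpace.single i 1)) +
        (∑ i : Fin n, u x i * fderiv ℝ (fun z => u z j) x (EuclideanSpace.single i 1)) +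
        fderiv ℝ p x (EuclideanSpace.single j 1) = 0)
    (hdiv : ∀ x : EuclideanSpace ℝ (Fin n), 1 < ‖x‖ →
      ∑ i : Fin n, fderiv ℝ (fun z => u z i) x (EuclideanSpace.single i 1) = 0)
    (C : ℝ) (hC : 0 < C)
    (hbound : ∀ x : EuclideanSpace ℝ (Fin n), 1 ≤ ‖x‖ → ‖u x‖ ≤ C / ‖x‖) :
    ∃ C' : ℝ, 0 < C' ∧
      ∀ x : EuclideanSpace ℝ (Fin n), 1 ≤ ‖x‖ → ‖u x‖ ≤ C' / ‖x‖ ^ (n - 2) := by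
  have hex : ∀ j, ∃ g : V n → ℝ, ContDiff ℝ ∞ g ∧ ∀ x, 2 < ‖x‖ → g x = u x j := fun j =>
    exists_smooth_extension (f := fun x => u x j) (contDiffOn_euclidean.1 hu j)
  choose U hU hUu using hex
  obtain ⟨P, hP, hPp⟩ := exists_smooth_extension hp
  have hpd : ∀ j i x, 2 < ‖x‖ → pd i (U j) x = pd i (fun z => u z j) x := fun j i x hx =>
    pd_congr (isOpen_ext 2) (fun y hy => hUu j y hy) i x hx
  have hsol : IsSol U P 2 C :=
    { smooth := hU
      smoothP := hP
      one_le := one_le_two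
      nonneg := hC.le
      mom := fun x hx j => by
        have h1 := hNS x (by linarith) j
        have h2 : ∀ i, pd i (pd i (U j)) x = pd i (pd i (fun z => u z j)) x := fun i =>
          pd_congr (isOpen_ext 2) (fun y hy => hpd j i y hy) i x hx
        have h3 : pd j P x = pd j p x := pd_congr (isOpen_ext 2) (fun y hy => hPp y hy) j x hx
        unfold lap
        simp_rw [h2, hpd j _ x hx, hUu _ x hx, h3]
        unfold pd
        linarith
      div := fun x hx => by
        have h1 := hdiv x (by linarith)
        rw [← h1]
        exact Finset.sum_congr rfl fun i _ => hpd i i x hx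
      bound := fun x hx j => by
        rw [hUu j x hx]
        exact (PiLp.norm_apply_le (u x) j).trans (hbound x (by linarith)) }
  obtain ⟨P', R, C₁, -, hdec⟩ := hsol.exists_isDecaying (by omega)
  obtain ⟨D, hD, hUD⟩ := hdec.exists_optimal_decay hn
  have hpos : ∀ x : V n, 1 ≤ ‖x‖ → 0 < ‖x‖ ^ (n - 2) := fun x hx => by positivity
  refine ⟨n * D + C * 2 ^ (n - 2), by positivity, fun x hx => ?_⟩
  have hx0 : 0 < ‖x‖ := by linarith
  rcases le_or_gt ‖x‖ 2 with h2 | h2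
  · rw [le_div_iff₀ (hpos x hx)]
    calc ‖u x‖ * ‖x‖ ^ (n - 2) ≤ C * 2 ^ (n - 2) := by
          gcongr
          exact (hbound x hx).trans (div_le_self hC.le hx)
      _ ≤ _ := le_add_of_nonneg_left (by positivity)
  · have h3 : ∀ j, |u x j| ≤ D / ‖x‖ ^ (n - 2) := fun j => by
      rw [← hUu j x h2]
      refine (hUD j x).trans ?_
      rw [div_eq_mul_inv]
      refine mul_le_mul_of_nonneg_left ?_ hD
      have e : (‖x‖ ^ (n - 2))⁻¹ = ‖x‖ ^ (2 - (n : ℝ)) := by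
        rw [← Real.rpow_natCast, ← Real.rpow_neg hx0.le, Nat.cast_sub (by omega)]
        push_cast
        rw [neg_sub]
      rw [e]
      have hn' : (4 : ℝ) ≤ n := by exact_mod_cast hn
      exact Real.rpow_le_rpow_of_nonpos hx0 (by linarith) (by linarith)
    have h4 : ‖u x‖ ≤ ∑ j, |u x j| := by
      rw [EuclideanSpace.norm_eq]
      refine (Real.sqrt_le_left (by positivity)).2 ?_
      simp only [Real.norm_eq_abs]
      exact Finset.sum_sq_le_sq_sum_of_nonneg fun j _ => abs_nonneg _
    refine h4.trans ((sum_le_card_mul _ h3).trans ?_)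
    rw [← mul_div_assoc]
    gcongr
    exact le_add_of_nonneg_right (by positivity)

end SteadyNS

/-- **Optimal decay in exterior domains, n ≥ 4.**
If `(u, p)` is a smooth solution of the steady Navier-Stokes equations on
`ℝⁿ \ closedBall 0 1`, `n ≥ 4`, and `|u(x)| ≤ C/|x|` for `|x| ≥ 1`, then there is a
constant `C̃ > 0` with `|u(x)| ≤ C̃/|x|^{n-2}` for all `|x| ≥ 1`. -/
theorem steady_NS_exterior_optimal_decay {n : ℕ} (hn : 4 ≤ n)
    (u : EuclideanSpace ℝ (Fin n) → EuclideanSpace ℝ (Fin n))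
    (p : EuclideanSpace ℝ (Fin n) → ℝ)
    (hu : ContDiffOn ℝ (⊤ : ℕ∞) u {x : EuclideanSpace ℝ (Fin n) | 1 < ‖x‖})
    (hp : ContDiffOn ℝ (⊤ : ℕ∞) p {x : EuclideanSpace ℝ (Fin n) | 1 < ‖x‖})
    (hNS : ∀ x : EuclideanSpace ℝ (Fin n), 1 < ‖x‖ → ∀ j : Fin n,
      -(∑ i : Fin n, fderiv ℝ (fun y => fderiv ℝ (fun z => u z j) y
            (EuclideanSpace.single i 1)) x (EuclideanSpace.single i 1)) +
        (∑ i : Fin n, u x i * fderiv ℝ (fun z => u z j) x (EuclideanSpace.single i 1)) +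
        fderiv ℝ p x (EuclideanSpace.single j 1) = 0)
    (hdiv : ∀ x : EuclideanSpace ℝ (Fin n), 1 < ‖x‖ →
      ∑ i : Fin n, fderiv ℝ (fun z => u z i) x (EuclideanSpace.single i 1) = 0)
    (C : ℝ) (hC : 0 < C)
    (hbound : ∀ x : EuclideanSpace ℝ (Fin n), 1 ≤ ‖x‖ → ‖u x‖ ≤ C / ‖x‖) :
    ∃ C' : ℝ, 0 < C' ∧
      ∀ x : EuclideanSpace ℝ (Fin n), 1 ≤ ‖x‖ → ‖u x‖ ≤ C' / ‖x‖ ^ (n - 2) := by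
  exact SteadyNS.exists_exterior_decay_bound hn u p hu hp hNS hdiv C hC hbound
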